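/- Fix α > 1. For every ε > 0 there is a constant K = K(α,ε) > 0 such that for all R > 0, the number of E-reduced quadratic irrationals ω with ω ≥ α and ϱ_E(ω) ≤ R satisfies |#{ω ∈ ℛ_E : ω ≥ α, ϱ_E(ω) ≤ R} − (e^R/π²)·log((α+1)/(α−1))| ≤ K·e^{(3/4+ε)R}. (Here log((α+1)/(α−1)) = ∫_α^∞ 2du/((u−1)(u+1)), the μ_E-measure of [α,∞).) -/

import Mathlib

noncomputable section

/-- `ω'` is the conjugate of the quadratic irrational `ω`: both are roots of the
minimal integer polynomial `A X^2 + B X + C` of `ω` (with `A > 0`, `gcd(A,B,C) = 1`),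
and `ω' ≠ ω`. -/
def IsConjPair (ω ω' : ℝ) : Prop :=
  Irrational ω ∧ ∃ A B C : ℤ, 0 < A ∧ Int.gcd (Int.gcd A B : ℤ) C = 1 ∧
    (A : ℝ) * ω ^ 2 + B * ω + C = 0 ∧ (A : ℝ) * ω' ^ 2 + B * ω' + C = 0 ∧ ω' ≠ ω

/-- The quadratic irrational `ω` has discriminant `Δ = B^2 - 4AC`, where
`A X^2 + B X + C` is its minimal integer polynomial (`A > 0`, `gcd(A,B,C) = 1`). -/
def HasDisc (ω : ℝ) (Δ : ℤ) : Prop :=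
  Irrational ω ∧ ∃ A B C : ℤ, 0 < A ∧ Int.gcd (Int.gcd A B : ℤ) C = 1 ∧
    (A : ℝ) * ω ^ 2 + B * ω + C = 0 ∧ Δ = B ^ 2 - 4 * A * C

/-- The matrix `M(a,e) = (a, e; 1, 0)`. -/
def Mmat (a e : ℤ) : Matrix (Fin 2) (Fin 2) ℤ := !![a, e; 1, 0]

/-- The spectral radius of a 2x2 integer matrix with trace `t`, namely
`(t + sqrt (t^2 - 4)) / 2`. -/
def specRad (σ : Matrix (Fin 2) (Fin 2) ℤ) : ℝ :=
  ((σ.trace : ℝ) + Real.sqrt ((σ.trace : ℝ) ^ 2 - 4)) / 2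

/-- First ECF digit: `a₁(u) = 2⎣(u+1)/2⎦`. -/
def aE (u : ℝ) : ℤ := 2 * ⌊(u + 1) / 2⌋

/-- Sign digit: `e₁(u) = sgn (u - a₁(u)) ∈ {±1}`. -/
def eE (u : ℝ) : ℤ := if (aE u : ℝ) < u then 1 else -1

/-- The ECF Gauss shift `T_E(u) = e₁(u) / (u - a₁(u))`. -/
def TE (u : ℝ) : ℝ := (eE u : ℝ) / (u - aE u)

/-- The least period of `ω` under `T_E` (junk value `0` if `ω` is not periodic). -/
def perE (ω : ℝ) : ℕ := sInf {n : ℕ | 0 < n ∧ TE^[n] ω = ω}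

/-- `Ω_E(ω) = M(a₁,e₁) ⋯ M(aₙ,eₙ)`, where `n = per(ω)` and `(aᵢ, eᵢ)` are the
ECF digits of `ω`. -/
def OmegaE (ω : ℝ) : Matrix (Fin 2) (Fin 2) ℤ :=
  ((List.range (perE ω)).map (fun i => Mmat (aE (TE^[i] ω)) (eE (TE^[i] ω)))).prod

/-- `Ω̃_E(ω)`: equal to `Ω_E(ω)` if `det Ω_E(ω) = 1`, and to `Ω_E(ω)²` otherwise. -/
def OmegaTildeE (ω : ℝ) : Matrix (Fin 2) (Fin 2) ℤ :=
  if (OmegaE ω).det = 1 then OmegaE ω else OmegaE ω ^ 2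

/-- The length `ϱ_E(ω) = 2 log 𝔯(Ω̃_E(ω))`. -/
def rhoE (ω : ℝ) : ℝ := 2 * Real.log (specRad (OmegaTildeE ω))


section ModA1

open Polynomial

namespace KL

section Stepanov

variable {F : Type*} [Field F]

lemma exists_w (f : F[X]) (n : ℕ) : ∀ i : ℕ,
    ∃ w : F[X], w.natDegree ≤ i * (f.natDegree - 1) ∧
      f ^ i * hasseDeriv i (f ^ n) = f ^ n * w := by
  induction n with
  | zero =>
    intro i
    rcases Nat.eq_zero_or_pos i with rfl | hi
    · exact ⟨1, by simp, by simp⟩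
    · refine ⟨0, by simp, ?_⟩
      rw [pow_zero, ← C_1, hasseDeriv_C i 1 hi]; simp
  | succ n ih =>
    intro i
    choose w hw1 hw2 using ih
    let w1 : ℕ → F[X] := fun b => if b = 0 then 1 else f ^ (b - 1) * hasseDeriv b f
    have hw1b : ∀ b, f ^ b * hasseDeriv b f = f * w1 b := by
      intro b
      rcases Nat.eq_zero_or_pos b with rfl | hb
      · simp [w1]
      · simp only [w1, if_neg hb.ne']
        rw [← mul_assoc, ← pow_succ', Nat.sub_add_cancel hb]
    have hdeg : ∀ b, (w1 b).natDegree ≤ b * (f.natDegree - 1) := by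
      intro b
      rcases Nat.eq_zero_or_pos b with rfl | hb
      · simp [w1]
      · simp only [w1, if_neg hb.ne']
        by_cases hh : f.natDegree < b
        · have : hasseDeriv b f = 0 := hasseDeriv_eq_zero_of_lt_natDegree f b hh
          simp [this]
        push Not at hh
        refine natDegree_mul_le.trans ?_
        have h1 := natDegree_pow_le (p := f) (n := b - 1)
        have h2 := natDegree_hasseDeriv_le f b
        obtain ⟨m, hm⟩ : ∃ m, f.natDegree = m + 1 := ⟨f.natDegree - 1, by omega⟩
        obtain ⟨c, rfl⟩ : ∃ c, b = c + 1 := ⟨b - 1, by omega⟩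
        rw [hm] at h1 h2 ⊢
        simp only [Nat.add_sub_cancel] at *
        have : c * (m + 1) + (m + 1 - (c + 1)) ≤ (c + 1) * m := by
          have : m + 1 - (c + 1) = m - c := by omega
          rw [this]; have : c ≤ m := by omega
          obtain ⟨e, rfl⟩ := Nat.exists_eq_add_of_le this
          simp; ring_nf; omega
        omega
    refine ⟨∑ ij ∈ Finset.HasAntidiagonal.antidiagonal i, w ij.1 * w1 ij.2, ?_, ?_⟩
    · refine natDegree_sum_le_of_forall_le _ _ ?_
      intro ij hij
      rw [Finset.HasAntidiagonal.mem_antidiagonal] at hij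
      refine natDegree_mul_le.trans ?_
      have := hw1 ij.1
      have := hdeg ij.2
      rw [← hij, add_mul]; omega
    · rw [pow_succ, hasseDeriv_mul, Finset.mul_sum, Finset.mul_sum]
      refine Finset.sum_congr rfl ?_
      intro ij hij
      rw [Finset.HasAntidiagonal.mem_antidiagonal] at hij
      rw [← hij, pow_add]
      linear_combination (f ^ ij.2 * hasseDeriv ij.2 f) * hw2 ij.1 + f ^ n * w ij.1 * hw1b ij.2

/-- twisted derivative -/
noncomputable def Dop (f : F[X]) (w : ℕ → F[X]) (k : ℕ) : F[X] →ₗ[F] F[X] :=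
  ∑ ij ∈ Finset.HasAntidiagonal.antidiagonal k, (LinearMap.mulLeft F (w ij.1 * f ^ ij.2)) ∘ₗ (hasseDeriv ij.2)

lemma Dop_apply (f : F[X]) (w : ℕ → F[X]) (k : ℕ) (r : F[X]) :
    Dop f w k r = ∑ ij ∈ Finset.HasAntidiagonal.antidiagonal k, w ij.1 * f ^ ij.2 * hasseDeriv ij.2 r := by
  simp [Dop, mul_assoc]

lemma natDegree_pow_mul_hasse (f : F[X]) (hf : 1 ≤ f.natDegree) (k D : ℕ) (r : F[X])
    (hr : r.natDegree < D) :
    (f ^ k * hasseDeriv k r).natDegree < D + k * (f.natDegree - 1) := by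
  by_cases hh : r.natDegree < k
  · have : hasseDeriv k r = 0 := hasseDeriv_eq_zero_of_lt_natDegree r k hh
    simp [this]; omega
  refine lt_of_le_of_lt natDegree_mul_le ?_
  have h1 := natDegree_pow_le (p := f) (n := k)
  have h2 := natDegree_hasseDeriv_le r k
  obtain ⟨m, hm⟩ : ∃ m, f.natDegree = m + 1 := ⟨f.natDegree - 1, by omega⟩
  rw [hm] at h1 ⊢
  simp only [Nat.add_sub_cancel]
  rw [mul_add] at h1
  omega

lemma natDegree_Dop (f : F[X]) (hf : 1 ≤ f.natDegree) (w : ℕ → F[X])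
    (hw : ∀ i, (w i).natDegree ≤ i * (f.natDegree - 1)) (k D : ℕ) (r : F[X])
    (hr : r.natDegree < D) : (Dop f w k r).natDegree < D + k * (f.natDegree - 1) := by
  rw [Dop_apply]
  have : (∑ ij ∈ Finset.HasAntidiagonal.antidiagonal k, w ij.1 * f ^ ij.2 * hasseDeriv ij.2 r).natDegree ≤
      D + k * (f.natDegree - 1) - 1 := by
    refine natDegree_sum_le_of_forall_le _ _ ?_
    intro ij hij
    rw [Finset.HasAntidiagonal.mem_antidiagonal] at hij
    rw [mul_assoc]
    refine natDegree_mul_le.trans ?_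
    have h1 := natDegree_pow_mul_hasse f hf ij.2 D r hr
    have h2 := hw ij.1
    rw [← hij, add_mul]; omega
  omega

lemma Dop_spec (f : F[X]) (w : ℕ → F[X]) (n : ℕ)
    (hw : ∀ i, f ^ i * hasseDeriv i (f ^ n) = f ^ n * w i) (k : ℕ) (r : F[X]) :
    f ^ k * hasseDeriv k (f ^ n * r) = f ^ n * Dop f w k r := by
  rw [Dop_apply, hasseDeriv_mul, Finset.mul_sum, Finset.mul_sum]
  refine Finset.sum_congr rfl ?_
  intro ij hij
  rw [Finset.HasAntidiagonal.mem_antidiagonal] at hij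
  rw [← hij, pow_add]
  linear_combination (f ^ ij.2 * hasseDeriv ij.2 r) * hw ij.1

lemma no_square_rel (f : F[X]) (hsq : Squarefree f) (hf : 1 ≤ f.natDegree) (c : F) (hc : c ≠ 0) :
    ∀ (n : ℕ) (r s : F[X]), r.natDegree ≤ n → r ^ 2 * f = C c * s ^ 2 → r = 0 := by
  intro n
  induction n using Nat.strong_induction_on with
  | _ n ih =>
  intro r s hn h
  by_contra hr
  have hf0 : f ≠ 0 := by rintro rfl; simp at hf
  have hCu : IsUnit (C c : F[X]) := by rw [isUnit_C]; exact hc.isUnit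
  have h1 : f ∣ s ^ 2 := by
    have : f ∣ C c * s ^ 2 := ⟨r ^ 2, by rw [← h]; ring⟩
    exact (hCu.dvd_mul_left).1 this
  have h2 : f ∣ s := (hsq.dvd_pow_iff_dvd (by norm_num)).1 h1
  obtain ⟨s1, rfl⟩ := h2
  have h3 : r ^ 2 = C c * (f * s1 ^ 2) := by
    apply mul_right_cancel₀ hf0
    rw [h]; ring
  have h4 : f ∣ r := (hsq.dvd_pow_iff_dvd (n := 2) (by norm_num)).1 ⟨C c * s1 ^ 2, by rw [h3]; ring⟩
  obtain ⟨r1, rfl⟩ := h4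
  have h5 : r1 ^ 2 * f = C c * s1 ^ 2 := by
    apply mul_right_cancel₀ hf0
    linear_combination h3
  have hr1 : r1 ≠ 0 := by rintro rfl; simp at hr
  have hd : (f * r1).natDegree = f.natDegree + r1.natDegree := natDegree_mul hf0 hr1
  exact hr1 (ih r1.natDegree (by omega) r1 s1 le_rfl h5)

lemma pow_dvd_of_taylor (P : F[X]) (x : F) (l : ℕ) (h : X ^ l ∣ taylor x P) :
    (X - C x) ^ l ∣ P := by
  obtain ⟨u, hu⟩ := h
  refine ⟨taylor (-x) u, ?_⟩
  have : taylor (-x) (taylor x P) = taylor (-x) (X ^ l * u) := by rw [hu]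
  rw [taylor_taylor] at this
  simp only [neg_add_cancel, taylor_zero', LinearMap.id_apply, taylor_mul, taylor_pow, taylor_X] at this
  rw [C_neg, ← sub_eq_add_neg] at this
  exact this

variable [Fintype F]

lemma aux_vanish (f : F[X]) (w : ℕ → F[X]) (n : ℕ)
    (hw : ∀ i, f ^ i * hasseDeriv i (f ^ n) = f ^ n * w i) (J l : ℕ)
    (hl : l ≤ Fintype.card F) (a : F) (r s : Fin J → F[X])
    (hQ : ∀ k < l, ∑ j, (f ^ k * hasseDeriv k (r j) + a • Dop f w k (s j)) * X ^ (j : ℕ) = 0)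
    (x : F) (hx : (f ^ n).eval x = a) (hfx : f.eval x ≠ 0) :
    (X - C x) ^ l ∣ ∑ j, (r j + f ^ n * s j) * X ^ ((j : ℕ) * Fintype.card F) := by
  obtain ⟨p, hp⟩ := CharP.exists F
  obtain ⟨e, hpp, hcard⟩ := FiniteField.card F p
  haveI : Fact p.Prime := ⟨hpp⟩
  apply pow_dvd_of_taylor
  have h1 : ∀ j : ℕ, X ^ l ∣ taylor x (X ^ (j * Fintype.card F) : F[X]) - C (x ^ j) := by
    intro j
    have hX : taylor x (X ^ (Fintype.card F) : F[X]) = X ^ (Fintype.card F) + C x := by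
      rw [taylor_pow, taylor_X, hcard, add_pow_char_pow, ← C_pow, ← hcard, FiniteField.pow_card]
    have h2 : taylor x (X ^ (j * Fintype.card F) : F[X]) = (X ^ (Fintype.card F) + C x) ^ j := by
      rw [mul_comm, pow_mul, taylor_pow, hX]
    rw [h2, C_pow]
    refine (pow_dvd_pow X hl).trans ?_
    have := sub_dvd_pow_sub_pow (X ^ (Fintype.card F) + C x) (C x) j
    simpa using this
  have h2 : X ^ l ∣ taylor x (∑ j, (r j + f ^ n * s j) * C (x ^ (j : ℕ))) := by
    rw [X_pow_dvd_iff]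
    intro k hk
    rw [taylor_coeff]
    have h3 := congrArg (eval x) (hQ k hk)
    have h4 : (f.eval x) ^ k * eval x (hasseDeriv k (∑ j, (r j + f ^ n * s j) * C (x ^ (j : ℕ))))
        = 0 := by
      rw [eval_zero] at h3
      rw [← h3]
      simp only [map_sum, eval_finset_sum, Finset.mul_sum]
      refine Finset.sum_congr rfl ?_
      intro j _
      have h5 := congrArg (eval x) (Dop_spec f w n hw k (s j))
      rw [mul_comm _ (C (x ^ (j : ℕ))), ← smul_eq_C_mul, map_smul, map_add]
      simp only [eval_mul, eval_pow, eval_add, eval_smul, smul_eq_mul, eval_X] at h5 hx ⊢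
      rw [hx] at h5
      linear_combination x ^ (j : ℕ) * h5
    rcases mul_eq_zero.1 h4 with h | h
    · exact absurd h (pow_ne_zero _ hfx)
    · exact h
  have h3 : taylor x (∑ j, (r j + f ^ n * s j) * X ^ ((j : ℕ) * Fintype.card F)) =
      taylor x (∑ j, (r j + f ^ n * s j) * C (x ^ (j : ℕ))) +
      ∑ j : Fin J, taylor x (r j + f ^ n * s j) *
        (taylor x (X ^ ((j : ℕ) * Fintype.card F) : F[X]) - C (x ^ (j : ℕ))) := by
    simp only [map_sum, taylor_mul, taylor_C]
    rw [← Finset.sum_add_distrib]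
    refine Finset.sum_congr rfl ?_
    intro j _
    ring
  rw [h3]
  refine dvd_add h2 (Finset.dvd_sum ?_)
  intro j _
  exact (h1 j).mul_left _

open Classical in
lemma aux_ne_zero (f : F[X]) (hsq : Squarefree f) (hf : 1 ≤ f.natDegree)
    (hf0 : f.eval 0 ≠ 0) (hodd : Fintype.card F % 2 = 1) (D : ℕ)
    (hD : 2 * D + f.natDegree ≤ Fintype.card F + 1) (J : ℕ) (r s : Fin J → F[X])
    (hr : ∀ j, (r j).natDegree < D) (hs : ∀ j, (s j).natDegree < D)
    (h0 : ∑ j, (r j + f ^ ((Fintype.card F - 1) / 2) * s j) * X ^ ((j : ℕ) * Fintype.card F) = 0) :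
    ∀ j, r j = 0 ∧ s j = 0 := by
  set q := Fintype.card F with hq
  set g := f ^ ((q - 1) / 2) with hg
  have hq0 : 0 < q := Fintype.card_pos
  have hgf : g ^ 2 * f = f ^ q := by
    rw [hg, ← pow_mul, ← pow_succ]; congr 1; omega
  by_contra hcon
  push Not at hcon
  obtain ⟨j0, hj0⟩ := hcon
  -- minimal index
  let Sset : Finset (Fin J) := Finset.univ.filter (fun j => ¬ (r j = 0 ∧ s j = 0))
  have hne : Sset.Nonempty := ⟨j0, by simpa [Sset] using hj0⟩
  obtain ⟨i, hi, hmin⟩ := Sset.exists_min_image (fun j => j) hne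
  have hi' : ¬ (r i = 0 ∧ s i = 0) := by simpa [Sset] using hi
  have hlow : ∀ j, j < i → r j = 0 ∧ s j = 0 := by
    intro j hj
    by_contra hc
    have := hmin j (by simpa [Sset] using hc)
    exact absurd hj (not_lt.2 this)
  have hdvd : X ^ q ∣ r i + g * s i := by
    have h1 : X ^ ((i : ℕ) * q) * X ^ q ∣ (r i + g * s i) * X ^ ((i : ℕ) * q) := by
      have h2 : (r i + g * s i) * X ^ ((i : ℕ) * q) =
          - ∑ j ∈ Finset.univ.erase i, (r j + g * s j) * X ^ ((j : ℕ) * q) := by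
        rw [← Finset.add_sum_erase _ _ (Finset.mem_univ i)] at h0
        linear_combination h0
      rw [h2, dvd_neg]
      refine Finset.dvd_sum ?_
      intro j hj
      have hji : j ≠ i := (Finset.mem_erase.1 hj).1
      rcases lt_or_gt_of_ne hji with h | h
      · obtain ⟨ha, hb⟩ := hlow j h
        simp [ha, hb]
      · rw [← pow_add]
        refine (pow_dvd_pow X ?_).mul_left _
        have : (i : ℕ) + 1 ≤ j := h
        calc (i : ℕ) * q + q = ((i : ℕ) + 1) * q := by ring
          _ ≤ j * q := Nat.mul_le_mul_right _ this
    rw [mul_comm] at h1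
    exact (mul_dvd_mul_iff_right (pow_ne_zero _ X_ne_zero)).1 h1
  have hfq : X ^ q ∣ f ^ q - C (f.eval 0) := by
    have : X ∣ f - C (f.eval 0) := by
      rw [X_dvd_iff]; simp [coeff_zero_eq_eval_zero]
    obtain ⟨u, hu⟩ := this
    refine ⟨expand F (Fintype.card F) u, ?_⟩
    have := congrArg (expand F (Fintype.card F)) hu
    rw [map_sub, map_mul, expand_C, expand_X, FiniteField.expand_card] at this
    exact this
  have hmain : X ^ q ∣ r i ^ 2 * f - C (f.eval 0) * s i ^ 2 := by
    have : r i ^ 2 * f - C (f.eval 0) * s i ^ 2 =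
      (r i + g * s i) * ((r i - g * s i) * f) + s i ^ 2 * (f ^ q - C (f.eval 0)) := by
      rw [← hgf]; ring
    rw [this]
    exact dvd_add (hdvd.mul_right _) (hfq.mul_left _)
  have hzero : r i ^ 2 * f - C (f.eval 0) * s i ^ 2 = 0 := by
    by_contra hne
    have h1 := natDegree_le_of_dvd hmain hne
    rw [natDegree_X_pow] at h1
    have h2 : (r i ^ 2 * f - C (f.eval 0) * s i ^ 2).natDegree ≤ q - 1 := by
      refine (natDegree_sub_le _ _).trans (max_le ?_ ?_)
      · refine natDegree_mul_le.trans ?_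
        have := natDegree_pow_le (p := r i) (n := 2)
        have := hr i
        omega
      · refine (natDegree_C_mul_le _ _).trans ?_
        have := natDegree_pow_le (p := s i) (n := 2)
        have := hs i
        omega
    omega
  have hri : r i = 0 := no_square_rel f hsq hf _ hf0 _ (r i) (s i) le_rfl (by linear_combination hzero)
  have hsi : s i = 0 := by
    rw [hri] at hzero
    have : C (f.eval 0) * s i ^ 2 = 0 := by linear_combination -hzero
    rcases mul_eq_zero.1 this with h | h
    · exact absurd (C_eq_zero.1 h) hf0
    · exact pow_eq_zero_iff (by norm_num) |>.1 h
  exact hi' ⟨hri, hsi⟩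

lemma aux_exists (f : F[X]) (hf : 1 ≤ f.natDegree) (w : ℕ → F[X])
    (hw : ∀ i, (w i).natDegree ≤ i * (f.natDegree - 1)) (a : F) (J l D : ℕ) (hDpos : 0 < D)
    (hdim : l * (D + l * f.natDegree + J) < 2 * (J * D)) :
    ∃ r s : Fin J → F[X], (∀ j, (r j).natDegree < D) ∧ (∀ j, (s j).natDegree < D) ∧
      (¬ ∀ j, r j = 0 ∧ s j = 0) ∧
      ∀ k < l, ∑ j, (f ^ k * hasseDeriv k (r j) + a • Dop f w k (s j)) * X ^ (j : ℕ) = 0 := by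
  let M := D + l * f.natDegree + J
  let V := (Fin J → degreeLT F D) × (Fin J → degreeLT F D)
  let Qk : ℕ → V →ₗ[F] F[X] := fun k => ∑ j : Fin J, (LinearMap.mulRight F (X ^ (j : ℕ))) ∘ₗ
    ((LinearMap.mulLeft F (f ^ k)) ∘ₗ (hasseDeriv k) ∘ₗ (degreeLT F D).subtype ∘ₗ
      (LinearMap.proj j) ∘ₗ (LinearMap.fst F _ _) +
      a • ((Dop f w k) ∘ₗ (degreeLT F D).subtype ∘ₗ (LinearMap.proj j) ∘ₗ (LinearMap.snd F _ _)))
  let Φ : V →ₗ[F] (Fin l → Fin M → F) := LinearMap.pi fun k => LinearMap.pi fun i =>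
    (lcoeff F (i : ℕ)) ∘ₗ (Qk (k : ℕ))
  have hfin : Module.finrank F (degreeLT F D) = D := by
    rw [(degreeLTEquiv F D).finrank_eq]; simp
  haveI : Module.Finite F (degreeLT F D) := Module.Finite.equiv (degreeLTEquiv F D).symm
  have hker : LinearMap.ker Φ ≠ ⊥ := by
    apply LinearMap.ker_ne_bot_of_finrank_lt
    simp only [V, Module.finrank_prod, Module.finrank_pi_fintype, hfin, Module.finrank_self]
    simp only [Finset.sum_const, Finset.card_univ, Fintype.card_fin, smul_eq_mul]
    simp only [M, mul_one]; linarith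
  obtain ⟨v, hv, hv0⟩ := (Submodule.ne_bot_iff _).1 hker
  have hdeg : ∀ u : degreeLT F D, (u : F[X]).natDegree < D := by
    intro u
    have := mem_degreeLT.1 u.2
    by_cases hu : (u : F[X]) = 0
    · rw [hu]; simpa using hDpos
    · exact (natDegree_lt_iff_degree_lt hu).2 this
  refine ⟨fun j => v.1 j, fun j => v.2 j, fun j => hdeg _, fun j => hdeg _, ?_, ?_⟩
  · intro hall
    apply hv0
    refine Prod.ext ?_ ?_
    · funext j; exact Subtype.ext (hall j).1
    · funext j; exact Subtype.ext (hall j).2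
  · intro k hk
    have hQ : Qk k v = ∑ j, (f ^ k * hasseDeriv k ((v.1 j : F[X])) +
        a • Dop f w k ((v.2 j : F[X]))) * X ^ (j : ℕ) := by
      simp [Qk]
      rfl
    rw [← hQ]
    ext i
    rw [coeff_zero]
    by_cases hi : i < M
    · have := LinearMap.mem_ker.1 hv
      have := congrFun (congrFun this ⟨k, hk⟩) ⟨i, hi⟩
      simpa [Φ] using this
    · apply coeff_eq_zero_of_natDegree_lt
      rw [hQ]
      push Not at hi
      refine lt_of_lt_of_le ?_ hi
      have : (∑ j : Fin J, (f ^ k * hasseDeriv k ((v.1 j : F[X])) +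
        a • Dop f w k ((v.2 j : F[X]))) * X ^ (j : ℕ)).natDegree ≤ M - 1 := by
        refine natDegree_sum_le_of_forall_le _ _ ?_
        intro j _
        refine natDegree_mul_le.trans ?_
        rw [natDegree_X_pow]
        have h1 := natDegree_pow_mul_hasse f hf k D _ (hdeg (v.1 j))
        have h2 := natDegree_Dop f hf w hw k D _ (hdeg (v.2 j))
        have h3 := natDegree_smul_le a (Dop f w k ((v.2 j : F[X])))
        have h4 := natDegree_add_le (f ^ k * hasseDeriv k ((v.1 j : F[X]))) (a • Dop f w k ((v.2 j : F[X])))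
        have h5 : (f ^ k * hasseDeriv k ((v.1 j : F[X])) +
          a • Dop f w k ((v.2 j : F[X]))).natDegree < D + k * (f.natDegree - 1) := by
          refine lt_of_le_of_lt h4 (max_lt h1 (lt_of_le_of_lt h3 h2))
        have h6 : k * (f.natDegree - 1) ≤ l * f.natDegree := Nat.mul_le_mul hk.le (Nat.sub_le _ _)
        have h7 := j.2
        simp only [M]; omega
      have : 0 < M := by simp only [M]; omega
      omega

theorem stepanov (f : F[X]) (hsq : Squarefree f) (hf : 1 ≤ f.natDegree)
    (hf0 : f.eval 0 ≠ 0) (hodd : Fintype.card F % 2 = 1) (J l D : ℕ) (hDpos : 0 < D)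
    (hD : 2 * D + f.natDegree ≤ Fintype.card F + 1) (hl : l ≤ Fintype.card F)
    (hdim : l * (D + l * f.natDegree + J) < 2 * (J * D)) (a : F) (ha : a ≠ 0) (S : Finset F)
    (hS : ∀ x ∈ S, (f ^ ((Fintype.card F - 1) / 2)).eval x = a)  :
    l * S.card ≤ (J + f.natDegree) * Fintype.card F := by
  set q := Fintype.card F with hq
  have hq0 : 0 < q := Fintype.card_pos
  choose w hw1 hw2 using exists_w f ((q - 1) / 2)
  obtain ⟨r, s, hr, hs, hne, hQ⟩ := aux_exists f hf w hw1 a J l D hDpos hdim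
  set P := ∑ j, (r j + f ^ ((q - 1) / 2) * s j) * X ^ ((j : ℕ) * q) with hP
  have hP0 : P ≠ 0 := fun h => hne (aux_ne_zero f hsq hf hf0 hodd D hD J r s hr hs h)
  by_cases hq1 : q = 1
  · have := Fintype.one_lt_card (α := F); omega
  have hdvd : ∏ x ∈ S, (X - C x) ^ l ∣ P := by
    refine Finset.prod_dvd_of_coprime ?_ ?_
    · intro x _ y _ hxy
      exact (pairwise_coprime_X_sub_C Function.injective_id hxy).pow
    · intro x hx
      have hfx : f.eval x ≠ 0 := by
        intro h
        have := hS x hx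
        rw [eval_pow, h, zero_pow] at this
        · exact ha this.symm
        · omega
      exact aux_vanish f w _ hw2 J l hl a r s hQ x (hS x hx) hfx
  have h1 := natDegree_le_of_dvd hdvd hP0
  rw [natDegree_prod_of_monic _ _ (fun x _ => (monic_X_sub_C x).pow l)] at h1
  simp only [(monic_X_sub_C _).natDegree_pow, natDegree_X_sub_C, mul_one, Finset.sum_const, smul_eq_mul] at h1
  have h2 : P.natDegree ≤ (J + f.natDegree) * q := by
    refine natDegree_sum_le_of_forall_le _ _ ?_
    intro j _
    refine natDegree_mul_le.trans ?_
    rw [natDegree_X_pow]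
    have h3 : (r j + f ^ ((q - 1) / 2) * s j).natDegree ≤ D + ((q - 1) / 2) * f.natDegree := by
      refine (natDegree_add_le _ _).trans (max_le ?_ ?_)
      · have := hr j; omega
      · refine natDegree_mul_le.trans ?_
        have := natDegree_pow_le (p := f) (n := (q - 1) / 2)
        have := hs j; omega
    have h4 : (j : ℕ) + 1 ≤ J := j.2
    have h5 : ((j : ℕ) + 1) * q ≤ J * q := Nat.mul_le_mul_right _ h4
    have h6 : ((q - 1) / 2) * f.natDegree ≤ q * f.natDegree :=
      Nat.mul_le_mul_right _ (by omega)
    have h7 : D ≤ q := by omega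
    nlinarith
  calc l * S.card = S.card * l := by ring
    _ ≤ _ := h1.trans h2

end Stepanov

end KL

end ModA1

section ModA2

open Polynomial Finset
namespace KL
noncomputable section
variable {F : Type} [Field F] [Fintype F] [DecidableEq F]

def lam (ψ : AddChar F ℂ) (b : F) (P : F[X]) : ℂ :=
  if P.coeff 0 = 0 then 0 else ψ (-(P.nextCoeff) - b * (P.coeff 1 / P.coeff 0))

theorem monicSet_finite (F : Type) [Field F] [Fintype F] (d : ℕ) :
    {P : F[X] | P.Monic ∧ P.natDegree = d}.Finite := by
  have e := (monicEquivDegreeLT (R := F) d).trans (degreeLTEquiv F d).toEquiv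
  exact Set.finite_coe_iff.mp (Finite.of_equiv _ e.symm)

def MM (F : Type) [Field F] [Fintype F] (d : ℕ) : Finset F[X] := (monicSet_finite F d).toFinset

theorem mem_MM {d : ℕ} {P : F[X]} : P ∈ MM F d ↔ P.Monic ∧ P.natDegree = d := by
  simp [MM]

def AA (ψ : AddChar F ℂ) (b : F) (d : ℕ) : ℂ := ∑ P ∈ MM F d, lam ψ b P

theorem lam_one (ψ : AddChar F ℂ) (b : F) : lam ψ b 1 = 1 := by
  have : (1 : F[X]).nextCoeff = 0 := by simp [nextCoeff]
  simp [lam, coeff_one, this]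

theorem lam_mul (ψ : AddChar F ℂ) (b : F) {P Q : F[X]} (hP : P.Monic) (hQ : Q.Monic) :
    lam ψ b (P * Q) = lam ψ b P * lam ψ b Q := by
  unfold lam
  rw [mul_coeff_zero, hP.nextCoeff_mul hQ, mul_coeff_one]
  by_cases h1 : P.coeff 0 = 0
  · simp [h1]
  by_cases h2 : Q.coeff 0 = 0
  · simp [h2]
  simp only [h1, h2, mul_eq_zero, or_self, if_false]
  rw [← AddChar.map_add_eq_mul]
  congr 1
  field_simp
  ring

theorem lam_pow (ψ : AddChar F ℂ) (b : F) {P : F[X]} (hP : P.Monic) (n : ℕ) :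
    lam ψ b (P ^ n) = lam ψ b P ^ n := by
  induction n with
  | zero => simp [lam_one]
  | succ n ih => rw [pow_succ, lam_mul ψ b (hP.pow n) hP, ih, pow_succ]

theorem AA_zero (ψ : AddChar F ℂ) (b : F) : AA ψ b 0 = 1 := by
  have : MM F 0 = {1} := by
    ext P
    rw [mem_MM, Finset.mem_singleton]
    constructor
    · rintro ⟨h1, h2⟩; exact (Monic.natDegree_eq_zero h1).mp h2
    · rintro rfl; simp
  simp [AA, this, lam_one]

theorem exists_ne_one {ψ : AddChar F ℂ} (hψ : ψ ≠ 1) : ∃ t, ψ t ≠ 1 := by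
  by_contra h
  push Not at h
  exact hψ (by ext t; simp [h t])

theorem AA_big (ψ : AddChar F ℂ) (hψ : ψ ≠ 1) (b : F) (d : ℕ) (hd : 3 ≤ d) : AA ψ b d = 0 := by
  obtain ⟨t, ht⟩ := exists_ne_one hψ
  have hdeg : ∀ (s : F), (C s * X ^ (d-1) : F[X]).degree < d := by
    intro s
    refine lt_of_le_of_lt (degree_C_mul_X_pow_le _ _) ?_
    exact_mod_cast (by omega : d - 1 < d)
  have hmem : ∀ (s : F) (P : F[X]), P ∈ MM F d → P + C s * X ^ (d-1) ∈ MM F d := by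
    intro s P hP
    rw [mem_MM] at hP ⊢
    obtain ⟨h1, h2⟩ := hP
    have h3 : P.degree = d := by rw [degree_eq_natDegree h1.ne_zero, h2]
    have h4 : (C s * X ^ (d-1) : F[X]).degree < P.degree := by rw [h3]; exact hdeg s
    refine ⟨h1.add_of_left h4, ?_⟩
    rw [natDegree_add_eq_left_of_degree_lt h4, h2]
  have hlam : ∀ P ∈ MM F d, lam ψ b (P + C (-t) * X ^ (d-1)) = ψ t * lam ψ b P := by
    intro P hP
    have hP' := hmem (-t) P hP
    rw [mem_MM] at hP hP'
    have hn : ∀ R : F[X], R.natDegree = d → R.nextCoeff = R.coeff (d-1) := by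
      intro R hR
      rw [nextCoeff_of_natDegree_pos (by omega), hR]
    unfold lam
    rw [hn _ hP.2, hn _ hP'.2]
    have e0 : (P + C (-t) * X ^ (d-1)).coeff 0 = P.coeff 0 := by
      simp [coeff_X_pow, show ¬ (0 = d - 1) by omega]
    have e1 : (P + C (-t) * X ^ (d-1)).coeff 1 = P.coeff 1 := by
      simp [coeff_X_pow, show ¬ (1 = d - 1) by omega]
    have e2 : (P + C (-t) * X ^ (d-1)).coeff (d-1) = P.coeff (d-1) - t := by
      simp [coeff_X_pow]; ring
    rw [e0, e1, e2]
    split_ifs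
    · simp
    · rw [← AddChar.map_add_eq_mul]; congr 1; ring
  have key : AA ψ b d = ψ t * AA ψ b d := by
    conv_rhs => rw [AA, Finset.mul_sum]
    unfold AA
    symm
    refine Finset.sum_bij' (fun P _ => P + C (-t) * X ^ (d-1)) (fun P _ => P + C t * X ^ (d-1))
      (fun P hP => hmem _ P hP) (fun P hP => hmem _ P hP) ?_ ?_ ?_
    · intro P hP; simp
    · intro P hP; simp
    · intro P hP; exact (hlam P hP).symm
  have : (ψ t - 1) * AA ψ b d = 0 := by linear_combination -key
  rcases mul_eq_zero.mp this with h | h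
  · exact absurd (sub_eq_zero.mp h) ht
  · exact h

theorem AA_two (ψ : AddChar F ℂ) (hψ : ψ ≠ 1) (b : F) (hb : b ≠ 0) :
    AA ψ b 2 = Fintype.card F := by
  have hψ' : ψ.IsPrimitive := AddChar.IsPrimitive.of_ne_one hψ
  have h1 : AA ψ b 2 = ∑ v : F, ∑ u : F, lam ψ b (X ^ 2 + C u * X + C v) := by
    rw [← Finset.sum_product', AA]
    symm
    refine Finset.sum_bij (fun vu _ => X ^ 2 + C vu.2 * X + C vu.1) ?_ ?_ ?_ ?_
    · rintro ⟨v, u⟩ _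
      rw [mem_MM]
      have : (X ^ 2 + C u * X + C v : F[X]).natDegree = 2 := by compute_degree!
      exact ⟨by monicity!, this⟩
    · rintro ⟨v, u⟩ _ ⟨v', u'⟩ _ h
      have h0 := congrArg (fun P => coeff P 0) h
      have h1 := congrArg (fun P => coeff P 1) h
      simp [coeff_X, coeff_C] at h0 h1
      simp [h0, h1]
    · intro P hP
      rw [mem_MM] at hP
      refine ⟨(P.coeff 0, P.coeff 1), by simp, ?_⟩
      have h2 : P.coeff 2 = 1 := by have := hP.1.coeff_natDegree; rwa [hP.2] at this
      conv_rhs => rw [P.as_sum_range_C_mul_X_pow, hP.2]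
      simp [Finset.sum_range_succ, h2]
      ring
    · rintro ⟨v, u⟩ _; rfl
  have h2 : ∀ v u : F, lam ψ b (X ^ 2 + C u * X + C v) =
      if v = 0 then 0 else ψ (u * (-1 - b / v)) := by
    intro v u
    have hd : (X ^ 2 + C u * X + C v : F[X]).natDegree = 2 := by compute_degree!
    unfold lam
    rw [nextCoeff_of_natDegree_pos (by omega), hd]
    have e0 : (X ^ 2 + C u * X + C v : F[X]).coeff 0 = v := by simp
    have e1 : (X ^ 2 + C u * X + C v : F[X]).coeff 1 = u := by
      simp [coeff_X, coeff_C, coeff_X_pow]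
    rw [show 2 - 1 = 1 from rfl, e0, e1]
    split_ifs
    · rfl
    · congr 1; ring
  rw [h1]
  have h3 : ∀ v : F, ∑ u : F, lam ψ b (X ^ 2 + C u * X + C v) =
      if v = -b then (Fintype.card F : ℂ) else 0 := by
    intro v
    simp_rw [h2]
    by_cases hv : v = 0
    · subst hv
      simp [hb]
    · simp only [hv, if_false]
      rw [AddChar.sum_mulShift _ hψ']
      have : (-1 - b / v = 0) ↔ v = -b := by
        constructor
        · intro h; field_simp at h; linear_combination -h
        · rintro rfl; field_simp; ring
      by_cases h : v = -b
      · rw [if_pos h, if_pos (this.mpr h)]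
      · rw [if_neg h, if_neg (fun h' => h (this.mp h'))]; simp
  simp_rw [h3]
  simp

/-- monic irreducible polynomials of degree dividing `k` -/
def Irr (F : Type) [Field F] [Fintype F] (k : ℕ) : Finset F[X] :=
  by
    classical
    exact Finset.filter (fun Q => Irreducible Q ∧ Q.natDegree ∣ k)
      ((Finset.Icc 1 k).biUnion (fun e => MM F e))

theorem mem_Irr {k : ℕ} (hk : 1 ≤ k) {Q : F[X]} :
    Q ∈ Irr F k ↔ Q.Monic ∧ Irreducible Q ∧ Q.natDegree ∣ k := by
  unfold Irr
  simp only [Finset.mem_filter, Finset.mem_biUnion, Finset.mem_Icc, mem_MM]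
  constructor
  · rintro ⟨⟨e, _, h⟩, h2⟩; exact ⟨h.1, h2⟩
  · rintro ⟨h1, h2, h3⟩
    exact ⟨⟨Q.natDegree, ⟨h2.natDegree_pos, Nat.le_of_dvd hk h3⟩, h1, rfl⟩, h2, h3⟩

def SP (ψ : AddChar F ℂ) (b : F) (k : ℕ) : ℂ :=
  ∑ Q ∈ Irr F k, (Q.natDegree : ℂ) * lam ψ b Q ^ (k / Q.natDegree)

theorem sum_dvd (ψ : AddChar F ℂ) (b : F) {R : F[X]} (hR : R.Monic) (d : ℕ) (hd : R.natDegree ≤ d)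
    [DecidablePred fun P : F[X] => R ∣ P] :
    ∑ P ∈ (MM F d).filter (fun P => R ∣ P), lam ψ b P = lam ψ b R * AA ψ b (d - R.natDegree) := by
  unfold AA
  rw [Finset.mul_sum]
  symm
  refine Finset.sum_bij (fun P _ => R * P) ?_ ?_ ?_ ?_
  · intro P hP
    rw [mem_MM] at hP
    rw [Finset.mem_filter, mem_MM]
    refine ⟨⟨hR.mul hP.1, ?_⟩, dvd_mul_right _ _⟩
    rw [hR.natDegree_mul hP.1, hP.2]; omega
  · intro P _ Q _ h
    exact mul_left_cancel₀ hR.ne_zero h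
  · intro P hP
    rw [Finset.mem_filter, mem_MM] at hP
    obtain ⟨⟨h1, h2⟩, Q, rfl⟩ := hP
    have hQ : Q.Monic := hR.of_mul_monic_left h1
    refine ⟨Q, ?_, rfl⟩
    rw [mem_MM]
    refine ⟨hQ, ?_⟩
    rw [hR.natDegree_mul hQ] at h2; omega
  · intro P hP
    rw [mem_MM] at hP
    rw [lam_mul ψ b hR hP.1]

theorem deg_eq {P : F[X]} (hP : P.Monic) {d : ℕ} (hd : P.natDegree = d) :
    d = ∑ k ∈ Finset.Icc 1 d, ∑ Q ∈ Irr F k,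
      (by classical exact if Q ^ (k / Q.natDegree) ∣ P then Q.natDegree else 0) := by
  classical
  set s := UniqueFactorizationMonoid.normalizedFactors P with hs
  have hP0 : P ≠ 0 := hP.ne_zero
  have hprod : s.prod = P := by
    have := leadingCoeff_mul_prod_normalizedFactors P
    rwa [hP.leadingCoeff, C_1, one_mul] at this
  have hmon : ∀ Q ∈ s, Q.Monic ∧ Irreducible Q ∧ Q ∣ P := by
    intro Q hQ
    rw [hs, Polynomial.mem_normalizedFactors_iff hP0] at hQ
    tauto
  have hdeg : d = ∑ Q ∈ s.toFinset, s.count Q * Q.natDegree := by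
    rw [← hd]
    conv_lhs => rw [← hprod]
    rw [natDegree_multiset_prod_of_monic _ (fun Q hQ => (hmon Q hQ).1),
      Finset.sum_multiset_map_count]
    simp
  have hcount : ∀ Q : F[X], Q.Monic → Irreducible Q → ∀ j : ℕ, Q ^ j ∣ P ↔ j ≤ s.count Q := by
    intro Q hQ hQi j
    have h := UniqueFactorizationMonoid.emultiplicity_eq_count_normalizedFactors hQi hP0
    rw [hQ.normalize_eq_self] at h
    rw [pow_dvd_iff_le_emultiplicity, h]
    exact_mod_cast Iff.rfl
  have hswap : (∑ k ∈ Finset.Icc 1 d, ∑ Q ∈ Irr F k,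
      if Q ^ (k / Q.natDegree) ∣ P then Q.natDegree else 0)
      = ∑ Q ∈ s.toFinset, ∑ k ∈ (Finset.Icc 1 d).filter
        (fun k => Q.natDegree ∣ k ∧ Q ^ (k / Q.natDegree) ∣ P), Q.natDegree := by
    simp_rw [← Finset.sum_filter]
    refine Finset.sum_comm' ?_
    intro k Q
    simp only [Finset.mem_filter, Finset.mem_Icc, Multiset.mem_toFinset]
    constructor
    · rintro ⟨hk, hQ, hdv⟩
      rw [mem_Irr hk.1] at hQ
      refine ⟨⟨hk, hQ.2.2, hdv⟩, ?_⟩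
      rw [hs, Polynomial.mem_normalizedFactors_iff hP0]
      refine ⟨hQ.2.1, hQ.1, ?_⟩
      refine dvd_trans (dvd_pow_self _ ?_) hdv
      have := Nat.div_pos (Nat.le_of_dvd hk.1 hQ.2.2) hQ.2.1.natDegree_pos
      omega
    · rintro ⟨⟨hk, h1, h2⟩, hQ⟩
      refine ⟨hk, ?_, h2⟩
      rw [mem_Irr hk.1]
      exact ⟨(hmon Q hQ).1, (hmon Q hQ).2.1, h1⟩
  have : ∀ Q ∈ s.toFinset, ∑ k ∈ (Finset.Icc 1 d).filter
        (fun k => Q.natDegree ∣ k ∧ Q ^ (k / Q.natDegree) ∣ P), Q.natDegree = s.count Q * Q.natDegree := by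
    intro Q hQ
    rw [Multiset.mem_toFinset] at hQ
    obtain ⟨h1, h2, h3⟩ := hmon Q hQ
    have hpos := h2.natDegree_pos
    rw [Finset.sum_const, smul_eq_mul]
    congr 1
    rw [show s.count Q = (Finset.Icc 1 (s.count Q)).card by simp]
    symm
    refine Finset.card_bij (fun j _ => j * Q.natDegree) ?_ ?_ ?_
    · intro j hj
      rw [Finset.mem_Icc] at hj
      have hdv := (hcount Q h1 h2 j).mpr hj.2
      simp only [Finset.mem_filter, Finset.mem_Icc]
      refine ⟨⟨Nat.mul_pos hj.1 hpos, ?_⟩, dvd_mul_left _ _, ?_⟩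
      · have := natDegree_le_of_dvd hdv hP0
        rwa [natDegree_pow, hd] at this
      · rwa [Nat.mul_div_cancel _ hpos]
    · intro i _ j _ h
      exact Nat.eq_of_mul_eq_mul_right hpos h
    · intro k hk
      simp only [Finset.mem_filter, Finset.mem_Icc] at hk
      obtain ⟨hk1, hk2, hk3⟩ := hk
      refine ⟨k / Q.natDegree, ?_, Nat.div_mul_cancel hk2⟩
      rw [Finset.mem_Icc]
      exact ⟨Nat.div_pos (Nat.le_of_dvd hk1.1 hk2) hpos, (hcount Q h1 h2 _).mp hk3⟩
  calc d = ∑ Q ∈ s.toFinset, s.count Q * Q.natDegree := hdeg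
    _ = _ := (Finset.sum_congr rfl this).symm
    _ = _ := hswap.symm
    _ = _ := by rfl

theorem newton (ψ : AddChar F ℂ) (b : F) (d : ℕ) :
    (d : ℂ) * AA ψ b d = ∑ k ∈ Finset.Icc 1 d, SP ψ b k * AA ψ b (d - k) := by
  classical
  have h1 : (d : ℂ) * AA ψ b d = ∑ P ∈ MM F d, ∑ k ∈ Finset.Icc 1 d, ∑ Q ∈ Irr F k,
      if Q ^ (k / Q.natDegree) ∣ P then (Q.natDegree : ℂ) * lam ψ b P else 0 := by
    unfold AA
    rw [Finset.mul_sum]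
    refine Finset.sum_congr rfl fun P hP => ?_
    rw [mem_MM] at hP
    have := deg_eq hP.1 hP.2
    conv_lhs => rw [this]
    push_cast
    simp_rw [Finset.sum_mul]
    refine Finset.sum_congr rfl fun k _ => Finset.sum_congr rfl fun Q _ => ?_
    split_ifs <;> simp
  rw [h1, Finset.sum_comm]
  refine Finset.sum_congr rfl fun k hk => ?_
  rw [Finset.mem_Icc] at hk
  rw [Finset.sum_comm, SP, Finset.sum_mul]
  refine Finset.sum_congr rfl fun Q hQ => ?_
  rw [mem_Irr hk.1] at hQ
  have hdeg : (Q ^ (k / Q.natDegree)).natDegree = k := by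
    rw [natDegree_pow, Nat.div_mul_cancel hQ.2.2]
  rw [← Finset.sum_filter, ← Finset.mul_sum, sum_dvd ψ b (hQ.1.pow _) d (by omega), hdeg,
    lam_pow ψ b hQ.1, mul_assoc]
end
end KL

end ModA2

section ModA2b

open Polynomial Finset
namespace KL
noncomputable section
variable {F : Type} [Field F] [Fintype F] [DecidableEq F]
variable {K : Type} [Field K] [Fintype K] [Algebra F K]
open IntermediateField

theorem minpoly_inv_nextCoeff (x : K) (hx : x ≠ 0) :
    (minpoly F x⁻¹).nextCoeff = (minpoly F x).coeff 1 / (minpoly F x).coeff 0 ∧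
    Module.finrank F⟮x⁻¹⟯ K = Module.finrank F⟮x⟯ K := by
  have hadj : F⟮x⁻¹⟯ = F⟮x⟯ := by
    apply le_antisymm
    · rw [adjoin_simple_le_iff]; exact inv_mem (mem_adjoin_simple_self F x)
    · rw [adjoin_simple_le_iff]
      have := inv_mem (mem_adjoin_simple_self F x⁻¹)
      rwa [inv_inv] at this
  refine ⟨?_, by rw [hadj]⟩
  have hIsInt : IsIntegral F x := IsIntegral.of_finite F x
  have hIsInt' : IsIntegral F x⁻¹ := IsIntegral.of_finite F x⁻¹
  set Q := minpoly F x with hQ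
  have hc0 : Q.coeff 0 ≠ 0 := minpoly.coeff_zero_ne_zero hIsInt hx
  have hn : 0 < Q.natDegree := minpoly.natDegree_pos hIsInt
  have hdeg : (minpoly F x⁻¹).natDegree = Q.natDegree := by
    rw [← adjoin.finrank hIsInt', ← adjoin.finrank hIsInt, hadj]
  have htr : Q.natTrailingDegree = 0 := natTrailingDegree_eq_zero.mpr (Or.inr hc0)
  have hrd : Q.reverse.natDegree = Q.natDegree := by
    rw [reverse_natDegree, htr]; simp
  have hlead : Q.reverse.leadingCoeff = Q.coeff 0 := by
    rw [reverse_leadingCoeff, trailingCoeff, htr]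
  set R := C (Q.coeff 0)⁻¹ * Q.reverse with hR
  have hRm : R.Monic := by
    rw [Monic, hR, leadingCoeff_mul, hlead, leadingCoeff_C, inv_mul_cancel₀ hc0]
  have hRd : R.natDegree = Q.natDegree := by
    rw [hR, natDegree_C_mul (inv_ne_zero hc0), hrd]
  have hroot : aeval x⁻¹ R = 0 := by
    have h0 : aeval x Q = 0 := minpoly.aeval F x
    have : eval₂ (algebraMap F K) (↑(Units.mk0 x hx)⁻¹ : K) Q.reverse = 0 := by
      letI := invertibleOfNonzero hx
      have := (eval₂_reverse_eq_zero_iff (algebraMap F K) x Q).mpr h0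
      simpa using this
    rw [hR, map_mul]
    have h2 : aeval x⁻¹ Q.reverse = 0 := by simpa [aeval_def] using this
    rw [h2, mul_zero]
  have hdvd := minpoly.dvd F x⁻¹ hroot
  have heq : R = minpoly F x⁻¹ :=
    (eq_of_monic_of_dvd_of_natDegree_le (minpoly.monic hIsInt') hRm hdvd (by omega))
  rw [← heq, nextCoeff_of_natDegree_pos (by omega), hRd, hR, coeff_C_mul, coeff_reverse,
    revAt_le (by omega), show Q.natDegree - (Q.natDegree - 1) = 1 by omega]
  field_simp

def SK (K : Type) [Field K] [Fintype K] [Algebra F K] (ψ : AddChar F ℂ) (b : F) : ℂ :=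
  by
    classical
    exact ∑ x : K, if x = 0 then 0 else ψ (Algebra.trace F K x + b * Algebra.trace F K x⁻¹)

theorem SP_eq_SK (ψ : AddChar F ℂ) (b : F) (k : ℕ) (hk : 1 ≤ k)
    (hK : Module.finrank F K = k) : SP ψ b k = SK K ψ b := by
  classical
  haveI : FiniteDimensional F K := inferInstance
  unfold SK SP
  have hmaps : ∀ x ∈ (Finset.univ : Finset K), minpoly F x ∈ Irr F k := by
    intro x _
    have hIsInt : IsIntegral F x := IsIntegral.of_finite F x
    rw [mem_Irr hk]
    exact ⟨minpoly.monic hIsInt, minpoly.irreducible hIsInt, hK ▸ minpoly.degree_dvd hIsInt⟩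
  rw [← Finset.sum_fiberwise_of_maps_to hmaps]
  refine Finset.sum_congr rfl fun Q hQ => ?_
  rw [mem_Irr hk] at hQ
  obtain ⟨hm, hi, hd⟩ := hQ
  have hcard : (Finset.univ.filter (fun x : K => minpoly F x = Q)).card = Q.natDegree := by
    haveI := Fact.mk hi
    have : Finite (AdjoinRoot Q) := by
      haveI : Module.Finite F (AdjoinRoot Q) := hm.finite_adjoinRoot
      exact Module.finite_of_finite F
    have hfr : Module.finrank F (AdjoinRoot Q) = Q.natDegree := by
      rw [(AdjoinRoot.powerBasis hi.ne_zero).finrank]; simp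
    obtain ⟨φ⟩ := FiniteField.nonempty_algHom_of_finrank_dvd (F := F) (K := AdjoinRoot Q) (L := K)
      (by rw [hfr, hK]; exact hd)
    have hroot : aeval (φ (AdjoinRoot.root Q)) Q = 0 := by
      rw [aeval_algHom_apply]; simp [AdjoinRoot.aeval_eq]
    have hQe : Q = minpoly F (φ (AdjoinRoot.root Q)) := minpoly.eq_of_irreducible_of_monic hi hroot hm
    have hsp : (Q.map (algebraMap F K)).Splits := by
      rw [hQe]; exact Normal.splits inferInstance _
    have hsep : Q.Separable := PerfectField.separable_of_irreducible hi
    rw [← card_rootSet_eq_natDegree hsep hsp, Fintype.card_subtype]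
    congr 1
    ext x
    simp only [Finset.mem_filter, Finset.mem_univ, true_and]
    rw [mem_rootSet]
    constructor
    · intro h; rw [← h]; exact ⟨h ▸ hi.ne_zero, minpoly.aeval F x⟩
    · intro h; exact (minpoly.eq_of_irreducible_of_monic hi h.2 hm).symm
  rw [← hcard]
  rw [← nsmul_eq_mul, ← Finset.sum_const]
  refine Finset.sum_congr rfl fun x hx => ?_
  rw [Finset.mem_filter] at hx
  obtain ⟨-, hx⟩ := hx
  have hIsInt : IsIntegral F x := IsIntegral.of_finite F x
  rw [hcard]
  have hfin : Module.finrank F⟮x⟯ K = k / Q.natDegree := by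
    have h1 := Module.finrank_mul_finrank F F⟮x⟯ K
    rw [adjoin.finrank hIsInt, hx, hK] at h1
    rw [← h1, Nat.mul_div_cancel_left _ hi.natDegree_pos]
  by_cases h0 : x = 0
  · have : Q.coeff 0 = 0 := by rw [← hx, h0]; simp [minpoly.zero]
    rw [if_pos h0, lam, if_pos this, zero_pow]
    have := Nat.div_pos (Nat.le_of_dvd hk hd) hi.natDegree_pos
    omega
  · have hc : Q.coeff 0 ≠ 0 := by rw [← hx]; exact minpoly.coeff_zero_ne_zero hIsInt h0
    obtain ⟨h1, h2⟩ := minpoly_inv_nextCoeff (F := F) x h0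
    rw [if_neg h0, lam, if_neg hc, trace_eq_finrank_mul_minpoly_nextCoeff F x,
      trace_eq_finrank_mul_minpoly_nextCoeff F x⁻¹, h1, h2, hfin, hx, ← AddChar.map_nsmul_eq_pow]
    congr 1
    rw [nsmul_eq_mul]; ring

theorem SP_one (ψ : AddChar F ℂ) (b : F) :
    SP ψ b 1 = ∑ x : F, if x = 0 then 0 else ψ (x + b * x⁻¹) := by
  rw [SP_eq_SK (K := F) ψ b 1 le_rfl (by simp)]
  unfold SK
  refine Finset.sum_congr rfl fun x _ => ?_
  simp [Algebra.trace_self_apply]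

theorem SP_two (ψ : AddChar F ℂ) (hψ : ψ ≠ 1) (b : F) (hb : b ≠ 0) :
    SP ψ b 2 = 2 * Fintype.card F - SP ψ b 1 ^ 2 := by
  have h1 := newton ψ b 1
  have h2 := newton ψ b 2
  rw [AA_two ψ hψ b hb] at h2
  simp [Finset.sum_Icc_succ_top, AA_zero] at h1 h2
  rw [h1] at h2
  linear_combination -h2

theorem SP_rec (ψ : AddChar F ℂ) (hψ : ψ ≠ 1) (b : F) (hb : b ≠ 0) (n : ℕ) (hn : 1 ≤ n) :
    SP ψ b (n + 2) = -(SP ψ b 1 * SP ψ b (n+1)) - Fintype.card F * SP ψ b n := by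
  have h1 := newton ψ b 1
  have h3 := newton ψ b (n+2)
  simp [AA_zero] at h1
  rw [AA_big ψ hψ b _ (by omega), mul_zero, Finset.sum_Icc_succ_top (by omega),
    Finset.sum_Icc_succ_top (by omega)] at h3
  have hz : ∑ k ∈ Finset.Icc 1 n, SP ψ b k * AA ψ b (n + 2 - k) = SP ψ b n * Fintype.card F := by
    obtain ⟨m, rfl⟩ : ∃ m, n = m + 1 := ⟨n - 1, by omega⟩
    rw [Finset.sum_Icc_succ_top (by omega), Finset.sum_eq_zero, zero_add,
      show m + 1 + 2 - (m + 1) = 2 by omega, AA_two ψ hψ b hb]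
    intro k hk
    rw [Finset.mem_Icc] at hk
    rw [AA_big ψ hψ b _ (by omega), mul_zero]
  rw [hz, show n + 2 - (n+1) = 1 by omega, show n + 2 - (n + 1 + 1) = 0 by omega, AA_zero, h1] at h3
  linear_combination -h3
end
end KL

end ModA2b

section ModA3

open Polynomial Finset
namespace KL
noncomputable section
variable {p : ℕ} [hp : Fact p.Prime]
variable {K : Type} [Field K] [Fintype K] [DecidableEq K] [Algebra (ZMod p) K]

def fpoly (K : Type) [Field K] (p : ℕ) (b : K) : K[X] := (X ^ p - X) ^ 2 - C (4 * b)

theorem g_natDegree : (X ^ p - X : K[X]).natDegree = p := by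
  have h2 := hp.out.one_lt
  rw [natDegree_sub_eq_left_of_natDegree_lt] <;> simp [h2]

theorem fpoly_natDegree (b : K) : (fpoly K p b).natDegree = 2 * p := by
  have h2 := hp.out.one_lt
  rw [fpoly, natDegree_sub_C, natDegree_pow, g_natDegree]

theorem four_ne (hodd : p ≠ 2) : (2 : K) ≠ 0 := by
  haveI : CharP K p := charP_of_injective_algebraMap (algebraMap (ZMod p) K).injective p
  have : Fact (2 < p) := ⟨by have := hp.out.two_le; omega⟩
  exact Ring.two_ne_zero (by rwa [ringChar.eq K p])

theorem fpoly_squarefree (hodd : p ≠ 2) (b : K) (hb : b ≠ 0) : Squarefree (fpoly K p b) := by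
  haveI : CharP K p := charP_of_injective_algebraMap (algebraMap (ZMod p) K).injective p
  have h2 : (2:K) ≠ 0 := four_ne (p := p) hodd
  apply Separable.squarefree
  have hder : derivative (fpoly K p b) = -2 * (X ^ p - X) := by
    unfold fpoly
    simp [derivative_pow]
    left
    rfl
  rw [Separable, hder]
  refine ⟨C (-(4*b)⁻¹), C (-(4*b)⁻¹ * 2⁻¹) * (X ^ p - X), ?_⟩
  have e1 : C (2⁻¹ : K) * 2 = 1 := by
    rw [show (2 : K[X]) = C 2 from rfl, ← C_mul, inv_mul_cancel₀ h2, C_1]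
  have e2 : C (4*b)⁻¹ * C (4 * b) = (1 : K[X]) := by
    rw [← C_mul, inv_mul_cancel₀, C_1]
    refine mul_ne_zero ?_ hb
    rw [show (4:K) = 2 * 2 by norm_num]; exact mul_ne_zero h2 h2
  unfold fpoly
  simp only [C_mul, C_neg] at e2 ⊢
  linear_combination C (4*b)⁻¹ * (X^p - X)^2 * e1 + e2

theorem nonres_count (hodd : p ≠ 2) (b : K) (hb : b ≠ 0) (Q : ℕ) (hQ : Fintype.card K = Q * Q)
    (hQp : 2 * p ≤ Q) (S : Finset K)
    (hS : ∀ x ∈ S, ((fpoly K p b) ^ ((Fintype.card K - 1) / 2)).eval x = -1) :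
    2 * S.card ≤ Q * Q + 4 * (4 * p + 1) * Q := by
  have h2 : (2:K) ≠ 0 := four_ne (p := p) hodd
  have hp1 := hp.out.one_lt
  haveI : CharP K p := charP_of_injective_algebraMap (algebraMap (ZMod p) K).injective p
  have hcodd : Fintype.card K % 2 = 1 := by
    rw [FiniteField.odd_card_of_char_ne_two]
    rwa [ringChar.eq K p]
  have hQodd : Q % 2 = 1 := by
    rw [hQ, Nat.mul_mod] at hcodd
    rcases Nat.mod_two_eq_zero_or_one Q with h | h <;> simp_all
  obtain ⟨w, rfl⟩ : ∃ w, Q = 2 * w + 1 := ⟨Q / 2, by omega⟩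
  have hd := fpoly_natDegree (p := p) b
  obtain ⟨D, hD⟩ : ∃ D, 2 * D + 2 * p = (2*w+1)*(2*w+1) + 1 := by
    refine ⟨2*w*w+2*w+1 - p, ?_⟩
    have : p ≤ 2*w*w+2*w+1 := by nlinarith
    zify [this]; ring
  have hDpos : 0 < D := by nlinarith
  have key := stepanov (fpoly K p b) (fpoly_squarefree hodd b hb) (by omega) ?_ hcodd
    (w + 2 * p + 1) (2 * w) D hDpos (by rw [hd, hQ]; omega) (by rw [hQ]; nlinarith) ?_ (-1) (by simp) S hS
  · rw [hd, hQ] at key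
    have hw : 1 ≤ w := by omega
    have h3 : 2 * w * (2 * S.card) ≤ 2 * w * ((2*w+1) * (2*w+1) + 4 * (4 * p + 1) * (2*w+1)) := by
      have : (2*w+1) * (2*w+1) * (2 * (4*p+1)) ≤ 2 * w * (4 * (4*p+1) * (2*w+1)) := by
        have : (2*w+1) * (2 * (4*p+1)) ≤ 2 * w * (4 * (4*p+1)) := by nlinarith
        nlinarith
      nlinarith
    exact Nat.le_of_mul_le_mul_left h3 (by omega)
  · simp [fpoly, hp.out.ne_zero]
    refine ⟨?_, hb⟩
    rw [show (4:K) = 2 * 2 by norm_num]; exact mul_ne_zero h2 h2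
  · rw [hd]
    have hw : 2 * p ≤ 2 * w + 1 := hQp
    zify at *
    nlinarith

theorem card_eval_zero_le (b : K) : (Finset.univ.filter
    (fun y : K => (fpoly K p b).eval y = 0)).card ≤ 2 * p := by
  have hd := fpoly_natDegree (p := p) b
  have h0 : fpoly K p b ≠ 0 := by
    intro h; rw [h] at hd; simp at hd; exact hp.out.ne_zero hd
  rw [← hd]
  refine le_trans ?_ (card_roots' (fpoly K p b))
  refine le_trans (Finset.card_le_card ?_) (Multiset.toFinset_card_le _)
  intro y hy
  simp at hy
  simp [h0, hy]

theorem res_count (hodd : p ≠ 2) (b : K) (hb : b ≠ 0) (Q : ℕ) (hQ : Fintype.card K = Q * Q)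
    (hQp : 2 * p ≤ Q) :
    Q * Q ≤ 2 * (Finset.univ.filter (fun y : K => (fpoly K p b).eval y ≠ 0 ∧
      IsSquare ((fpoly K p b).eval y))).card + 4 * (4 * p + 1) * Q + 4 * p := by
  classical
  haveI : CharP K p := charP_of_injective_algebraMap (algebraMap (ZMod p) K).injective p
  have hc : ringChar K ≠ 2 := by rwa [ringChar.eq K p]
  set A := (Finset.univ.filter (fun y : K => (fpoly K p b).eval y = 0))
  set B := (Finset.univ.filter (fun y : K => (fpoly K p b).eval y ≠ 0 ∧
      IsSquare ((fpoly K p b).eval y)))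
  set S := (Finset.univ.filter (fun y : K => (fpoly K p b).eval y ≠ 0 ∧
      ¬ IsSquare ((fpoly K p b).eval y)))
  have h1 : Fintype.card K ≤ A.card + B.card + S.card := by
    rw [← Finset.card_univ]
    refine le_trans (Finset.card_le_card (t := A ∪ B ∪ S) ?_)
      (le_trans (Finset.card_union_le _ _) (Nat.add_le_add_right (Finset.card_union_le _ _) _))
    intro y _
    simp only [A, B, S, Finset.mem_union, Finset.mem_filter, Finset.mem_univ, true_and]
    tauto
  have h2 := card_eval_zero_le (p := p) b
  have h3 := nonres_count hodd b hb Q hQ hQp S (by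
    intro y hy
    simp only [S, Finset.mem_filter, Finset.mem_univ, true_and] at hy
    rw [eval_pow]
    have hodd' := FiniteField.odd_card_of_char_ne_two hc
    rw [show (Fintype.card K - 1) / 2 = Fintype.card K / 2 by omega]
    rcases FiniteField.pow_dichotomy hc hy.1 with h | h
    · exact absurd ((FiniteField.isSquare_iff hc hy.1).mpr h) hy.2
    · exact h)
  change A.card ≤ _ at h2
  omega

theorem trace_frob (y : K) : Algebra.trace (ZMod p) K (y ^ p - y) = 0 := by
  rw [map_sub, sub_eq_zero]
  have := Algebra.trace_eq_of_algEquiv (FiniteField.frobeniusAlgEquivOfAlgebraic (ZMod p) K) y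
  simpa [FiniteField.coe_frobeniusAlgEquivOfAlgebraic, ZMod.card] using this

theorem trace_count (hodd : p ≠ 2) (b : ZMod p) (hb : b ≠ 0) (Q : ℕ)
    (hQ : Fintype.card K = Q * Q) (hQp : 2 * p ≤ Q) :
    Q * Q ≤ p * (Finset.univ.filter (fun x : K => x ≠ 0 ∧
      Algebra.trace (ZMod p) K x + b * Algebra.trace (ZMod p) K x⁻¹ = 0)).card
      + 4 * (4 * p + 1) * Q + 4 * p := by
  classical
  have h2 : (2:K) ≠ 0 := four_ne (p := p) hodd
  set b' : K := algebraMap (ZMod p) K b with hb'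
  have hb0 : b' ≠ 0 := by simpa [hb'] using hb
  refine le_trans (res_count hodd b' hb0 Q hQ hQp) ?_
  set B := (Finset.univ.filter (fun y : K => (fpoly K p b').eval y ≠ 0 ∧
      IsSquare ((fpoly K p b').eval y)))
  set T := (Finset.univ.filter (fun x : K => x ≠ 0 ∧
      Algebra.trace (ZMod p) K x + b * Algebra.trace (ZMod p) K x⁻¹ = 0))
  set W := (Finset.univ : Finset (K × K)).filter
    (fun xy => xy.1 ≠ 0 ∧ xy.1 + b' * xy.1⁻¹ = xy.2 ^ p - xy.2)
  have hev : ∀ y : K, (fpoly K p b').eval y = (y ^ p - y)^2 - 4 * b' := by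
    intro y; simp [fpoly]
  have hW1 : 2 * B.card ≤ W.card := by
    refine le_trans (Finset.mul_card_image_le_card_of_maps_to
      (s := W.filter (fun xy => xy.2 ∈ B)) (f := fun xy => xy.2) (t := B) ?_ 2 ?_)
      (Finset.card_filter_le _ _)
    · intro xy h; exact (Finset.mem_filter.mp h).2
    · intro y hy
      have hyB := hy
      simp only [B, Finset.mem_filter, Finset.mem_univ, true_and, hev] at hy
      obtain ⟨h0, r, hr⟩ := hy
      have hr0 : r ≠ 0 := by rintro rfl; simp at hr; exact h0 hr
      set c := y ^ p - y with hc
      have hprod : ((c + r) / 2) * ((c - r) / 2) = b' := by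
        field_simp; linear_combination hr
      have hx1 : (c + r) / 2 ≠ 0 := by rintro h; rw [h, zero_mul] at hprod; exact hb0 hprod.symm
      have hx2 : (c - r) / 2 ≠ 0 := by rintro h; rw [h, mul_zero] at hprod; exact hb0 hprod.symm
      rw [show 2 = ({((c + r) / 2, y), ((c - r) / 2, y)} : Finset (K × K)).card from ?_]
      · apply Finset.card_le_card
        intro xy hxy
        simp only [Finset.mem_insert, Finset.mem_singleton] at hxy
        simp only [W, Finset.mem_filter, Finset.mem_univ, true_and]
        rcases hxy with rfl | rfl
        · refine ⟨⟨⟨hx1, ?_⟩, hyB⟩, rfl⟩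
          simp only
          rw [← hc, ← hprod, mul_comm ((c + r) / 2) ((c - r) / 2), mul_inv_cancel_right₀ hx1]
          field_simp; ring
        · refine ⟨⟨⟨hx2, ?_⟩, hyB⟩, rfl⟩
          simp only
          rw [← hc, ← hprod, mul_inv_cancel_right₀ hx2]
          field_simp; ring
      · rw [Finset.card_pair]
        intro h
        rw [Prod.mk.injEq] at h
        have h1 := h.1
        field_simp at h1
        have : 2 * r = 0 := by linear_combination h1
        rcases mul_eq_zero.mp this with h | h
        · exact h2 h
        · exact hr0 h
  have hW2 : W.card ≤ p * T.card := by
    refine Finset.card_le_mul_card_image_of_maps_to (f := fun xy => xy.1) ?_ p ?_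
    · intro xy h
      simp only [W, T, Finset.mem_filter, Finset.mem_univ, true_and] at h ⊢
      refine ⟨h.1, ?_⟩
      have := trace_frob (p := p) xy.2
      rw [← h.2, map_add, hb', ← Algebra.smul_def, map_smul, smul_eq_mul] at this
      exact this
    · intro x _
      have hd : (X ^ p - X - C (x + b' * x⁻¹) : K[X]).natDegree = p := by
        rw [natDegree_sub_C, g_natDegree]
      have h0 : (X ^ p - X - C (x + b' * x⁻¹) : K[X]) ≠ 0 := by
        intro h; rw [h] at hd; simp at hd; exact hp.out.ne_zero hd.symm
      conv_rhs => rw [← hd]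
      refine le_trans ?_ (card_roots' _)
      refine le_trans ?_ (Multiset.toFinset_card_le _)
      refine Finset.card_le_card_of_injOn (fun xy => xy.2) ?_ ?_
      · intro xy h
        simp only [W, Finset.coe_filter, Finset.mem_filter, Finset.mem_univ, true_and,
          Set.mem_setOf_eq] at h
        simp only [Finset.mem_coe, Multiset.mem_toFinset, mem_roots h0, IsRoot.def, eval_sub,
          eval_pow, eval_X, eval_C]
        rw [← h.1.2, h.2, sub_self]
      · intro xy h xy' h' e
        simp only [Finset.coe_filter, Set.mem_setOf_eq] at h h'
        exact Prod.ext (h.2.trans h'.2.symm) e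
  omega
end
end KL

end ModA3

section ModA4

open Polynomial Finset
namespace KL
noncomputable section

theorem SP_formula {F : Type} [Field F] [Fintype F] [DecidableEq F]
    (ψ : AddChar F ℂ) (hψ : ψ ≠ 1) (b : F) (hb : b ≠ 0) (x y : ℂ)
    (hs : x + y = - SP ψ b 1) (hm : x * y = Fintype.card F) (n : ℕ) (hn : 1 ≤ n) :
    SP ψ b n = -(x ^ n + y ^ n) := by
  induction n using Nat.strong_induction_on with
  | _ n ih =>
    match n, hn with
    | 1, _ => linear_combination hs
    | 2, _ => rw [SP_two ψ hψ b hb, ← hm]; linear_combination (x + y - SP ψ b 1) * hs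
    | (k + 3), _ =>
      rw [SP_rec ψ hψ b hb (k+1) (by omega), ih (k+1+1) (by omega) (by omega),
        ih (k+1) (by omega) (by omega), ← hm]
      have : SP ψ b 1 = -(x + y) := by linear_combination hs
      rw [this]; ring

theorem SP_one_real {F : Type} [Field F] [Fintype F] [DecidableEq F]
    (ψ : AddChar F ℂ) (b : F) : ∃ s : ℝ, SP ψ b 1 = s := by
  have : (starRingEnd ℂ) (SP ψ b 1) = SP ψ b 1 := by
    rw [SP_one, map_sum]
    rw [← Equiv.sum_comp (Equiv.neg F)]
    refine Finset.sum_congr rfl fun x _ => ?_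
    simp only [Equiv.neg_apply, neg_eq_zero]
    split_ifs
    · simp
    · rw [← AddChar.map_neg_eq_conj]
      congr 1
      rw [inv_neg]; ring
  exact ⟨(SP ψ b 1).re, (Complex.conj_eq_iff_re.mp this).symm⟩

theorem SP_small {F : Type} [Field F] [Fintype F] [DecidableEq F]
    (ψ : AddChar F ℂ) (hψ : ψ ≠ 1) (b : F) (hb : b ≠ 0) (s : ℝ) (hs : SP ψ b 1 = s)
    (h : s ^ 2 ≤ 4 * Fintype.card F) (t : ℕ) (ht : 1 ≤ t) :
    ‖SP ψ b (2 * t)‖ ≤ 2 * (Fintype.card F : ℝ) ^ t := by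
  set q : ℝ := ((Fintype.card F : ℕ) : ℝ) with hq
  set δ := Real.sqrt (4 * q - s ^ 2)
  have hδ : δ ^ 2 = 4 * q - s ^ 2 := Real.sq_sqrt (by linarith)
  have hδc : (δ : ℂ) ^ 2 = 4 * q - s ^ 2 := by exact_mod_cast congrArg (fun r : ℝ => (r : ℂ)) hδ
  have hI := Complex.I_sq
  have hf := SP_formula ψ hψ b hb (((-s/2 : ℝ) : ℂ) + ((δ/2 : ℝ) : ℂ) * Complex.I)
    (((-s/2 : ℝ) : ℂ) - ((δ/2 : ℝ) : ℂ) * Complex.I)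
    (by rw [hs]; push_cast; ring) (by
      have : ((Fintype.card F : ℕ) : ℂ) = ((q : ℝ) : ℂ) := by simp [q]
      rw [this]; push_cast
      linear_combination (1/4:ℂ) * hδc - (δ:ℂ)^2 / 4 * hI) (2 * t) (by omega)
  have hn1 : ‖((-s/2 : ℝ) : ℂ) + ((δ/2 : ℝ) : ℂ) * Complex.I‖ ^ 2 = q := by
    rw [← Complex.normSq_eq_norm_sq, Complex.normSq_add_mul_I]; linear_combination hδ / 4
  have hn2 : ‖((-s/2 : ℝ) : ℂ) - ((δ/2 : ℝ) : ℂ) * Complex.I‖ ^ 2 = q := by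
    rw [sub_eq_add_neg, ← neg_mul, ← Complex.ofReal_neg,
      ← Complex.normSq_eq_norm_sq, Complex.normSq_add_mul_I]; linear_combination hδ / 4
  rw [hf, norm_neg]
  refine (norm_add_le _ _).trans ?_
  rw [norm_pow, norm_pow, pow_mul, pow_mul, hn1, hn2]; linarith

theorem SP_large {F : Type} [Field F] [Fintype F] [DecidableEq F]
    (ψ : AddChar F ℂ) (hψ : ψ ≠ 1) (b : F) (hb : b ≠ 0) (s : ℝ) (hs : SP ψ b 1 = s)
    (h : 4 * Fintype.card F < s ^ 2) : ∃ m : ℝ, (Fintype.card F : ℝ) < m ∧ ∀ (t : ℕ), 1 ≤ t →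
    m ^ t ≤ (-SP ψ b (2 * t)).re := by
  set q : ℝ := ((Fintype.card F : ℕ) : ℝ) with hq
  set δ := Real.sqrt (s ^ 2 - 4 * q)
  have hδ : δ ^ 2 = s ^ 2 - 4 * q := Real.sq_sqrt (by linarith)
  have hf : ∀ t : ℕ, 1 ≤ t → (-SP ψ b (2 * t)).re =
      (((-s + δ)/2) ^ 2) ^ t + (((-s - δ)/2) ^ 2) ^ t := by
    intro t ht
    have hf := SP_formula ψ hψ b hb ((((-s + δ)/2 : ℝ) : ℂ)) ((((-s - δ)/2 : ℝ) : ℂ))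
      (by rw [hs]; push_cast; ring) (by
        have : ((Fintype.card F : ℕ) : ℂ) = ((q : ℝ) : ℂ) := by simp [q]
        rw [this, ← Complex.ofReal_mul, Complex.ofReal_inj]
        linear_combination -hδ / 4) (2 * t) (by omega)
    rw [hf, neg_neg, ← Complex.ofReal_pow, ← Complex.ofReal_pow, ← Complex.ofReal_add,
      Complex.ofReal_re, pow_mul, pow_mul]
  have hp1 : ∀ t : ℕ, 0 ≤ (((-s + δ)/2) ^ 2) ^ t := fun t => by positivity
  have hp2 : ∀ t : ℕ, 0 ≤ (((-s - δ)/2) ^ 2) ^ t := fun t => by positivity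
  by_cases hc : q < ((-s + δ)/2) ^ 2
  · exact ⟨_, hc, fun t ht => by rw [hf t ht]; linarith [hp2 t]⟩
  · refine ⟨((-s - δ)/2) ^ 2, ?_, fun t ht => by rw [hf t ht]; linarith [hp1 t]⟩
    nlinarith

variable {p : ℕ} [hp : Fact p.Prime]

theorem mulShift_ne_one (ψ : AddChar (ZMod p) ℂ) (hψ : ψ ≠ 1) (a : ZMod p) (ha : a ≠ 0) :
    ψ.mulShift a ≠ 1 := (AddChar.IsPrimitive.of_ne_one hψ) ha

theorem sum_shift (hodd : p ≠ 2) (ψ : AddChar (ZMod p) ℂ) (hψ : ψ ≠ 1) (b : ZMod p) (hb : b ≠ 0)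
    (t : ℕ) (ht : 2 ≤ t) :
    ∑ a ∈ Finset.univ.erase (0 : ZMod p), (-SP (ψ.mulShift a) b (2 * t)).re
      ≤ 4 * (4 * p + 1) * (p:ℝ) ^ t + 4 * p := by
  classical
  let K := GaloisField p (2 * t)
  letI : Fintype K := Fintype.ofFinite K
  have hfr : Module.finrank (ZMod p) K = 2 * t := GaloisField.finrank p (by omega)
  have hcard : Fintype.card K = p ^ t * p ^ t := by
    have := GaloisField.card p (2*t) (by omega)
    rw [Fintype.card_eq_nat_card, this]; ring
  have hpp : 2 * p ≤ p ^ t := by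
    have h2 := hp.out.two_le
    calc 2 * p ≤ p * p := Nat.mul_le_mul_right _ h2
      _ = p ^ 2 := by ring
      _ ≤ p ^ t := Nat.pow_le_pow_right hp.out.pos ht
  have hcount := trace_count (p := p) (K := K) hodd b hb (p ^ t) hcard hpp
  set T := (Finset.univ.filter (fun x : K => x ≠ 0 ∧
      Algebra.trace (ZMod p) K x + b * Algebra.trace (ZMod p) K x⁻¹ = 0)) with hT
  have hψ' : ψ.IsPrimitive := AddChar.IsPrimitive.of_ne_one hψ
  have hall : ∑ a : ZMod p, SK K (ψ.mulShift a) b = (p : ℂ) * T.card := by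
    unfold SK
    rw [Finset.sum_comm]
    have : ∀ x : K, (∑ a : ZMod p, if x = 0 then (0:ℂ) else
        (ψ.mulShift a) (Algebra.trace (ZMod p) K x + b * Algebra.trace (ZMod p) K x⁻¹)) =
        if x ∈ T then (p : ℂ) else 0 := by
      intro x
      by_cases hx : x = 0
      · simp [hx, hT]
      · simp only [hx, if_false, AddChar.mulShift_apply]
        rw [AddChar.sum_mulShift _ hψ', ZMod.card]
        simp [hT, hx]
    convert Finset.sum_congr rfl (fun x _ => this x) using 1
    rw [Finset.sum_ite_mem, Finset.univ_inter, Finset.sum_const, nsmul_eq_mul, mul_comm]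
  have hzero : SK K (ψ.mulShift 0) b = (p ^ t * p ^ t : ℕ) - 1 := by
    unfold SK
    simp only [AddChar.mulShift_zero, AddChar.one_apply]
    have : ∀ x : K, (if x = 0 then (0:ℂ) else 1) = 1 - if x = 0 then 1 else 0 := by
      intro x; split_ifs <;> simp
    simp_rw [this]
    rw [Finset.sum_sub_distrib, Finset.sum_ite_eq' Finset.univ (0:K)]
    simp [← hcard]
  have hsum : ∑ a ∈ Finset.univ.erase (0 : ZMod p), (-SP (ψ.mulShift a) b (2 * t))
      = ((((p ^ t * p ^ t : ℕ) : ℝ) - 1 - p * T.card : ℝ) : ℂ) := by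
    rw [Finset.sum_neg_distrib, Finset.sum_congr rfl (fun a _ =>
      SP_eq_SK (K := K) (ψ.mulShift a) b (2*t) (by omega) hfr)]
    have := Finset.add_sum_erase Finset.univ (fun a => SK K (ψ.mulShift a) b)
      (Finset.mem_univ (0 : ZMod p))
    rw [hall, hzero] at this
    push_cast at this ⊢
    linear_combination -this
  have hre := congrArg Complex.re hsum
  rw [Complex.ofReal_re, Complex.re_sum] at hre
  rw [hre]
  have hc2 : ((p ^ t * p ^ t : ℕ) : ℝ) ≤ p * T.card + 4 * (4 * p + 1) * (p:ℝ) ^ t + 4 * p := by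
    exact_mod_cast hcount
  linarith

theorem weil_SP (hodd : p ≠ 2) (ψ : AddChar (ZMod p) ℂ) (hψ : ψ ≠ 1) (b : ZMod p) (hb : b ≠ 0) :
    ‖SP ψ b 1‖ ^ 2 ≤ 4 * p := by
  obtain ⟨s, hs⟩ := SP_one_real ψ b
  rw [hs, Complex.norm_real, Real.norm_eq_abs, sq_abs]
  by_contra hcon
  push Not at hcon
  obtain ⟨m, hm, hmt⟩ := SP_large ψ hψ b hb s hs (by rwa [ZMod.card])
  rw [ZMod.card] at hm
  have hp0 : (0:ℝ) < p := by exact_mod_cast hp.out.pos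
  have hlow : ∀ a : ZMod p, a ≠ 0 → ∀ t : ℕ, 1 ≤ t →
      -(2 * (p:ℝ) ^ t) ≤ (-SP (ψ.mulShift a) b (2 * t)).re := by
    intro a ha t ht
    obtain ⟨s', hs'⟩ := SP_one_real (ψ.mulShift a) b
    have hne := mulShift_ne_one ψ hψ a ha
    by_cases hc : s' ^ 2 ≤ 4 * Fintype.card (ZMod p)
    · have := SP_small _ hne b hb s' hs' hc t ht
      rw [ZMod.card] at this
      have h2 := Complex.abs_re_le_norm (SP (ψ.mulShift a) b (2 * t))
      rw [Complex.neg_re]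
      have := (abs_le.mp (h2.trans this)).2
      linarith
    · push Not at hc
      obtain ⟨m', hm', h⟩ := SP_large _ hne b hb s' hs' hc
      have := h t ht
      have h0 : 0 ≤ m' := le_trans (by positivity) hm'.le
      have : 0 ≤ m' ^ t := by positivity
      have : 0 ≤ (p:ℝ) ^ t := by positivity
      linarith
  have hkey : ∀ t : ℕ, 2 ≤ t → m ^ t ≤ (4 * (4 * p + 1) + 4 * p + 2 * p) * (p:ℝ)^t := by
    intro t ht
    have h1 := sum_shift hodd ψ hψ b hb t ht
    have h1p : (1:ℝ) ≤ (p:ℝ)^t := one_le_pow₀ (by exact_mod_cast hp.out.one_le)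
    have hmem : (1 : ZMod p) ∈ Finset.univ.erase (0 : ZMod p) := by simp
    rw [← Finset.add_sum_erase _ _ hmem, AddChar.mulShift_one] at h1
    have h2 := hmt t (by omega)
    have h3 : -(p * (2 * (p:ℝ)^t)) ≤ ∑ a ∈ (Finset.univ.erase (0 : ZMod p)).erase 1,
        (-SP (ψ.mulShift a) b (2 * t)).re := by
      calc -(p * (2 * (p:ℝ)^t)) ≤ ((Finset.univ.erase (0 : ZMod p)).erase 1).card • (-(2 * (p:ℝ)^t)) := by
            rw [nsmul_eq_mul]
            have : ((((Finset.univ.erase (0 : ZMod p)).erase 1).card : ℕ) : ℝ) ≤ p := by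
              have h := Finset.card_le_univ ((Finset.univ.erase (0 : ZMod p)).erase 1)
              rw [ZMod.card] at h
              exact_mod_cast h
            nlinarith
        _ ≤ _ := by
            apply Finset.card_nsmul_le_sum
            intro a ha
            refine hlow a ?_ t (by omega)
            simp at ha; exact ha.2
    nlinarith
  obtain ⟨n, hn⟩ := pow_unbounded_of_one_lt (4 * (4 * p + 1) + 4 * p + 2 * p : ℝ)
    (show 1 < m / p by rw [one_lt_div hp0]; exact hm)
  have h1 := hkey (n + 2) (by omega)
  have h2 : (m / p) ^ n ≤ (m / p) ^ (n + 2) :=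
    pow_le_pow_right₀ (by rw [one_le_div hp0]; exact hm.le) (by omega)
  rw [div_pow _ _ (n+2), le_div_iff₀ (by positivity)] at h2
  have h3 : (0:ℝ) < (p:ℝ)^(n+2) := by positivity
  nlinarith

/-- Weil bound for Kloosterman sums modulo an odd prime. -/
theorem weil (hodd : p ≠ 2) (ψ : AddChar (ZMod p) ℂ) (hψ : ψ ≠ 1) (b : ZMod p) (hb : b ≠ 0) :
    ‖∑ x : ZMod p, if x = 0 then (0:ℂ) else ψ (x + b * x⁻¹)‖ ≤ 2 * Real.sqrt p := by
  have h := weil_SP hodd ψ hψ b hb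
  rw [SP_one] at h
  refine le_of_sq_le_sq ?_ (by positivity)
  rw [mul_pow, Real.sq_sqrt (by positivity)]
  linarith
end
end KL

end ModA4

section ModB1

open Finset
namespace KL
noncomputable section

def Kl {R : Type} [CommRing R] [Fintype R] (f g : AddChar R ℂ) : ℂ :=
  by
    classical
    exact ∑ x : Rˣ, f (x : R) * g ((x⁻¹ : Rˣ) : R)

theorem Kl_trivial {R : Type} [CommRing R] [Fintype R] (f g : AddChar R ℂ) :
    ‖Kl f g‖ ≤ Fintype.card R := by
  classical
  unfold Kl
  refine (norm_sum_le _ _).trans ?_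
  have : ∀ x ∈ (Finset.univ : Finset Rˣ), ‖f (x : R) * g ((x⁻¹ : Rˣ) : R)‖ ≤ 1 := by
    intro x _
    rw [norm_mul, AddChar.norm_apply, AddChar.norm_apply, one_mul]
  refine (Finset.sum_le_sum this).trans ?_
  rw [Finset.sum_const, nsmul_eq_mul, mul_one, Finset.card_univ]
  exact_mod_cast Fintype.card_le_of_injective (fun x : Rˣ => (x : R)) Units.val_injective

theorem Kl_prod {R S : Type} [CommRing R] [Fintype R] [CommRing S] [Fintype S]
    (T : Type) [CommRing T] [Fintype T] (e : T ≃+* R × S) (f g : AddChar T ℂ)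
    (f1 g1 : AddChar R ℂ) (f2 g2 : AddChar S ℂ)
    (hf : ∀ x y, f (e.symm (x, y)) = f1 x * f2 y)
    (hg : ∀ x y, g (e.symm (x, y)) = g1 x * g2 y) :
    Kl f g = Kl f1 g1 * Kl f2 g2 := by
  classical
  unfold Kl
  rw [Finset.sum_mul_sum, ← Finset.sum_product', Finset.univ_product_univ]
  let E : Tˣ ≃ Rˣ × Sˣ := ((Units.mapEquiv e.toMulEquiv).trans MulEquiv.prodUnits).toEquiv
  rw [← Equiv.sum_comp E.symm]
  refine Finset.sum_congr rfl fun xy _ => ?_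
  obtain ⟨x, y⟩ := xy
  have h1 : ((E.symm (x, y) : Tˣ) : T) = e.symm ((x : R), (y : S)) := rfl
  have h2 : (((E.symm (x, y))⁻¹ : Tˣ) : T) = e.symm (((x⁻¹ : Rˣ) : R), ((y⁻¹ : Sˣ) : S)) := rfl
  rw [h1, h2, hf, hg]
  ring

theorem exists_mulShift {n : ℕ} [NeZero n] (ψ f : AddChar (ZMod n) ℂ) (hψ : ψ.IsPrimitive) :
    ∃ a, f = ψ.mulShift a := by
  have hinj := AddChar.to_mulShift_inj_of_isPrimitive hψ
  have hbij := (Fintype.bijective_iff_injective_and_card _).mpr ⟨hinj, (AddChar.card_eq).symm⟩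
  obtain ⟨a, ha⟩ := hbij.2 f
  exact ⟨a, ha.symm⟩

theorem Kl_field {p : ℕ} [hp : Fact p.Prime] (f g : AddChar (ZMod p) ℂ) :
    Kl f g = ∑ x : ZMod p, if x = 0 then 0 else f x * g x⁻¹ := by
  classical
  unfold Kl
  have := Finset.sum_filter (s := (Finset.univ : Finset (ZMod p))) (fun x => ¬ x = 0)
    (fun x => f x * g x⁻¹)
  simp only [ite_not] at this
  rw [← this]
  refine Finset.sum_bij (fun x _ => (x : ZMod p)) ?_ ?_ ?_ ?_
  · intro x _; simp
  · intro x _ y _ h; exact Units.ext h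
  · intro x hx
    simp at hx
    exact ⟨Units.mk0 x hx, by simp, rfl⟩
  · intro x _; rw [Units.val_inv_eq_inv_val]

theorem Kl_prime {p : ℕ} [hp : Fact p.Prime] (hodd : p ≠ 2) (f g : AddChar (ZMod p) ℂ) (hg : g ≠ 1) :
    ‖Kl f g‖ ≤ 2 * Real.sqrt p := by
  have hp1 : (1:ℝ) ≤ Real.sqrt p := by
    rw [Real.one_le_sqrt]; exact_mod_cast hp.out.one_le
  have hgp : g.IsPrimitive := AddChar.IsPrimitive.of_ne_one hg
  rw [Kl_field]
  by_cases hf : f = 1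
  · subst hf
    have : ∑ x : ZMod p, (if x = 0 then (0:ℂ) else (1 : AddChar (ZMod p) ℂ) x * g x⁻¹) = -1 := by
      have h1 : ∀ x : ZMod p, (if x = 0 then (0:ℂ) else (1 : AddChar (ZMod p) ℂ) x * g x⁻¹)
          = g x⁻¹ - if x = 0 then 1 else 0 := by
        intro x
        split_ifs with h
        · simp [h]
        · simp
      simp_rw [h1]
      rw [Finset.sum_sub_distrib, Finset.sum_ite_eq' Finset.univ (0 : ZMod p)]
      have h2 := Equiv.sum_comp (Function.Involutive.toPerm (fun x : ZMod p => x⁻¹) inv_involutive)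
        (fun x => g x)
      simp only [Function.Involutive.coe_toPerm] at h2
      rw [h2, AddChar.sum_eq_zero_of_ne_one hg]; simp
    rw [this]; simp; linarith
  · obtain ⟨b, hb⟩ := exists_mulShift f g (AddChar.IsPrimitive.of_ne_one hf)
    have hb0 : b ≠ 0 := by rintro rfl; rw [AddChar.mulShift_zero] at hb; exact hg hb
    have := weil hodd f hf b hb0
    convert this using 4
    · rw [hb, AddChar.mulShift_apply, AddChar.map_add_eq_mul]

theorem Kl_bound_aux (s : ℕ) : Squarefree s → Odd s → ∀ r : ℕ, r ≠ 0 → Nat.Coprime s r →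
    ∀ (n : ℕ) [NeZero n], n = s * r → ∀ f g : AddChar (ZMod n) ℂ,
    ‖Kl f g‖ ≤ (∏ p ∈ s.primeFactors, (2 * Real.sqrt p * (if g ((n / p : ℕ) : ZMod n) = 1 then (p:ℝ) else 1))) * r := by
  induction s using Nat.strong_induction_on with
  | _ s ih =>
  intro hsq hodd r hr hcop n _ hn f g
  by_cases hs1 : s = 1
  · subst hs1
    have := Kl_trivial f g
    rw [ZMod.card] at this
    simpa [hn] using this
  have hpp := Nat.minFac_prime hs1
  have hmf := s.minFac_dvd
  generalize s.minFac = p at hpp hmf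
  obtain ⟨s', hs'⟩ := hmf
  haveI : Fact p.Prime := ⟨hpp⟩
  subst hs'
  have hs'0 : s' ≠ 0 := by rintro rfl; simp at hsq
  have hlt : s' < p * s' := by
    have := hpp.two_le; have := Nat.pos_of_ne_zero hs'0; nlinarith
  have hsq' : Squarefree s' := hsq.squarefree_of_dvd (dvd_mul_left _ _)
  have hodd' : Odd s' := (Nat.odd_mul.mp hodd).2
  have hpodd : p ≠ 2 := by
    rintro rfl; have := (Nat.odd_mul.mp hodd).1; exact absurd this (by decide)
  have hcop1 : Nat.Coprime p s' := Nat.coprime_of_squarefree_mul hsq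
  have hcop2 : Nat.Coprime p r := Nat.Coprime.coprime_mul_right hcop
  have hcop3 : Nat.Coprime s' r := Nat.Coprime.coprime_mul_left hcop
  have hcop4 : Nat.Coprime p (s' * r) := Nat.Coprime.mul_right hcop1 hcop2
  obtain ⟨m, hm⟩ : ∃ m, m = s' * r := ⟨_, rfl⟩
  have hnm : n = p * m := by rw [hn, hm]; ring
  rw [← hm] at hcop4
  haveI : NeZero m := ⟨by rw [hm]; positivity⟩
  subst hnm
  let e := ZMod.chineseRemainder hcop4
  let i1 : ZMod p →+ ZMod (p * m) := e.symm.toAddMonoidHom.comp (AddMonoidHom.inl _ _)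
  let i2 : ZMod m →+ ZMod (p * m) := e.symm.toAddMonoidHom.comp (AddMonoidHom.inr _ _)
  have hi : ∀ x y, e.symm (x, y) = i1 x + i2 y := by
    intro x y
    change _ = e.symm (x, 0) + e.symm (0, y)
    rw [← map_add]; simp
  have hprod := Kl_prod (ZMod (p * m)) e f g (f.compAddMonoidHom i1) (g.compAddMonoidHom i1)
    (f.compAddMonoidHom i2) (g.compAddMonoidHom i2)
    (by intro x y; rw [hi, AddChar.map_add_eq_mul]; rfl)
    (by intro x y; rw [hi, AddChar.map_add_eq_mul]; rfl)
  have hb2 := ih s' hlt hsq' hodd' r hr hcop3 m hm (f.compAddMonoidHom i2) (g.compAddMonoidHom i2)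
  have hsp : (0:ℝ) < Real.sqrt p := Real.sqrt_pos.mpr (by exact_mod_cast hpp.pos)
  have hsp1 : (1:ℝ) ≤ Real.sqrt p := by
    rw [Real.one_le_sqrt]; exact_mod_cast hpp.one_le
  have hb1 : ‖Kl (f.compAddMonoidHom i1) (g.compAddMonoidHom i1)‖ ≤
      2 * Real.sqrt p * (if g ((p * m / p : ℕ) : ZMod (p * m)) = 1 then (p:ℝ) else 1) := by
    by_cases h : g.compAddMonoidHom i1 = 1
    · have h1 : g ((p * m / p : ℕ) : ZMod (p * m)) = 1 := by
        rw [Nat.mul_div_cancel_left _ hpp.pos]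
        have h2 : ((m : ℕ) : ZMod (p * m)) = i1 (m : ZMod p) := by
          apply e.injective
          change _ = e (e.symm ((m : ZMod p), 0))
          rw [e.apply_symm_apply, map_natCast]
          ext <;> simp
        rw [h2]
        exact congrArg (fun φ : AddChar (ZMod p) ℂ => φ (m : ZMod p)) h
      rw [if_pos h1]
      have := Kl_trivial (f.compAddMonoidHom i1) (g.compAddMonoidHom i1)
      rw [ZMod.card] at this
      refine this.trans ?_
      have hp0 : (0:ℝ) ≤ p := by positivity
      nlinarith
    · have := Kl_prime hpodd (f.compAddMonoidHom i1) (g.compAddMonoidHom i1) h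
      refine this.trans ?_
      split_ifs
      · have hp0 : (1:ℝ) ≤ p := by exact_mod_cast hpp.one_le
        nlinarith
      · linarith
  have hpf : (p * s').primeFactors = insert p s'.primeFactors := by
    rw [Nat.primeFactors_mul hpp.ne_zero hs'0, hpp.primeFactors]; rfl
  have hpn : p ∉ s'.primeFactors := by
    intro h
    have := Nat.dvd_of_mem_primeFactors h
    exact (hpp.coprime_iff_not_dvd.mp hcop1) this
  rw [hpf, Finset.prod_insert hpn, hprod, norm_mul, mul_assoc]
  refine mul_le_mul hb1 (hb2.trans ?_) (norm_nonneg _) (by positivity)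
  refine mul_le_mul_of_nonneg_right ?_ (by positivity)
  refine Finset.prod_le_prod (fun i _ => by positivity) fun p' hp' => ?_
  have hp'p := Nat.prime_of_mem_primeFactors hp'
  refine mul_le_mul_of_nonneg_left ?_ (by positivity)
  have hdvd : p' ∣ m := by rw [hm]; exact (Nat.dvd_of_mem_primeFactors hp').mul_right r
  by_cases h : (g.compAddMonoidHom i2) ((m / p' : ℕ) : ZMod m) = 1
  · have h1 : g ((p * m / p' : ℕ) : ZMod (p * m)) = 1 := by
      have h2 : ((p * m / p' : ℕ) : ZMod (p * m)) = p • i2 ((m / p' : ℕ) : ZMod m) := by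
        apply e.injective
        change _ = e (p • e.symm (0, ((m / p' : ℕ) : ZMod m)))
        rw [map_nsmul, e.apply_symm_apply, map_natCast, Nat.mul_div_assoc _ hdvd]
        ext <;> simp
      rw [h2, AddChar.map_nsmul_eq_pow]
      have h3 : g (i2 ((m / p' : ℕ) : ZMod m)) = 1 := h
      rw [h3, one_pow]
    rw [if_pos h, if_pos h1]
  · rw [if_neg h]
    split_ifs
    · exact_mod_cast hp'p.one_le
    · exact le_rfl

end
end KL

end ModB1

section ModB2

open Finset
namespace KL
noncomputable section
variable {q : ℕ} [NeZero q]

abbrev ee (q : ℕ) [NeZero q] : AddChar (ZMod q) ℂ := ZMod.stdAddChar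

theorem sum_val (F : ℕ → ℝ) : ∑ h : ZMod q, F h.val = ∑ j ∈ Finset.range q, F j := by
  refine Finset.sum_bij (fun h _ => h.val) ?_ ?_ ?_ ?_
  · intro h _; exact Finset.mem_range.mpr (ZMod.val_lt h)
  · intro a _ b _ h; exact ZMod.val_injective q h
  · intro j hj
    exact ⟨(j : ZMod q), Finset.mem_univ _, ZMod.val_cast_of_lt (Finset.mem_range.mp hj)⟩
  · intro h _; rfl

theorem sin_pi_ge (t : ℝ) (h0 : 0 ≤ t) (h1 : t ≤ 1) : 2 * min t (1 - t) ≤ Real.sin (Real.pi * t) := by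
  have hpi := Real.pi_pos
  have key : ∀ u : ℝ, 0 ≤ u → u ≤ 1/2 → 2 * u ≤ Real.sin (Real.pi * u) := by
    intro u hu hu'
    have := Real.mul_le_sin (x := Real.pi * u) (by positivity) (by nlinarith)
    calc 2 * u = 2 / Real.pi * (Real.pi * u) := by field_simp
      _ ≤ _ := this
  by_cases h : t ≤ 1/2
  · exact le_trans (by linarith [min_le_left t (1-t)]) (key t h0 h)
  · have h2 := key (1 - t) (by linarith) (by linarith)
    rw [show Real.pi * (1 - t) = Real.pi - Real.pi * t by ring, Real.sin_pi_sub] at h2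
    exact le_trans (by linarith [min_le_right t (1-t)]) h2

theorem val_pos {k : ZMod q} (hk : k ≠ 0) : 0 < k.val := by
  rw [Nat.pos_iff_ne_zero]; intro h; exact hk ((ZMod.val_eq_zero k).mp h)

theorem norm_one_sub_ee (k : ZMod q) :
    4 * min ((k.val : ℝ) / q) (1 - (k.val : ℝ) / q) ≤ ‖1 - ee q k‖ := by
  have hq : (0:ℝ) < q := by exact_mod_cast Nat.pos_of_ne_zero (NeZero.ne q)
  have hlt : (k.val : ℝ) < q := by exact_mod_cast ZMod.val_lt k
  have hcoe : ee q k = Complex.exp (Complex.I * ((2 * Real.pi * (k.val / q) : ℝ) : ℂ)) := by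
    have := ZMod.stdAddChar_coe (N := q) (k.val : ℤ)
    rw [show (((k.val : ℤ)) : ZMod q) = k by simp] at this
    change ZMod.stdAddChar k = _
    rw [this]
    congr 1; push_cast; ring
  rw [norm_sub_rev, hcoe, Complex.norm_exp_I_mul_ofReal_sub_one]
  have := sin_pi_ge ((k.val : ℝ) / q) (by positivity) (by rw [div_le_one hq]; exact hlt.le)
  rw [norm_mul, Real.norm_eq_abs, Real.norm_eq_abs, abs_of_pos (by norm_num : (0:ℝ) < 2),
    show 2 * Real.pi * ((k.val : ℝ) / q) / 2 = Real.pi * (k.val / q) by ring]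
  linarith [le_abs_self (Real.sin (Real.pi * (k.val / q)))]

theorem inv_norm_le (k : ZMod q) (hk : k ≠ 0) :
    ‖1 - ee q k‖⁻¹ ≤ (q : ℝ) / 4 * (1 / (k.val : ℝ) + 1 / ((q : ℝ) - k.val)) := by
  have hq : (0:ℝ) < q := by exact_mod_cast Nat.pos_of_ne_zero (NeZero.ne q)
  have hlt : (k.val : ℝ) < q := by exact_mod_cast ZMod.val_lt k
  have hk0 : (0:ℝ) < k.val := by exact_mod_cast val_pos hk
  have h := norm_one_sub_ee k
  have hA : (0:ℝ) < (k.val : ℝ) / q := by positivity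
  have hB : (0:ℝ) < 1 - (k.val : ℝ) / q := by rw [sub_pos, div_lt_one hq]; exact hlt
  have hmin : 0 < 4 * min ((k.val : ℝ) / q) (1 - (k.val : ℝ) / q) := by
    have := lt_min hA hB; linarith
  refine (inv_anti₀ hmin h).trans ?_
  have e1 : (q : ℝ) / 4 * (1 / (k.val : ℝ)) = (4 * ((k.val : ℝ) / q))⁻¹ := by field_simp
  have e2 : (q : ℝ) / 4 * (1 / ((q : ℝ) - k.val)) = (4 * (1 - (k.val : ℝ) / q))⁻¹ := by
    have : (q:ℝ) - k.val ≠ 0 := by linarith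
    field_simp
  rw [mul_add, e1, e2]
  rcases min_choice ((k.val : ℝ) / q) (1 - (k.val : ℝ) / q) with hh | hh <;> rw [hh]
  · have : 0 < (4 * (1 - (k.val : ℝ) / q))⁻¹ := by positivity
    linarith
  · have : 0 < (4 * ((k.val : ℝ) / q))⁻¹ := by positivity
    linarith

theorem ee_geom (k : ZMod q) (Y0 : ℤ) (n : ℕ) :
    (1 - ee q k) * ∑ i ∈ Finset.range n, ee q (k * ((Y0 + i : ℤ) : ZMod q)) =
      ee q (k * (Y0 : ZMod q)) - ee q (k * ((Y0 + n : ℤ) : ZMod q)) := by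
  induction n with
  | zero => simp
  | succ n ih =>
    rw [Finset.sum_range_succ, mul_add, ih]
    have : ee q (k * ((Y0 + (n + 1 : ℕ) : ℤ) : ZMod q)) = ee q k * ee q (k * ((Y0 + n : ℤ) : ZMod q)) := by
      rw [← AddChar.map_add_eq_mul]; congr 1; push_cast; ring
    rw [this]; ring

theorem ee_ne_one (k : ZMod q) (hk : k ≠ 0) : 1 - ee q k ≠ 0 := by
  intro h
  have : ee q k = ee q 0 := by rw [AddChar.map_zero_eq_one]; linear_combination -h
  exact hk (ZMod.injective_stdAddChar this)

theorem geom_bound (k : ZMod q) (hk : k ≠ 0) (Y0 : ℤ) (n : ℕ) :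
    ‖∑ i ∈ Finset.range n, ee q (k * ((Y0 + i : ℤ) : ZMod q))‖ ≤ 2 * ‖1 - ee q k‖⁻¹ := by
  have h := ee_geom k Y0 n
  have h0 := ee_ne_one k hk
  have : ∑ i ∈ Finset.range n, ee q (k * ((Y0 + i : ℤ) : ZMod q)) =
      (ee q (k * (Y0 : ZMod q)) - ee q (k * ((Y0 + n : ℤ) : ZMod q))) * (1 - ee q k)⁻¹ := by
    rw [← h]; field_simp
  rw [this, norm_mul, norm_inv]
  refine mul_le_mul_of_nonneg_right ?_ (by positivity)
  refine (norm_sub_le _ _).trans ?_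
  rw [AddChar.norm_apply, AddChar.norm_apply]; norm_num

theorem sum_inv_range (q : ℕ) : ∑ j ∈ Finset.range q, 1 / (j : ℝ) ≤ 1 + Real.log q := by
  have h := harmonic_le_one_add_log q
  refine le_trans ?_ h
  rw [harmonic]
  push_cast
  rcases q with _ | q
  · simp
  · rw [Finset.sum_range_succ']
    simp only [Nat.cast_zero, div_zero, add_zero]
    rw [Finset.sum_range_succ]
    have : (0:ℝ) ≤ ((q:ℝ) + 1)⁻¹ := by positivity
    simp only [one_div, Nat.cast_add, Nat.cast_one]
    linarith

theorem sum_inv_range' (q : ℕ) : ∑ j ∈ Finset.range q, 1 / ((q : ℝ) - j) ≤ 1 + Real.log q := by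
  have h := harmonic_le_one_add_log q
  refine le_trans ?_ h
  rw [harmonic]
  push_cast
  rw [← Finset.sum_range_reflect]
  apply le_of_eq
  refine Finset.sum_congr rfl fun j hj => ?_
  rw [Finset.mem_range] at hj
  rw [one_div]; congr 1
  rw [show q - 1 - j = q - (j + 1) by omega, Nat.cast_sub (by omega)]; push_cast; ring

theorem L1 (Y0 : ℤ) (n : ℕ) (hn : n ≤ q) :
    ∑ h : ZMod q, ‖∑ i ∈ Finset.range n, ee q (h * ((Y0 + i : ℤ) : ZMod q))‖
      ≤ q * (Real.log q + 2) := by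
  classical
  have hq : (0:ℝ) < q := by exact_mod_cast Nat.pos_of_ne_zero (NeZero.ne q)
  have hb : ∀ h : ZMod q, ‖∑ i ∈ Finset.range n, ee q (h * ((Y0 + i : ℤ) : ZMod q))‖ ≤
      (if h = 0 then (q:ℝ) else 0) + (q:ℝ)/2 * (1 / (h.val : ℝ) + 1 / ((q:ℝ) - h.val)) := by
    intro h
    have hlt : (h.val : ℝ) < q := by exact_mod_cast ZMod.val_lt h
    by_cases h0 : h = 0
    · subst h0
      simp
      have : (n:ℝ) ≤ q := by exact_mod_cast hn
      have h3 : (0:ℝ) ≤ (q:ℝ)/2 * (q:ℝ)⁻¹ := by positivity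
      linarith
    · rw [if_neg h0, zero_add]
      refine (geom_bound h h0 Y0 n).trans ?_
      have := inv_norm_le h h0
      linarith
  refine (Finset.sum_le_sum fun h _ => hb h).trans ?_
  rw [Finset.sum_add_distrib, Finset.sum_ite_eq' Finset.univ (0 : ZMod q), if_pos (Finset.mem_univ _),
    ← Finset.mul_sum, sum_val (q := q) (fun j => 1 / (j:ℝ) + 1 / ((q:ℝ) - j)),
    Finset.sum_add_distrib]
  have h1 := sum_inv_range q
  have h2 := sum_inv_range' q
  nlinarith

def kt (f g : AddChar (ZMod q) ℂ) (x : ZMod q) : ℂ :=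
  by
    classical
    exact if IsUnit x then f x * g x⁻¹ else 0

theorem sum_kt (f g : AddChar (ZMod q) ℂ) : ∑ x : ZMod q, kt f g x = Kl f g := by
  classical
  unfold kt Kl
  rw [← Finset.sum_filter]
  symm
  refine Finset.sum_bij (fun x _ => (x : ZMod q)) ?_ ?_ ?_ ?_
  · intro x _; simp
  · intro x _ y _ h; exact Units.ext h
  · intro x hx
    rw [Finset.mem_filter] at hx
    obtain ⟨u, rfl⟩ := hx.2
    exact ⟨u, @Finset.mem_univ _ (_) u, rfl⟩
  · intro x _
    rw [ZMod.inv_coe_unit]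

theorem incomplete (f g : AddChar (ZMod q) ℂ) (B : ℝ) (hB : ∀ f', ‖Kl f' g‖ ≤ B)
    (x0 : ℤ) (n : ℕ) (hn : n ≤ q) :
    ‖∑ i ∈ Finset.range n, kt f g ((x0 + i : ℤ) : ZMod q)‖ ≤ B * (Real.log q + 2) := by
  classical
  have hq : (0:ℝ) < q := by exact_mod_cast Nat.pos_of_ne_zero (NeZero.ne q)
  have hqc : (q:ℂ) ≠ 0 := by exact_mod_cast hq.ne'
  have horth : ∀ y : ZMod q, (q:ℂ) * kt f g y =
      ∑ h : ZMod q, ee q (h * (-y)) * Kl (f * (ee q).mulShift h) g := by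
    intro y
    have h1 : ∀ h : ZMod q, ee q (h * (-y)) * Kl (f * (ee q).mulShift h) g =
        ∑ x : ZMod q, kt f g x * ee q (h * (x - y)) := by
      intro h
      rw [← sum_kt, Finset.mul_sum]
      refine Finset.sum_congr rfl fun x _ => ?_
      unfold kt
      split_ifs
      · rw [AddChar.mul_apply, AddChar.mulShift_apply, sub_eq_add_neg, mul_add,
          AddChar.map_add_eq_mul]; ring
      · simp
    simp_rw [h1]
    rw [Finset.sum_comm]
    simp_rw [← Finset.mul_sum, AddChar.sum_mulShift _ (ZMod.isPrimitive_stdAddChar q), ZMod.card,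
      sub_eq_zero]
    simp [mul_comm]
  have hmain : (q:ℂ) * ∑ i ∈ Finset.range n, kt f g ((x0 + i : ℤ) : ZMod q) =
      ∑ h : ZMod q, (∑ i ∈ Finset.range n, ee q ((-h) * ((x0 + i : ℤ) : ZMod q))) *
        Kl (f * (ee q).mulShift h) g := by
    rw [Finset.mul_sum]
    simp_rw [horth, Finset.sum_mul]
    rw [Finset.sum_comm]
    simp only [mul_neg, neg_mul]
  have hnorm : (q:ℝ) * ‖∑ i ∈ Finset.range n, kt f g ((x0 + i : ℤ) : ZMod q)‖ ≤
      (q * (Real.log q + 2)) * B := by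
    have : (q:ℝ) * ‖∑ i ∈ Finset.range n, kt f g ((x0 + i : ℤ) : ZMod q)‖ =
        ‖(q:ℂ) * ∑ i ∈ Finset.range n, kt f g ((x0 + i : ℤ) : ZMod q)‖ := by
      rw [norm_mul]; simp
    rw [this, hmain]
    have hB0 : 0 ≤ B := (norm_nonneg _).trans (hB 1)
    calc _ ≤ ∑ h : ZMod q, ‖∑ i ∈ Finset.range n, ee q ((-h) * ((x0 + i : ℤ) : ZMod q))‖ * B := by
          refine (norm_sum_le _ _).trans (Finset.sum_le_sum fun h _ => ?_)
          rw [norm_mul]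
          exact mul_le_mul_of_nonneg_left (hB _) (norm_nonneg _)
      _ = (∑ h : ZMod q, ‖∑ i ∈ Finset.range n, ee q (h * ((x0 + i : ℤ) : ZMod q))‖) * B := by
          rw [Finset.sum_mul]
          exact Equiv.sum_comp (Equiv.neg (ZMod q)) (fun h =>
            ‖∑ i ∈ Finset.range n, ee q (h * ((x0 + i : ℤ) : ZMod q))‖ * B)
      _ ≤ _ := mul_le_mul_of_nonneg_right (L1 x0 n hn) hB0
  nlinarith

/-- count of solutions in a trapezoid -/
theorem trapezoid (U : ZMod q) (B : ZMod q → ℝ)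
    (hB : ∀ k f, ‖Kl f ((ee q).mulShift (-(k * U)))‖ ≤ B k)
    (x0 : ℤ) (n : ℕ) (hn : n ≤ q) (Y0 Z : ℤ) (hYZ : ∀ i < n, Y0 - 1 ≤ Z - (x0 + i))
    [DecidablePred fun i : ℕ => IsUnit ((x0 + i : ℤ) : ZMod q)] :
    |((∑ i ∈ (Finset.range n).filter (fun i : ℕ => IsUnit ((x0 + i : ℤ) : ZMod q)),
        ((Finset.Icc Y0 (Z - (x0 + i))).filter
          (fun y : ℤ => (y : ZMod q) = U * (((x0 + i : ℤ) : ZMod q))⁻¹)).card : ℕ) : ℝ)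
      - ∑ i ∈ (Finset.range n).filter (fun i : ℕ => IsUnit ((x0 + i : ℤ) : ZMod q)),
        ((Z : ℝ) - (x0 + i) - Y0 + 1) / q|
    ≤ (Real.log q + 2) / 2 * ∑ k ∈ Finset.univ.erase (0 : ZMod q),
        B k * (1 / (k.val : ℝ) + 1 / ((q:ℝ) - k.val)) := by
  classical
  have hq : (0:ℝ) < q := by exact_mod_cast Nat.pos_of_ne_zero (NeZero.ne q)
  have hqc : (q:ℂ) ≠ 0 := by exact_mod_cast hq.ne'
  set S := (Finset.range n).filter (fun i : ℕ => IsUnit ((x0 + i : ℤ) : ZMod q)) with hS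
  let X : ℕ → ZMod q := fun i => ((x0 + i : ℤ) : ZMod q)
  let W : ℕ → ℕ := fun i => (Z - (x0 + i) - Y0 + 1).toNat
  have hW : ∀ i ∈ S, ((W i : ℕ) : ℤ) = Z - (x0 + i) - Y0 + 1 := by
    intro i hi
    rw [hS, Finset.mem_filter, Finset.mem_range] at hi
    have := hYZ i hi.1
    exact Int.toNat_of_nonneg (by omega)
  have hIcc : ∀ i ∈ S, ∀ F : ℤ → ℂ, ∑ y ∈ Finset.Icc Y0 (Z - (x0 + i)), F y =
      ∑ j ∈ Finset.range (W i), F (Y0 + j) := by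
    intro i hi F
    have hw := hW i hi
    symm
    refine Finset.sum_bij (fun j _ => Y0 + (j:ℤ)) ?_ ?_ ?_ ?_
    · intro j hj; rw [Finset.mem_range] at hj; rw [Finset.mem_Icc]; omega
    · intro a _ b _ h; omega
    · intro y hy
      rw [Finset.mem_Icc] at hy
      refine ⟨(y - Y0).toNat, ?_, ?_⟩
      · rw [Finset.mem_range]; omega
      · omega
    · intro j _; rfl
  have hcount : ∀ i ∈ S, (q:ℂ) * (((Finset.Icc Y0 (Z - (x0 + i))).filter
          (fun y : ℤ => (y : ZMod q) = U * (X i)⁻¹)).card : ℂ) =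
      ((Z : ℂ) - (x0 + i) - Y0 + 1) + ∑ k ∈ Finset.univ.erase (0 : ZMod q),
        ee q (-(k * U) * (X i)⁻¹) *
          ((ee q (k * (Y0 : ZMod q)) - ee q (k * ((Z + 1 : ℤ) : ZMod q)) * ee q ((-k) * X i)) * (1 - ee q k)⁻¹) := by
    intro i hi
    have h1 : (q:ℂ) * (((Finset.Icc Y0 (Z - (x0 + i))).filter
          (fun y : ℤ => (y : ZMod q) = U * (X i)⁻¹)).card : ℂ) =
        ∑ y ∈ Finset.Icc Y0 (Z - (x0 + i)), ∑ k : ZMod q, ee q (k * ((y : ZMod q) - U * (X i)⁻¹)) := by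
      simp_rw [AddChar.sum_mulShift _ (ZMod.isPrimitive_stdAddChar q), ZMod.card, sub_eq_zero]
      rw [Finset.card_filter]
      push_cast
      rw [Finset.mul_sum]
      refine Finset.sum_congr rfl fun y _ => ?_
      split_ifs <;> simp
    rw [h1, Finset.sum_comm, ← Finset.add_sum_erase _ _ (Finset.mem_univ (0 : ZMod q))]
    congr 1
    · rw [hIcc i hi]
      simp only [zero_mul, AddChar.map_zero_eq_one, Finset.sum_const, Finset.card_range,
        nsmul_eq_mul, mul_one]
      have := congrArg (fun z : ℤ => (z : ℂ)) (hW i hi)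
      push_cast at this
      rw [this]
    · refine Finset.sum_congr rfl fun k hk => ?_
      have hk0 : k ≠ 0 := (Finset.mem_erase.mp hk).1
      rw [hIcc i hi]
      have hg := ee_geom k Y0 (W i)
      rw [hW i hi] at hg
      have h2 : ∀ j : ℕ, ee q (k * (((Y0 + j : ℤ) : ZMod q) - U * (X i)⁻¹)) =
          ee q (-(k * U) * (X i)⁻¹) * ee q (k * ((Y0 + j : ℤ) : ZMod q)) := by
        intro j
        rw [← AddChar.map_add_eq_mul]; congr 1; ring
      simp_rw [h2]
      rw [← Finset.mul_sum]
      congr 1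
      rw [eq_mul_inv_iff_mul_eq₀ (ee_ne_one k hk0), mul_comm, hg, ← AddChar.map_add_eq_mul]
      congr 2
      simp only [X]; push_cast; ring
  set E : ℝ := ((∑ i ∈ S, ((Finset.Icc Y0 (Z - (x0 + i))).filter
          (fun y : ℤ => (y : ZMod q) = U * (X i)⁻¹)).card : ℕ) : ℝ)
      - ∑ i ∈ S, ((Z : ℝ) - (x0 + i) - Y0 + 1) / q with hE
  have hEc : (q:ℂ) * ((E : ℝ) : ℂ) = ∑ k ∈ Finset.univ.erase (0 : ZMod q),
      (ee q (k * (Y0 : ZMod q)) * (∑ i ∈ S, ee q (-(k * U) * (X i)⁻¹)) -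
        ee q (k * ((Z + 1 : ℤ) : ZMod q)) * (∑ i ∈ S, ee q ((-k) * X i) * ee q (-(k * U) * (X i)⁻¹)))
        * (1 - ee q k)⁻¹ := by
    rw [hE]
    push_cast
    rw [mul_sub, Finset.mul_sum, Finset.mul_sum, ← Finset.sum_sub_distrib]
    have : ∀ i ∈ S, (q:ℂ) * (((Finset.Icc Y0 (Z - (x0 + i))).filter
          (fun y : ℤ => (y : ZMod q) = U * (X i)⁻¹)).card : ℂ) - q * (((Z : ℂ) - (x0 + i) - Y0 + 1) / q)
          = ∑ k ∈ Finset.univ.erase (0 : ZMod q),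
        ee q (-(k * U) * (X i)⁻¹) *
          ((ee q (k * (Y0 : ZMod q)) - ee q (k * ((Z + 1 : ℤ) : ZMod q)) * ee q ((-k) * X i)) * (1 - ee q k)⁻¹) := by
      intro i hi
      rw [hcount i hi, mul_div_cancel₀ _ hqc]; ring
    rw [Finset.sum_congr rfl this, Finset.sum_comm]
    refine Finset.sum_congr rfl fun k _ => ?_
    rw [Finset.mul_sum, Finset.mul_sum, ← Finset.sum_sub_distrib, Finset.sum_mul]
    refine Finset.sum_congr rfl fun i _ => ?_
    push_cast
    ring
  have hS1 : ∀ (f : AddChar (ZMod q) ℂ) (k : ZMod q),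
      ‖∑ i ∈ S, f (X i) * ee q (-(k * U) * (X i)⁻¹)‖ ≤ B k * (Real.log q + 2) := by
    intro f k
    have := incomplete f ((ee q).mulShift (-(k * U))) (B k) (hB k) x0 n hn
    convert this using 2
    rw [hS, Finset.sum_filter]
    refine Finset.sum_congr rfl fun i _ => ?_
    unfold kt
    by_cases hu : IsUnit ((x0 + i : ℤ) : ZMod q)
    · rw [if_pos hu, if_pos hu]; rfl
    · rw [if_neg hu, if_neg hu]
  have hnorm : (q:ℝ) * |E| ≤ ∑ k ∈ Finset.univ.erase (0 : ZMod q),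
      (2 * (B k * (Real.log q + 2))) * ((q : ℝ) / 4 * (1 / (k.val : ℝ) + 1 / ((q : ℝ) - k.val))) := by
    have h1 : (q:ℝ) * |E| = ‖(q:ℂ) * ((E : ℝ) : ℂ)‖ := by
      rw [norm_mul, Complex.norm_real]; simp
    rw [h1, hEc]
    refine (norm_sum_le _ _).trans (Finset.sum_le_sum fun k hk => ?_)
    have hk0 : k ≠ 0 := (Finset.mem_erase.mp hk).1
    rw [norm_mul, norm_inv]
    have hs1 := hS1 1 k
    simp only [AddChar.one_apply, one_mul] at hs1
    have hs2 := hS1 ((ee q).mulShift (-k)) k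
    simp only [AddChar.mulShift_apply] at hs2
    refine mul_le_mul ?_ (inv_norm_le k hk0) (by positivity) ?_
    · refine (norm_sub_le _ _).trans ?_
      rw [norm_mul, norm_mul, AddChar.norm_apply, AddChar.norm_apply]
      linarith
    · linarith [(norm_nonneg _).trans hs1]
  have hfin : (q:ℝ) * |E| ≤ q * ((Real.log q + 2) / 2 * ∑ k ∈ Finset.univ.erase (0 : ZMod q),
        B k * (1 / (k.val : ℝ) + 1 / ((q:ℝ) - k.val))) := by
    refine hnorm.trans (le_of_eq ?_)
    rw [Finset.mul_sum, Finset.mul_sum]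
    refine Finset.sum_congr rfl fun k _ => ?_
    ring
  exact le_of_mul_le_mul_left hfin hq
end
end KL

end ModB2

section ModB3

open Finset
namespace KL
noncomputable section

theorem Kl_bound (s r : ℕ) (hs : Squarefree s) (hodd : Odd s) (hr : r ≠ 0) (hc : Nat.Coprime s r)
    (n : ℕ) [NeZero n] (hn : n = s * r) (U : ZMod n) (hU : IsUnit U) (k : ZMod n)
    (f : AddChar (ZMod n) ℂ) :
    ‖Kl f ((ee n).mulShift (-(k * U)))‖ ≤ s.divisors.card * Real.sqrt s * r * (Nat.gcd k.val s : ℕ) := by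
  have h := Kl_bound_aux s hs hodd r hr hc n hn f ((ee n).mulShift (-(k * U)))
  refine h.trans ?_
  have hs0 : s ≠ 0 := hs.ne_zero
  have hn0 : n ≠ 0 := NeZero.ne n
  have hcond : ∀ p ∈ s.primeFactors, ((ee n).mulShift (-(k * U)) ((n / p : ℕ) : ZMod n) = 1 ↔ p ∣ k.val) := by
    intro p hp
    have hpp := Nat.prime_of_mem_primeFactors hp
    have hpn : p ∣ n := (Nat.dvd_of_mem_primeFactors hp).trans ⟨r, hn⟩
    obtain ⟨m, rfl⟩ := hpn
    have hm0 : m ≠ 0 := by rintro rfl; simp at hn0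
    rw [AddChar.mulShift_apply, Nat.mul_div_cancel_left _ hpp.pos]
    have e1 : ee (p*m) (-(k * U) * (m : ZMod (p*m))) = 1 ↔ -(k * U) * (m : ZMod (p*m)) = 0 := by
      constructor
      · intro h
        apply ZMod.injective_stdAddChar
        rw [AddChar.map_zero_eq_one]; exact h
      · intro h; rw [h, AddChar.map_zero_eq_one]
    rw [e1]
    have e2 : -(k * U) * (m : ZMod (p*m)) = -(U * (k * m)) := by ring
    rw [e2, neg_eq_zero, hU.mul_right_eq_zero]
    have e3 : k * (m : ZMod (p*m)) = ((k.val * m : ℕ) : ZMod (p*m)) := by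
      push_cast; rw [ZMod.natCast_zmod_val]
    rw [e3, ZMod.natCast_eq_zero_iff, Nat.mul_dvd_mul_iff_right (Nat.pos_of_ne_zero hm0)]
  have hprod : (∏ p ∈ s.primeFactors, (2 * Real.sqrt p *
      (if (ee n).mulShift (-(k * U)) ((n / p : ℕ) : ZMod n) = 1 then (p:ℝ) else 1))) =
      s.divisors.card * Real.sqrt s * (Nat.gcd k.val s : ℕ) := by
    have h1 : ∀ p ∈ s.primeFactors, (2 * Real.sqrt p *
      (if (ee n).mulShift (-(k * U)) ((n / p : ℕ) : ZMod n) = 1 then (p:ℝ) else 1)) =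
        2 * Real.sqrt p * (if p ∣ k.val then (p:ℝ) else 1) := by
      intro p hp
      simp only [hcond p hp]
    rw [Finset.prod_congr rfl h1, Finset.prod_mul_distrib, Finset.prod_mul_distrib]
    congr 1
    · congr 1
      · rw [Nat.card_divisors hs0, Finset.prod_const]
        push_cast
        rw [Finset.prod_congr rfl (g := fun _ => (2:ℝ)), Finset.prod_const]
        intro p hp
        rw [Nat.factorization_eq_one_of_squarefree hs (Nat.prime_of_mem_primeFactors hp) (Nat.dvd_of_mem_primeFactors hp)]
        norm_num
      · have : (s:ℝ) = ∏ p ∈ s.primeFactors, (p:ℝ) := by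
          conv_lhs => rw [← Nat.prod_primeFactors_of_squarefree hs]
          push_cast; rfl
        rw [this, Real.sqrt_prod]
        intro p _; positivity
    · rw [← Finset.prod_filter]
      have hg : Squarefree (Nat.gcd k.val s) := hs.squarefree_of_dvd (Nat.gcd_dvd_right _ _)
      rw [← Nat.prod_primeFactors_of_squarefree hg]
      push_cast
      refine Finset.prod_congr ?_ fun _ _ => rfl
      ext p
      simp only [Finset.mem_filter, Nat.mem_primeFactors, Nat.dvd_gcd_iff]
      have : Nat.gcd k.val s ≠ 0 := hg.ne_zero
      tauto
  rw [hprod]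
  apply le_of_eq; ring

theorem sum_gcd_div (q s : ℕ) (hs : s ≠ 0) :
    ∑ j ∈ Finset.range q, (Nat.gcd j s : ℝ) * (1 / (j:ℝ)) ≤ s.divisors.card * (1 + Real.log q) := by
  have h1 : ∀ j ∈ Finset.range q, (Nat.gcd j s : ℝ) * (1 / (j:ℝ)) ≤
      ∑ d ∈ s.divisors, (if d ∣ j then (d:ℝ) * (1 / (j:ℝ)) else 0) := by
    intro j _
    have hm : Nat.gcd j s ∈ s.divisors := Nat.mem_divisors.mpr ⟨Nat.gcd_dvd_right _ _, hs⟩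
    have := Finset.single_le_sum (f := fun d => if d ∣ j then (d:ℝ) * (1 / (j:ℝ)) else 0)
      (fun d _ => by split_ifs <;> positivity) hm
    simp only [Nat.gcd_dvd_left, if_true] at this
    exact this
  refine (Finset.sum_le_sum h1).trans ?_
  rw [Finset.sum_comm, ← nsmul_eq_mul]
  refine Finset.sum_le_card_nsmul _ _ _ fun d hd => ?_
  have hd0 : 0 < d := Nat.pos_of_mem_divisors hd
  refine le_trans ?_ (sum_inv_range q)
  rw [← Finset.sum_filter]
  have hinj : Set.InjOn (fun j => j / d) ((Finset.range q).filter (fun j => d ∣ j) : Finset ℕ) := by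
    intro a ha b hb h
    simp only [Finset.coe_filter, Set.mem_setOf_eq] at ha hb
    exact (Nat.div_left_inj ha.2 hb.2).mp h
  calc ∑ j ∈ (Finset.range q).filter (fun j => d ∣ j), (d:ℝ) * (1 / (j:ℝ))
      = ∑ j ∈ (Finset.range q).filter (fun j => d ∣ j), 1 / ((j / d : ℕ) : ℝ) := by
        refine Finset.sum_congr rfl fun j hj => ?_
        obtain ⟨i, rfl⟩ := (Finset.mem_filter.mp hj).2
        rw [Nat.mul_div_cancel_left _ hd0]
        push_cast
        have : (d:ℝ) ≠ 0 := by positivity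
        by_cases hi : (i:ℝ) = 0
        · simp [hi]
        · field_simp
    _ = ∑ i ∈ ((Finset.range q).filter (fun j => d ∣ j)).image (fun j => j / d), 1 / (i : ℝ) := by
        rw [Finset.sum_image hinj]
    _ ≤ _ := by
        refine Finset.sum_le_sum_of_subset_of_nonneg ?_ fun i _ _ => by positivity
        intro i hi
        obtain ⟨j, hj, rfl⟩ := Finset.mem_image.mp hi
        have := (Finset.mem_filter.mp hj).1
        rw [Finset.mem_range] at *
        exact lt_of_le_of_lt (Nat.div_le_self _ _) this

theorem sum_gcd_div2 (q s : ℕ) [NeZero q] (hs : s ∣ q) :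
    ∑ k ∈ Finset.univ.erase (0 : ZMod q), (Nat.gcd k.val s : ℝ) *
      (1 / (k.val : ℝ) + 1 / ((q:ℝ) - k.val)) ≤ 2 * (s.divisors.card * (1 + Real.log q)) := by
  have hs0 : s ≠ 0 := by rintro rfl; exact NeZero.ne q (Nat.eq_zero_of_zero_dvd hs)
  have hA : ∑ k ∈ Finset.univ.erase (0 : ZMod q), (Nat.gcd k.val s : ℝ) * (1 / (k.val : ℝ)) ≤
      s.divisors.card * (1 + Real.log q) := by
    refine le_trans ?_ (sum_gcd_div q s hs0)
    rw [← sum_val (q := q) (fun j => (Nat.gcd j s : ℝ) * (1 / (j:ℝ)))]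
    exact Finset.sum_le_sum_of_subset_of_nonneg (Finset.erase_subset _ _) fun i _ _ => by positivity
  have hB : ∑ k ∈ Finset.univ.erase (0 : ZMod q), (Nat.gcd k.val s : ℝ) * (1 / ((q:ℝ) - k.val)) =
      ∑ k ∈ Finset.univ.erase (0 : ZMod q), (Nat.gcd k.val s : ℝ) * (1 / (k.val : ℝ)) := by
    refine Finset.sum_bij (fun k _ => -k) ?_ ?_ ?_ ?_
    · intro k hk; simpa using hk
    · intro a _ b _ h; exact neg_injective h
    · intro b hb; exact ⟨-b, by simpa using hb, neg_neg b⟩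
    · intro k hk
      have hk0 : k ≠ 0 := (Finset.mem_erase.mp hk).1
      haveI : NeZero k := ⟨hk0⟩
      have hv : (-k).val = q - k.val := ZMod.val_neg_of_ne_zero k
      rw [hv, Nat.cast_sub (ZMod.val_lt k).le]
      congr 2
      obtain ⟨m, hm⟩ := hs
      have hle : k.val ≤ q := (ZMod.val_lt k).le
      apply Nat.dvd_antisymm
      · apply Nat.dvd_gcd
        · exact Nat.dvd_sub ((Nat.gcd_dvd_right _ _).trans ⟨m, hm⟩) (Nat.gcd_dvd_left _ _)
        · exact Nat.gcd_dvd_right _ _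
      · apply Nat.dvd_gcd
        · have := Nat.dvd_sub (((Nat.gcd_dvd_right (q - k.val) s)).trans ⟨m, hm⟩) (Nat.gcd_dvd_left (q - k.val) s)
          rwa [Nat.sub_sub_self hle] at this
        · exact Nat.gcd_dvd_right _ _
  simp_rw [mul_add]
  rw [Finset.sum_add_distrib, hB]
  linarith

theorem trapezoid2 (s r : ℕ) (hs : Squarefree s) (hodd : Odd s) (hr : r ≠ 0) (hc : Nat.Coprime s r)
    (q : ℕ) [NeZero q] (hq : q = s * r) (U : ZMod q) (hU : IsUnit U)
    (x0 : ℤ) (n : ℕ) (hn : n ≤ q) (Y0 Z : ℤ) (hYZ : ∀ i < n, Y0 - 1 ≤ Z - (x0 + i))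
    [DecidablePred fun i : ℕ => IsUnit ((x0 + i : ℤ) : ZMod q)] :
    |((∑ i ∈ (Finset.range n).filter (fun i : ℕ => IsUnit ((x0 + i : ℤ) : ZMod q)),
        ((Finset.Icc Y0 (Z - (x0 + i))).filter
          (fun y : ℤ => (y : ZMod q) = U * (((x0 + i : ℤ) : ZMod q))⁻¹)).card : ℕ) : ℝ)
      - ∑ i ∈ (Finset.range n).filter (fun i : ℕ => IsUnit ((x0 + i : ℤ) : ZMod q)),
        ((Z : ℝ) - (x0 + i) - Y0 + 1) / q|
    ≤ (s.divisors.card : ℝ) ^ 2 * Real.sqrt s * r * (Real.log q + 2) ^ 2 := by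
  refine (trapezoid U _ (fun k f => Kl_bound s r hs hodd hr hc q hq U hU k f) x0 n hn Y0 Z hYZ).trans ?_
  have h := sum_gcd_div2 q s ⟨r, hq⟩
  have hlog : 0 ≤ Real.log q := Real.log_natCast_nonneg q
  have e : ∑ k ∈ Finset.univ.erase (0 : ZMod q), (s.divisors.card * Real.sqrt s * r * (Nat.gcd k.val s : ℕ)) *
      (1 / (k.val : ℝ) + 1 / ((q:ℝ) - k.val)) = s.divisors.card * Real.sqrt s * r *
      ∑ k ∈ Finset.univ.erase (0 : ZMod q), (Nat.gcd k.val s : ℝ) *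
      (1 / (k.val : ℝ) + 1 / ((q:ℝ) - k.val)) := by
    rw [Finset.mul_sum]; refine Finset.sum_congr rfl fun k _ => by ring
  rw [e]
  set D : ℝ := (s.divisors.card : ℝ)
  have hD : 0 ≤ D * Real.sqrt s * r := by positivity
  calc (Real.log q + 2) / 2 * (D * Real.sqrt s * r * _) ≤
      (Real.log q + 2) / 2 * (D * Real.sqrt s * r * (2 * (D * (1 + Real.log q)))) := by gcongr
    _ = (D ^ 2 * Real.sqrt s * r) * ((Real.log q + 2) * (1 + Real.log q)) := by ring
    _ ≤ (D ^ 2 * Real.sqrt s * r) * (Real.log q + 2) ^ 2 := by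
      apply mul_le_mul_of_nonneg_left _ (by positivity)
      nlinarith
end
end KL

end ModB3

section ModB4

open Finset
namespace KL
noncomputable section

theorem tau_bound (ε : ℝ) (hε : 0 < ε) :
    ∃ C : ℝ, 0 < C ∧ ∀ n : ℕ, n ≠ 0 → (n.divisors.card : ℝ) ≤ C * (n:ℝ) ^ ε := by
  have hl2 : 0 < Real.log 2 := Real.log_pos (by norm_num)
  set C0 : ℝ := 1 + 1 / (ε * Real.log 2) with hC0
  have hC1 : 1 ≤ C0 := by rw [hC0]; have : 0 < 1 / (ε * Real.log 2) := by positivity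
                          linarith
  set P : ℕ := ⌈(2:ℝ) ^ (1/ε)⌉₊ with hP
  refine ⟨C0 ^ (P + 1), by positivity, fun n hn => ?_⟩
  have hpow : (n:ℝ) ^ ε = ∏ p ∈ n.primeFactors, ((p:ℝ) ^ ε) ^ (n.factorization p) := by
    conv_lhs => rw [← Nat.prod_factorization_pow_eq_self hn]
    rw [Finsupp.prod, Nat.support_factorization]
    push_cast
    rw [← Real.finsetProd_rpow _ _ (fun i _ => by positivity)]
    refine Finset.prod_congr rfl fun p _ => ?_
    rw [← Real.rpow_natCast, ← Real.rpow_natCast, ← Real.rpow_mul (by positivity), ← Real.rpow_mul (by positivity), mul_comm]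
  have hterm : ∀ p ∈ n.primeFactors, ((n.factorization p + 1 : ℕ) : ℝ) ≤
      (if p ≤ P then C0 else 1) * ((p:ℝ) ^ ε) ^ (n.factorization p) := by
    intro p hp
    have hp2 : (2:ℝ) ≤ p := by exact_mod_cast (Nat.prime_of_mem_primeFactors hp).two_le
    set v := n.factorization p
    split_ifs with h
    · have h1 : 1 + ε * Real.log 2 ≤ (p:ℝ) ^ ε := by
        calc 1 + ε * Real.log 2 ≤ Real.exp (ε * Real.log 2) := by
              have := Real.add_one_le_exp (ε * Real.log 2); linarith
          _ = (2:ℝ) ^ ε := by rw [Real.rpow_def_of_pos (by norm_num), mul_comm]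
          _ ≤ _ := Real.rpow_le_rpow (by norm_num) hp2 hε.le
      have h2 : 1 + (v:ℝ) * (ε * Real.log 2) ≤ ((p:ℝ) ^ ε) ^ v := by
        have hb := one_add_mul_le_pow (a := ε * Real.log 2) (by nlinarith [mul_pos hε hl2]) v
        exact hb.trans (pow_le_pow_left₀ (by positivity) h1 v)
      calc ((v + 1 : ℕ) : ℝ) ≤ C0 * (1 + (v:ℝ) * (ε * Real.log 2)) := by
            rw [hC0]
            have e : (1 + 1 / (ε * Real.log 2)) * (1 + (v:ℝ) * (ε * Real.log 2)) =
              1 + v + (v:ℝ) * (ε * Real.log 2) + 1 / (ε * Real.log 2) := by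
              field_simp; ring
            rw [e]; push_cast
            have : 0 ≤ (v:ℝ) * (ε * Real.log 2) + 1 / (ε * Real.log 2) := by positivity
            linarith
        _ ≤ _ := mul_le_mul_of_nonneg_left h2 (by linarith)
    · rw [one_mul]
      have h1 : (2:ℝ) ≤ (p:ℝ) ^ ε := by
        push Not at h
        have h3 : (2:ℝ) ^ (1/ε) ≤ p := (Nat.le_ceil _).trans (by exact_mod_cast h.le)
        calc (2:ℝ) = ((2:ℝ) ^ (1/ε)) ^ ε := by
              rw [← Real.rpow_mul (by norm_num), one_div, inv_mul_cancel₀ hε.ne', Real.rpow_one]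
          _ ≤ _ := Real.rpow_le_rpow (by positivity) h3 hε.le
      calc ((v + 1 : ℕ) : ℝ) ≤ (2:ℝ) ^ v := by exact_mod_cast Nat.lt_two_pow_self
        _ ≤ _ := pow_le_pow_left₀ (by norm_num) h1 v
  rw [Nat.card_divisors hn, hpow]
  push_cast
  calc ∏ p ∈ n.primeFactors, ((n.factorization p : ℝ) + 1) ≤
      ∏ p ∈ n.primeFactors, ((if p ≤ P then C0 else 1) * ((p:ℝ) ^ ε) ^ (n.factorization p)) := by
        refine Finset.prod_le_prod (fun p _ => by positivity) fun p hp => ?_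
        have := hterm p hp
        push_cast at this
        exact this
    _ = (∏ p ∈ n.primeFactors, (if p ≤ P then C0 else 1)) * ∏ p ∈ n.primeFactors, ((p:ℝ) ^ ε) ^ (n.factorization p) :=
        Finset.prod_mul_distrib
    _ ≤ _ := by
        refine mul_le_mul_of_nonneg_right ?_ (Finset.prod_nonneg fun p _ => by positivity)
        rw [← Finset.prod_filter, Finset.prod_const]
        refine pow_le_pow_right₀ hC1 ?_
        refine (Finset.card_le_card (t := Finset.range (P+1)) ?_).trans (by simp)
        intro p hp
        have := (Finset.mem_filter.mp hp).2
        rw [Finset.mem_range]; omega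

theorem log_bound (ε : ℝ) (hε : 0 < ε) :
    ∃ C : ℝ, 0 < C ∧ ∀ n : ℕ, n ≠ 0 → Real.log n + 2 ≤ C * (n:ℝ) ^ ε := by
  refine ⟨1/ε + 2, by positivity, fun n hn => ?_⟩
  have h1 := Real.log_natCast_le_rpow_div n hε
  have h2 : (1:ℝ) ≤ (n:ℝ) ^ ε := Real.one_le_rpow (by exact_mod_cast Nat.one_le_iff_ne_zero.mpr hn) hε.le
  rw [add_mul, one_div_mul_eq_div]; linarith

theorem decomp (q : ℕ) : ∃ s r b g : ℕ, q ≠ 0 → (Squarefree s ∧ Odd s ∧ r ≠ 0 ∧ Nat.Coprime s r ∧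
    q = s * r ∧ r = b ^ 2 * g ∧ g ∣ 2 * b ∧ b ≠ 0) := by
  by_cases hq : q = 0
  · exact ⟨0, 0, 0, 0, fun h => absurd hq h⟩
  obtain ⟨a, b, hab, ha⟩ := Nat.sq_mul_squarefree q
  have hb : b ≠ 0 := by rintro rfl; simp at hab; exact hq hab.symm
  obtain ⟨s, hs⟩ := Nat.gcd_dvd_left a (2 * b)
  set g := Nat.gcd a (2 * b) with hg
  have hsq : Squarefree (g * s) := hs ▸ ha
  rw [Nat.squarefree_mul_iff] at hsq
  obtain ⟨hcop, hg2, hs2⟩ := hsq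
  have hc2 : Nat.Coprime s (2 * b) := by
    have h1 : Nat.gcd s (2*b) ∣ g := Nat.dvd_gcd ((Nat.gcd_dvd_left _ _).trans ⟨g, by rw [hs]; ring⟩) (Nat.gcd_dvd_right _ _)
    have h2 := Nat.dvd_gcd h1 (Nat.gcd_dvd_left s (2*b))
    rw [Nat.Coprime] at hcop
    rw [hcop] at h2
    exact Nat.dvd_one.mp h2
  rw [Nat.coprime_mul_iff_right] at hc2
  refine ⟨s, b ^ 2 * g, b, g, fun _ => ⟨hs2, (Nat.coprime_two_right).mp hc2.1, ?_, ?_, ?_, rfl, Nat.gcd_dvd_right _ _, hb⟩⟩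
  · exact mul_ne_zero (pow_ne_zero _ hb) hg2.ne_zero
  · exact Nat.Coprime.mul_right (Nat.Coprime.pow_right _ hc2.2) hcop.symm
  · rw [← hab, hs]; ring

theorem sum_bg (b g : ℕ → ℕ) (hb : ∀ q, q ≠ 0 → b q ≠ 0 ∧ g q ∣ 2 * b q ∧ b q ^ 2 * g q ∣ q) (X : ℕ) :
    ∑ q ∈ Finset.Icc 1 X, (b q : ℝ) * Real.sqrt (g q) ≤
      X * ∑ j ∈ Finset.Icc 1 X, ((2 * j).divisors.card : ℝ) / j := by
  classical
  set T : Finset (Σ _ : ℕ, ℕ) := (Finset.Icc 1 X).sigma (fun j => (2 * j).divisors) with hT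
  have hmap : ∀ q ∈ Finset.Icc 1 X, (⟨b q, g q⟩ : Σ _ : ℕ, ℕ) ∈ T := by
    intro q hq
    rw [Finset.mem_Icc] at hq
    obtain ⟨h1, h2, h3⟩ := hb q (by omega)
    rw [hT, Finset.mem_sigma]
    refine ⟨?_, Nat.mem_divisors.mpr ⟨h2, by simpa using h1⟩⟩
    rw [Finset.mem_Icc]
    have h4 : b q ∣ q := (dvd_trans (dvd_trans (Dvd.intro_left _ (by ring)) (Dvd.intro _ rfl)) h3 : b q ∣ q)
    have := Nat.le_of_dvd (by omega) h4
    simp only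
    omega
  rw [← Finset.sum_fiberwise_of_maps_to hmap, hT, Finset.sum_sigma, Finset.mul_sum]
  refine Finset.sum_le_sum fun j hj => ?_
  rw [Finset.mem_Icc] at hj
  have hj0 : (0:ℝ) < j := by exact_mod_cast hj.1
  have : ∀ d ∈ (2*j).divisors, ∑ q ∈ (Finset.Icc 1 X).filter (fun q => (⟨b q, g q⟩ : Σ _ : ℕ, ℕ) = ⟨j, d⟩),
      (b q : ℝ) * Real.sqrt (g q) ≤ X / j := by
    intro d hd
    have hd0 : 0 < d := Nat.pos_of_mem_divisors hd
    have hd1 : (1:ℝ) ≤ d := by exact_mod_cast hd0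
    have hcard : ((Finset.Icc 1 X).filter (fun q => (⟨b q, g q⟩ : Σ _ : ℕ, ℕ) = ⟨j, d⟩)).card ≤ X / (j^2*d) := by
      rw [← Nat.Ioc_filter_dvd_card_eq_div]
      refine Finset.card_le_card ?_
      intro q hq
      rw [Finset.mem_filter, Finset.mem_Icc] at hq
      obtain ⟨h1, h2⟩ := hq
      rw [Sigma.mk.injEq] at h2
      have h3 := (hb q (by omega)).2.2
      rw [h2.1, eq_of_heq h2.2] at h3
      rw [Finset.mem_filter, Finset.mem_Ioc]
      exact ⟨by omega, h3⟩
    calc ∑ q ∈ (Finset.Icc 1 X).filter (fun q => (⟨b q, g q⟩ : Σ _ : ℕ, ℕ) = ⟨j, d⟩), (b q : ℝ) * Real.sqrt (g q)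
        = ∑ q ∈ (Finset.Icc 1 X).filter (fun q => (⟨b q, g q⟩ : Σ _ : ℕ, ℕ) = ⟨j, d⟩), (j : ℝ) * Real.sqrt d := by
          refine Finset.sum_congr rfl fun q hq => ?_
          have h2 := (Finset.mem_filter.mp hq).2
          rw [Sigma.mk.injEq] at h2
          rw [h2.1, eq_of_heq h2.2]
      _ ≤ (X / ((j:ℝ)^2*d)) * (j * Real.sqrt d) := by
          rw [Finset.sum_const, nsmul_eq_mul]
          refine mul_le_mul_of_nonneg_right ?_ (by positivity)
          refine (Nat.cast_le.mpr hcard).trans ?_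
          refine Nat.cast_div_le.trans (by push_cast; rfl)
      _ = X / j * (Real.sqrt d / d) := by field_simp
      _ ≤ X / j * 1 := by
          refine mul_le_mul_of_nonneg_left ?_ (by positivity)
          rw [div_le_one (by positivity)]
          calc Real.sqrt d ≤ Real.sqrt (d^2) := Real.sqrt_le_sqrt (by nlinarith)
            _ = d := Real.sqrt_sq (by positivity)
      _ = _ := mul_one _
  refine (Finset.sum_le_sum this).trans ?_
  rw [Finset.sum_const, nsmul_eq_mul]
  apply le_of_eq; ring

theorem err_exists : ∃ E : ℕ → ℝ, (∀ q, 0 ≤ E q) ∧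
    (∀ (q : ℕ) [NeZero q] (U : ZMod q), IsUnit U → 
      ∀ (x0 : ℤ) (n : ℕ), n ≤ q → ∀ (Y0 Z : ℤ), (∀ i < n, Y0 - 1 ≤ Z - (x0 + i)) →
      ∀ [DecidablePred fun i : ℕ => IsUnit ((x0 + i : ℤ) : ZMod q)],
    |((∑ i ∈ (Finset.range n).filter (fun i : ℕ => IsUnit ((x0 + i : ℤ) : ZMod q)),
        ((Finset.Icc Y0 (Z - (x0 + i))).filter
          (fun y : ℤ => (y : ZMod q) = U * (((x0 + i : ℤ) : ZMod q))⁻¹)).card : ℕ) : ℝ)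
      - ∑ i ∈ (Finset.range n).filter (fun i : ℕ => IsUnit ((x0 + i : ℤ) : ZMod q)),
        ((Z : ℝ) - (x0 + i) - Y0 + 1) / q| ≤ E q) ∧
    ∀ ε : ℝ, 0 < ε → ∃ C : ℝ, 0 < C ∧ ∀ X : ℕ, ∑ q ∈ Finset.Icc 1 X, E q ≤ C * (X:ℝ) ^ (3/2 + ε) := by
  choose s r b g h using decomp
  refine ⟨fun q => (((s q).divisors.card : ℝ) ^ 2 * Real.sqrt (s q) * r q * (Real.log q + 2) ^ 2),
    fun q => by positivity, ?_, ?_⟩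
  · intro q _ U hU x0 n hn Y0 Z hYZ _
    obtain ⟨h1, h2, h3, h4, h5, -⟩ := h q (NeZero.ne q)
    exact trapezoid2 (s q) (r q) h1 h2 h3 h4 q h5 U hU x0 n hn Y0 Z hYZ
  · intro ε hε
    set η := ε / 6 with hη
    have hη0 : 0 < η := by positivity
    obtain ⟨C1, hC1, ht⟩ := tau_bound η hη0
    obtain ⟨C2, hC2, hl⟩ := log_bound η hη0
    refine ⟨C1 ^ 2 * C2 ^ 2 * (C1 * 2 ^ η * C2), by positivity, fun X => ?_⟩
    rcases Nat.eq_zero_or_pos X with rfl | hX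
    · simp; positivity
    have hX1 : (1:ℝ) ≤ X := by exact_mod_cast hX
    have hX0 : (0:ℝ) < X := by linarith
    set Y : ℝ := (X:ℝ) ^ η with hY
    have hYpos : 0 < Y := by positivity
    have hterm : ∀ q ∈ Finset.Icc 1 X, ((s q).divisors.card : ℝ) ^ 2 * Real.sqrt (s q) * r q * (Real.log q + 2) ^ 2 ≤
        (C1 * Y) ^ 2 * (C2 * Y) ^ 2 * Real.sqrt X * ((b q : ℝ) * Real.sqrt (g q)) := by
      intro q hq
      rw [Finset.mem_Icc] at hq
      have hq0 : q ≠ 0 := by omega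
      obtain ⟨h1, h2, h3, h4, h5, h6, h7, h8⟩ := h q hq0
      have hsX : (s q : ℝ) ≤ X := by
        have : s q ≤ q := Nat.le_of_dvd (by omega) ⟨r q, h5⟩
        exact_mod_cast this.trans hq.2
      have a1 : ((s q).divisors.card : ℝ) ≤ C1 * Y :=
        (ht _ h1.ne_zero).trans (mul_le_mul_of_nonneg_left (Real.rpow_le_rpow (by positivity) hsX hη0.le) hC1.le)
      have a2 : Real.log q + 2 ≤ C2 * Y :=
        (hl _ hq0).trans (mul_le_mul_of_nonneg_left (Real.rpow_le_rpow (by positivity) (by exact_mod_cast hq.2) hη0.le) hC2.le)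
      have a3 : Real.sqrt (s q) * r q = Real.sqrt q * ((b q : ℝ) * Real.sqrt (g q)) := by
        have e1 : (r q : ℝ) = Real.sqrt (r q) * Real.sqrt (r q) := (Real.mul_self_sqrt (by positivity)).symm
        have e2 : Real.sqrt (q:ℝ) = Real.sqrt (s q) * Real.sqrt (r q) := by
          rw [← Real.sqrt_mul (by positivity)]; congr 1; exact_mod_cast h5
        have e3 : Real.sqrt (r q) = b q * Real.sqrt (g q) := by
          have : (r q : ℝ) = (b q : ℝ)^2 * g q := by exact_mod_cast h6
          rw [this, Real.sqrt_mul (by positivity), Real.sqrt_sq (by positivity)]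
        rw [e2, ← e3]; conv_lhs => rw [e1]
        ring
      have a4 : Real.sqrt q ≤ Real.sqrt X := Real.sqrt_le_sqrt (by exact_mod_cast hq.2)
      have hl0 : 0 ≤ Real.log q + 2 := by have := Real.log_natCast_nonneg q; linarith
      calc _ = ((s q).divisors.card : ℝ) ^ 2 * (Real.log q + 2) ^ 2 * (Real.sqrt (s q) * r q) := by ring
        _ = ((s q).divisors.card : ℝ) ^ 2 * (Real.log q + 2) ^ 2 * (Real.sqrt q * ((b q : ℝ) * Real.sqrt (g q))) := by rw [a3]
        _ ≤ (C1 * Y) ^ 2 * (C2 * Y) ^ 2 * (Real.sqrt X * ((b q : ℝ) * Real.sqrt (g q))) := by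
          refine mul_le_mul (mul_le_mul (pow_le_pow_left₀ (Nat.cast_nonneg _) a1 2)
            (pow_le_pow_left₀ hl0 a2 2) (by positivity) (by positivity))
            (mul_le_mul_of_nonneg_right a4 (by positivity)) (by positivity) (by positivity)
        _ = _ := by ring
    refine (Finset.sum_le_sum hterm).trans ?_
    rw [← Finset.mul_sum]
    have hbg := sum_bg b g (fun q hq => by
      obtain ⟨h1, h2, h3, h4, h5, h6, h7, h8⟩ := h q hq
      exact ⟨h8, h7, ⟨s q, by rw [← h6]; exact h5.trans (mul_comm _ _)⟩⟩) X
    have hsum : ∑ j ∈ Finset.Icc 1 X, ((2 * j).divisors.card : ℝ) / j ≤ (C1 * 2 ^ η * Y) * (C2 * Y) := by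
      have : ∀ j ∈ Finset.Icc 1 X, ((2 * j).divisors.card : ℝ) / j ≤ (C1 * 2 ^ η * Y) * (1 / j) := by
        intro j hj
        rw [Finset.mem_Icc] at hj
        rw [← div_eq_mul_one_div]
        refine div_le_div_of_nonneg_right ?_ (by positivity)
        refine (ht (2*j) (by omega)).trans ?_
        push_cast
        rw [Real.mul_rpow (by norm_num) (by positivity), mul_assoc]
        gcongr
        exact Real.rpow_le_rpow (by positivity) (by exact_mod_cast hj.2) hη0.le
      refine (Finset.sum_le_sum this).trans ?_
      rw [← Finset.mul_sum]
      refine mul_le_mul_of_nonneg_left ?_ (by positivity)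
      refine le_trans ?_ (hl X (by omega))
      have hh := harmonic_le_one_add_log X
      rw [harmonic_eq_sum_Icc] at hh
      push_cast at hh
      simp only [one_div]
      linarith
    calc (C1 * Y) ^ 2 * (C2 * Y) ^ 2 * Real.sqrt X * ∑ q ∈ Finset.Icc 1 X, (b q : ℝ) * Real.sqrt (g q)
        ≤ (C1 * Y) ^ 2 * (C2 * Y) ^ 2 * Real.sqrt X * (X * ((C1 * 2 ^ η * Y) * (C2 * Y))) := by
          refine mul_le_mul_of_nonneg_left (hbg.trans ?_) (by positivity)
          exact mul_le_mul_of_nonneg_left hsum (by positivity)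
      _ = C1 ^ 2 * C2 ^ 2 * (C1 * 2 ^ η * C2) * (Real.sqrt X * X * Y ^ 6) := by ring
      _ = _ := by
          congr 1
          rw [Real.sqrt_eq_rpow, hY, ← Real.rpow_natCast, ← Real.rpow_mul hX0.le]
          conv_lhs => rw [show (X:ℝ) ^ (1/2:ℝ) * X = (X:ℝ) ^ (1/2:ℝ) * (X:ℝ) ^ (1:ℝ) by rw [Real.rpow_one]]
          rw [← Real.rpow_add hX0, ← Real.rpow_add hX0]
          congr 1
          rw [hη]; push_cast; ring
end
end KL

end ModB4

section ModC1

open Finset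
namespace KL
noncomputable section

def TrapOK (E : ℕ → ℝ) : Prop :=
    (∀ (q : ℕ) [NeZero q] (U : ZMod q), IsUnit U → 
      ∀ (x0 : ℤ) (n : ℕ), n ≤ q → ∀ (Y0 Z : ℤ), (∀ i < n, Y0 - 1 ≤ Z - (x0 + i)) →
      ∀ [DecidablePred fun i : ℕ => IsUnit ((x0 + i : ℤ) : ZMod q)],
    |((∑ i ∈ (Finset.range n).filter (fun i : ℕ => IsUnit ((x0 + i : ℤ) : ZMod q)),
        ((Finset.Icc Y0 (Z - (x0 + i))).filter
          (fun y : ℤ => (y : ZMod q) = U * (((x0 + i : ℤ) : ZMod q))⁻¹)).card : ℕ) : ℝ)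
      - ∑ i ∈ (Finset.range n).filter (fun i : ℕ => IsUnit ((x0 + i : ℤ) : ZMod q)),
        ((Z : ℝ) - (x0 + i) - Y0 + 1) / q| ≤ E q)

theorem sum_Ico_int {M : Type*} [AddCommMonoid M] (x0 : ℤ) (n : ℕ) (F : ℤ → M) :
    ∑ x ∈ Finset.Ico x0 (x0 + n), F x = ∑ i ∈ Finset.range n, F (x0 + i) := by
  symm
  refine Finset.sum_bij (fun i _ => x0 + (i:ℤ)) ?_ ?_ ?_ ?_
  · intro i hi; rw [Finset.mem_range] at hi; rw [Finset.mem_Ico]; omega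
  · intro a _ b _ h; omega
  · intro y hy
    rw [Finset.mem_Ico] at hy
    refine ⟨(y - x0).toNat, ?_, ?_⟩
    · rw [Finset.mem_range]; omega
    · omega
  · intro j _; rfl

theorem trap3 (E : ℕ → ℝ) (hE : TrapOK E) (q : ℕ) [NeZero q] (U : ZMod q) (hU : IsUnit U)
    (x0 : ℤ) (n : ℕ) (hn : n ≤ q) (Y0 Z : ℤ) [DecidablePred fun x : ℤ => IsUnit (x : ZMod q)] :
    |∑ x ∈ Finset.Ico x0 (x0 + n), (if IsUnit (x : ZMod q) then 
        (((Finset.Icc Y0 (Z - x)).filter (fun y : ℤ => (y : ZMod q) = U * ((x : ℤ) : ZMod q)⁻¹)).card : ℝ) else 0)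
      - ∑ x ∈ Finset.Ico x0 (x0 + n), (if IsUnit (x : ZMod q) then max 0 ((Z : ℝ) - x - Y0 + 1) / q else 0)| ≤ E q := by
  set n' : ℕ := min n (Z - Y0 + 2 - x0).toNat with hn'
  have h := hE q U hU x0 n' ((min_le_left _ _).trans hn) Y0 Z (by
    intro i hi
    have : i < (Z - Y0 + 2 - x0).toNat := lt_of_lt_of_le hi (min_le_right _ _)
    omega)
  rw [sum_Ico_int, sum_Ico_int]
  have e1 : ∑ i ∈ Finset.range n, (if IsUnit ((x0 + i : ℤ) : ZMod q) then 
        (((Finset.Icc Y0 (Z - (x0 + i))).filter (fun y : ℤ => (y : ZMod q) = U * ((x0 + i : ℤ) : ZMod q)⁻¹)).card : ℝ) else 0)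
      = ((∑ i ∈ (Finset.range n').filter (fun i : ℕ => IsUnit ((x0 + i : ℤ) : ZMod q)),
        ((Finset.Icc Y0 (Z - (x0 + i))).filter
          (fun y : ℤ => (y : ZMod q) = U * (((x0 + i : ℤ) : ZMod q))⁻¹)).card : ℕ) : ℝ) := by
    push_cast
    rw [Finset.sum_filter]
    symm
    refine Finset.sum_subset (Finset.range_mono (min_le_left _ _)) ?_
    intro i hi hi'
    rw [Finset.mem_range] at hi hi'
    rw [Finset.Icc_eq_empty (by omega)]
    simp
  have e2 : ∑ i ∈ Finset.range n, (if IsUnit ((x0 + i : ℤ) : ZMod q) then max 0 ((Z : ℝ) - ((x0 + i : ℤ) : ℝ) - Y0 + 1) / q else 0)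
      = ∑ i ∈ (Finset.range n').filter (fun i : ℕ => IsUnit ((x0 + i : ℤ) : ZMod q)),
        ((Z : ℝ) - (x0 + i) - Y0 + 1) / q := by
    rw [Finset.sum_filter]
    symm
    rw [← Finset.sum_subset (Finset.range_mono (min_le_left n (Z - Y0 + 2 - x0).toNat))]
    · refine Finset.sum_congr rfl fun i hi => ?_
      rw [Finset.mem_range] at hi
      have h1 : (0:ℤ) ≤ Z - (x0 + i) - Y0 + 1 := by omega
      have h2 : (0:ℝ) ≤ (Z : ℝ) - (x0 + i) - Y0 + 1 := by exact_mod_cast h1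
      push_cast
      rw [max_eq_right h2]
    · intro i hi hi'
      rw [Finset.mem_range] at hi hi'
      have h1 : Z - (x0 + i) - Y0 + 1 ≤ (0:ℤ) := by omega
      have h2 : (Z : ℝ) - ((x0 + i : ℤ) : ℝ) - Y0 + 1 ≤ 0 := by exact_mod_cast h1
      rw [max_eq_left h2]
      simp
  rw [e1, e2]
  exact h

/-- arithmetic condition on (c,a,d) -/
def Pc (c a d : ℤ) : Prop :=
  (Even c ∧ 2 * c ∣ a * d - 1) ∨ (Odd c ∧ Even a ∧ Even d ∧ c ∣ a * d - 1)

open Classical in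
def Dc (α N : ℝ) (c : ℕ) : ℕ :=
  ∑ d ∈ Finset.Ioo (-(c:ℤ)) c, ((Finset.Icc ⌈α * c⌉ (⌊N⌋ - d)).filter (fun a : ℤ => Pc c a d)).card

open Classical in
def Mc (α N : ℝ) (c : ℕ) : ℝ :=
  ∑ d ∈ (Finset.Ioo (-(c:ℤ)) c).filter (fun d : ℤ => IsCoprime (c:ℤ) d ∧ Odd ((c:ℤ) + d)),
    max 0 (N - d - α * c) / (2 * c)

theorem isUnit_int (q : ℕ) (x : ℤ) : IsUnit (x : ZMod q) ↔ IsCoprime (q : ℤ) x := by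
  rw [ZMod.coe_int_isUnit_iff_isCoprime]

theorem max_diff (a b : ℝ) : |max 0 a - max 0 b| ≤ |a - b| := by
  have := abs_max_sub_max_le_abs a b 0
  rwa [max_comm a, max_comm b] at this

theorem Dc_even (E : ℕ → ℝ) (hE : TrapOK E) (α N : ℝ) (c : ℕ) (hc : 0 < c) (hev : Even c) :
    |(Dc α N c : ℝ) - Mc α N c| ≤ E (2 * c) + 2 := by
  classical
  have hcz : Even (c:ℤ) := by exact_mod_cast hev
  haveI : NeZero (2 * c) := ⟨by omega⟩
  have h := trap3 E hE (2 * c) 1 isUnit_one (-(c:ℤ) + 1) (2 * c - 1) (by omega) ⌈α * c⌉ ⌊N⌋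
  have hI : Finset.Ico (-(c:ℤ) + 1) (-(c:ℤ) + 1 + (2 * c - 1 : ℕ)) = Finset.Ioo (-(c:ℤ)) c := by
    ext x; rw [Finset.mem_Ico, Finset.mem_Ioo]; omega
  rw [hI] at h
  have hunit : ∀ d : ℤ, IsUnit (d : ZMod (2*c)) ↔ (IsCoprime (c:ℤ) d ∧ Odd ((c:ℤ) + d)) := by
    intro d
    rw [isUnit_int]
    push_cast
    rw [IsCoprime.mul_left_iff]
    have h2 : IsCoprime (2:ℤ) d ↔ Odd d := by
      rw [Int.isCoprime_iff_gcd_eq_one, ← Int.natAbs_odd, ← Nat.coprime_two_left, Nat.Coprime, Int.gcd]; rfl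
    rw [h2, and_comm, Int.odd_add]
    have : ¬ Odd (c:ℤ) := by rwa [Int.not_odd_iff_even]
    constructor
    · rintro ⟨h1, h3⟩; exact ⟨h1, by simp [this, h3]⟩
    · rintro ⟨h1, h3⟩
      refine ⟨h1, ?_⟩
      rw [← Int.not_even_iff_odd]; tauto
  have e1 : (Dc α N c : ℝ) = ∑ x ∈ Finset.Ioo (-(c:ℤ)) c, (if IsUnit (x : ZMod (2*c)) then 
        (((Finset.Icc ⌈α * c⌉ (⌊N⌋ - x)).filter (fun y : ℤ => (y : ZMod (2*c)) = 1 * ((x : ℤ) : ZMod (2*c))⁻¹)).card : ℝ) else 0) := by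
    unfold Dc
    push_cast
    refine Finset.sum_congr rfl fun d _ => ?_
    have hP : ∀ a : ℤ, Pc c a d ↔ (a : ZMod (2*c)) * d = 1 := by
      intro a
      unfold Pc
      have : ¬ Odd (c:ℤ) := by rwa [Int.not_odd_iff_even]
      have e : ((2 * c : ℕ) : ℤ) ∣ a * d - 1 ↔ (a : ZMod (2*c)) * d = 1 := by
        rw [← ZMod.intCast_zmod_eq_zero_iff_dvd]
        push_cast
        rw [sub_eq_zero]
      rw [← e]; push_cast; tauto
    split_ifs with hu
    · congr 2
      ext a
      rw [Finset.mem_filter, Finset.mem_filter, hP, one_mul]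
      refine and_congr_right fun _ => ?_
      constructor
      · intro h
        rw [← mul_one (a : ZMod (2*c)), ← ZMod.mul_inv_of_unit _ hu, ← mul_assoc, h, one_mul]
      · intro h
        rw [h]; exact (mul_comm _ _).trans (ZMod.mul_inv_of_unit _ hu)
    · rw [Nat.cast_eq_zero, Finset.card_eq_zero, Finset.filter_eq_empty_iff]
      intro a _ h
      rw [hP] at h
      exact hu (IsUnit.of_mul_eq_one (a : ZMod (2*c)) ((mul_comm _ _).trans h))
  have e2 : |∑ x ∈ Finset.Ioo (-(c:ℤ)) c, (if IsUnit (x : ZMod (2*c)) then max 0 ((⌊N⌋ : ℝ) - x - ⌈α * c⌉ + 1) / (2*c : ℕ) else 0)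
      - Mc α N c| ≤ 2 := by
    unfold Mc
    rw [Finset.sum_filter, ← Finset.sum_sub_distrib]
    have hc0 : (0:ℝ) < c := by exact_mod_cast hc
    have hb : ∀ d ∈ Finset.Ioo (-(c:ℤ)) c, |(if IsUnit (d : ZMod (2*c)) then max 0 ((⌊N⌋ : ℝ) - d - ⌈α * c⌉ + 1) / (2*c : ℕ) else 0)
        - (if IsCoprime (c:ℤ) d ∧ Odd ((c:ℤ) + d) then max 0 (N - d - α * c) / (2 * c) else 0)| ≤ 1 / c := by
      intro d _
      simp only [hunit]
      split_ifs
      · push_cast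
        rw [← sub_div, abs_div, abs_of_pos (by positivity : (0:ℝ) < 2 * c), div_le_div_iff₀ (by positivity) hc0]
        have := max_diff ((⌊N⌋ : ℝ) - d - ⌈α * c⌉ + 1) (N - d - α * c)
        have h3 : |((⌊N⌋ : ℝ) - d - ⌈α * c⌉ + 1) - (N - d - α * c)| ≤ 1 := by
          rw [abs_le]
          have h1 := Int.floor_le N
          have h2 := Int.lt_floor_add_one N
          have h3 := Int.le_ceil (α * c)
          have h4 := Int.ceil_lt_add_one (α * c)
          constructor <;> linarith
        nlinarith
      · simp
    refine (Finset.abs_sum_le_sum_abs _ _).trans ((Finset.sum_le_sum hb).trans ?_)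
    rw [Finset.sum_const, Int.card_Ioo, nsmul_eq_mul, mul_one_div, div_le_iff₀ hc0]
    have : ((c:ℤ) - -(c:ℤ) - 1).toNat ≤ 2 * c := by omega
    exact_mod_cast this
  rw [e1]
  rw [abs_le] at *
  constructor <;> linarith [h.1, h.2, e2.1, e2.2]

theorem Dc_odd (E : ℕ → ℝ) (hE : TrapOK E) (α N : ℝ) (c : ℕ) (hc : 0 < c) (hod : Odd c) :
    |(Dc α N c : ℝ) - Mc α N c| ≤ E c + 2 := by
  classical
  have hcz : Odd (c:ℤ) := by exact_mod_cast hod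
  have hnev : ¬ Even (c:ℤ) := by rwa [Int.not_even_iff_odd]
  haveI : NeZero c := ⟨by omega⟩
  obtain ⟨m, hm⟩ := hod
  have h2u : IsUnit ((2:ℤ) : ZMod c) := by
    rw [isUnit_int]
    exact ⟨1, -(m:ℤ), by rw [hm]; push_cast; ring⟩
  push_cast at h2u
  have h4u : IsUnit ((4:ZMod c)) := by
    have := h2u.mul h2u
    norm_num at this; exact this
  have h4i : (4:ZMod c) * (4:ZMod c)⁻¹ = 1 := ZMod.mul_inv_of_unit _ h4u
  have h4iu : IsUnit ((4:ZMod c)⁻¹) := IsUnit.of_mul_eq_one _ (by rw [mul_comm]; exact h4i)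
  have h := trap3 E hE c (4:ZMod c)⁻¹ h4iu (-(m:ℤ)) c le_rfl ⌈α * c / 2⌉ ⌊N / 2⌋
  have hI : (Finset.Ioo (-(c:ℤ)) c).filter (fun d : ℤ => Even d) = (Finset.Ico (-(m:ℤ)) (-(m:ℤ) + c)).image (fun x => 2 * x) := by
    ext x
    rw [Finset.mem_filter, Finset.mem_Ioo, Finset.mem_image]
    constructor
    · rintro ⟨h1, k, hk⟩
      exact ⟨k, by rw [Finset.mem_Ico]; omega, by omega⟩
    · rintro ⟨k, hk, rfl⟩
      rw [Finset.mem_Ico] at hk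
      exact ⟨by omega, by simp⟩
  have hinj : Set.InjOn (fun x : ℤ => 2 * x) (Finset.Ico (-(m:ℤ)) (-(m:ℤ) + c) : Finset ℤ) := by
    intro a _ b _ h; simpa using h
  have hunit : ∀ x : ℤ, (IsCoprime (c:ℤ) (2 * x) ∧ Odd ((c:ℤ) + 2 * x)) ↔ IsUnit (x : ZMod c) := by
    intro x
    rw [isUnit_int, IsCoprime.mul_right_iff]
    have h2 : IsCoprime (c:ℤ) 2 := ⟨1, -(m:ℤ), by rw [hm]; push_cast; ring⟩
    have h3 : Odd ((c:ℤ) + 2 * x) := by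
      rw [Int.odd_add]; simp [hcz]
    tauto
  have e1 : (Dc α N c : ℝ) = ∑ x ∈ Finset.Ico (-(m:ℤ)) (-(m:ℤ) + c), (if IsUnit (x : ZMod c) then 
        (((Finset.Icc ⌈α * c / 2⌉ (⌊N / 2⌋ - x)).filter (fun y : ℤ => (y : ZMod c) = (4:ZMod c)⁻¹ * ((x : ℤ) : ZMod c)⁻¹)).card : ℝ) else 0) := by
    unfold Dc
    push_cast
    rw [← Finset.sum_subset (Finset.filter_subset (fun d : ℤ => Even d) _), hI, Finset.sum_image hinj]
    · refine Finset.sum_congr rfl fun x _ => ?_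
      have hP : ∀ a : ℤ, Pc c a (2 * x) ↔ (Even a ∧ (a : ZMod c) * (2 * x) = 1) := by
        intro a
        unfold Pc
        have e : ((c : ℕ) : ℤ) ∣ a * (2 * x) - 1 ↔ (a : ZMod c) * (2 * x) = 1 := by
          rw [← ZMod.intCast_zmod_eq_zero_iff_dvd]
          push_cast
          rw [sub_eq_zero]
        have h5 : Even (2 * x) := by simp
        rw [← e]; tauto
      split_ifs with hu
      · have : (Finset.Icc ⌈α * c⌉ (⌊N⌋ - 2 * x)).filter (fun a : ℤ => Pc c a (2 * x)) =
          ((Finset.Icc ⌈α * c / 2⌉ (⌊N / 2⌋ - x)).filter (fun y : ℤ => (y : ZMod c) = (4:ZMod c)⁻¹ * ((x : ℤ) : ZMod c)⁻¹)).image (fun y => 2 * y) := by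
          ext a
          rw [Finset.mem_filter, Finset.mem_image, Finset.mem_Icc, hP]
          have key : ∀ y : ℤ, (⌈α * c⌉ ≤ 2 * y ∧ 2 * y ≤ ⌊N⌋ - 2 * x) ↔ (⌈α * c / 2⌉ ≤ y ∧ y ≤ ⌊N / 2⌋ - x) := by
            intro y
            rw [Int.ceil_le, Int.ceil_le, le_sub_iff_add_le, Int.le_floor, le_sub_iff_add_le, Int.le_floor]
            push_cast
            constructor <;> rintro ⟨h1, h2⟩ <;> constructor <;> linarith
          have key2 : ∀ y : ℤ, ((2 * y : ℤ) : ZMod c) * (2 * x) = 1 ↔ (y : ZMod c) = (4:ZMod c)⁻¹ * ((x : ℤ) : ZMod c)⁻¹ := by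
            intro y
            have hx := ZMod.mul_inv_of_unit _ hu
            push_cast
            constructor
            · intro h
              calc (y : ZMod c) = y * (4 * (4:ZMod c)⁻¹) * (x * (x : ZMod c)⁻¹) := by rw [h4i, hx]; ring
                _ = (2 * y * (2 * x)) * ((4:ZMod c)⁻¹ * (x : ZMod c)⁻¹) := by ring
                _ = _ := by rw [h, one_mul]
            · intro h
              rw [h]
              calc 2 * ((4:ZMod c)⁻¹ * (x : ZMod c)⁻¹) * (2 * x) = (4 * (4:ZMod c)⁻¹) * (x * (x : ZMod c)⁻¹) := by ring
                _ = 1 := by rw [h4i, hx, one_mul]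
          constructor
          · rintro ⟨h1, ⟨k, hk⟩, h2⟩
            obtain rfl : a = 2 * k := by omega
            exact ⟨k, by rw [Finset.mem_filter, Finset.mem_Icc]; exact ⟨(key k).mp h1, (key2 k).mp h2⟩, rfl⟩
          · rintro ⟨k, hk, rfl⟩
            rw [Finset.mem_filter, Finset.mem_Icc] at hk
            exact ⟨(key k).mpr hk.1, by simp, (key2 k).mpr hk.2⟩
        rw [this, Finset.card_image_of_injective _ (fun a b h => by simpa using h)]
      · rw [Nat.cast_eq_zero, Finset.card_eq_zero, Finset.filter_eq_empty_iff]
        intro a _ h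
        rw [hP] at h
        exact hu (IsUnit.of_mul_eq_one ((a : ZMod c) * 2) (by rw [← h.2]; ring))
    · intro d hd hd'
      rw [Nat.cast_eq_zero, Finset.card_eq_zero, Finset.filter_eq_empty_iff]
      intro a _ h
      unfold Pc at h
      rw [Finset.mem_filter] at hd'
      tauto
  have e2 : |∑ x ∈ Finset.Ico (-(m:ℤ)) (-(m:ℤ) + c), (if IsUnit (x : ZMod c) then max 0 ((⌊N / 2⌋ : ℝ) - x - ⌈α * c / 2⌉ + 1) / (c : ℕ) else 0)
      - Mc α N c| ≤ 2 := by
    unfold Mc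
    rw [Finset.sum_filter]
    rw [← Finset.sum_subset (Finset.filter_subset (fun d : ℤ => Even d) (Finset.Ioo (-(c:ℤ)) c)), hI, Finset.sum_image hinj]
    rotate_left
    · intro d hd hd'
      rw [Finset.mem_filter] at hd'
      rw [if_neg]
      rintro ⟨-, h2⟩
      rw [Int.odd_add] at h2
      tauto
    rw [← Finset.sum_sub_distrib]
    have hc0 : (0:ℝ) < c := by exact_mod_cast hc
    have hb : ∀ x ∈ Finset.Ico (-(m:ℤ)) (-(m:ℤ) + c), |(if IsUnit (x : ZMod c) then max 0 ((⌊N / 2⌋ : ℝ) - x - ⌈α * c / 2⌉ + 1) / (c : ℕ) else 0)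
        - (if IsCoprime (c:ℤ) (2 * x) ∧ Odd ((c:ℤ) + 2 * x) then max 0 (N - (2 * x : ℤ) - α * c) / (2 * c) else 0)| ≤ 1 / c := by
      intro x _
      simp only [hunit]
      split_ifs
      · push_cast
        have e : max 0 (N - 2 * x - α * c) / (2 * c) = max 0 (N / 2 - x - α * c / 2) / c := by
          rw [show N - 2 * x - α * c = 2 * (N / 2 - x - α * c / 2) by ring]
          have : max 0 (2 * (N / 2 - x - α * c / 2)) = 2 * max 0 (N / 2 - x - α * c / 2) := by
            rw [mul_max_of_nonneg _ _ (by norm_num : (0:ℝ) ≤ 2), mul_zero]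
          rw [this]; field_simp
        rw [e, ← sub_div, abs_div, abs_of_pos hc0]
        refine div_le_div_of_nonneg_right ?_ hc0.le
        refine (max_diff _ _).trans ?_
        rw [abs_le]
        have h1 := Int.floor_le (N/2)
        have h2 := Int.lt_floor_add_one (N/2)
        have h3 := Int.le_ceil (α * c/2)
        have h4 := Int.ceil_lt_add_one (α * c/2)
        constructor <;> linarith
      · simp
    refine (Finset.abs_sum_le_sum_abs _ _).trans ((Finset.sum_le_sum hb).trans ?_)
    rw [Finset.sum_const, Int.card_Ico, nsmul_eq_mul, mul_one_div, div_le_iff₀ hc0]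
    have : (-(m:ℤ) + c - -(m:ℤ)).toNat ≤ 2 * c := by omega
    exact_mod_cast this
  rw [e1]
  rw [abs_le] at *
  constructor <;> linarith [h.1, h.2, e2.1, e2.2]

theorem Dc_bound (E : ℕ → ℝ) (hE0 : ∀ q, 0 ≤ E q) (hE : TrapOK E) (α N : ℝ) (c : ℕ) (hc : 0 < c) :
    |(Dc α N c : ℝ) - Mc α N c| ≤ E (2 * c) + E c + 2 := by
  rcases Nat.even_or_odd c with h | h
  · linarith [Dc_even E hE α N c hc h, hE0 c]
  · linarith [Dc_odd E hE α N c hc h, hE0 (2*c)]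

/-- C result -/
theorem sum_Dc (ε : ℝ) (hε : 0 < ε) : ∃ C : ℝ, 0 < C ∧ ∀ (α N : ℝ) (X : ℕ),
    |(∑ c ∈ Finset.Icc 1 X, (Dc α N c : ℝ)) - ∑ c ∈ Finset.Icc 1 X, Mc α N c| ≤ C * (X:ℝ) ^ (3/2 + ε) := by
  obtain ⟨E, hE0, hE, hS⟩ := err_exists
  obtain ⟨C, hC, hX⟩ := hS ε hε
  refine ⟨C * 2 ^ (3/2 + ε) + C + 2, by positivity, fun α N X => ?_⟩
  rw [← Finset.sum_sub_distrib]
  refine (Finset.abs_sum_le_sum_abs _ _).trans ?_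
  have h1 : ∑ c ∈ Finset.Icc 1 X, |(Dc α N c : ℝ) - Mc α N c| ≤ ∑ c ∈ Finset.Icc 1 X, (E (2 * c) + E c + 2) :=
    Finset.sum_le_sum fun c hc => Dc_bound E hE0 (fun q _ => hE q) α N c (by rw [Finset.mem_Icc] at hc; omega)
  refine h1.trans ?_
  rw [Finset.sum_add_distrib, Finset.sum_add_distrib]
  have h2 : ∑ c ∈ Finset.Icc 1 X, E (2 * c) ≤ ∑ q ∈ Finset.Icc 1 (2 * X), E q := by
    rw [← Finset.sum_image (f := E) (g := fun c => 2 * c) (fun a _ b _ h => by simpa using h)]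
    refine Finset.sum_le_sum_of_subset_of_nonneg ?_ fun i _ _ => hE0 i
    intro i hi
    obtain ⟨j, hj, rfl⟩ := Finset.mem_image.mp hi
    rw [Finset.mem_Icc] at *; omega
  have h3 := hX (2 * X)
  have h4 := hX X
  push_cast at h3
  rw [Real.mul_rpow (by norm_num) (by positivity)] at h3
  have h5 : ∑ c ∈ Finset.Icc 1 X, (2:ℝ) ≤ 2 * (X:ℝ) ^ (3/2+ε) := by
    rw [Finset.sum_const, nsmul_eq_mul, Nat.card_Icc]
    rcases Nat.eq_zero_or_pos X with rfl | hX
    · simp; positivity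
    · have : (X:ℝ) ^ (1:ℝ) ≤ (X:ℝ) ^ (3/2+ε) := Real.rpow_le_rpow_of_exponent_le (by exact_mod_cast hX) (by linarith)
      rw [Real.rpow_one] at this
      simp only [Nat.add_sub_cancel]
      linarith
  nlinarith
end
end KL

end ModC1

section ModD1

open Finset
namespace KL
noncomputable section

theorem harm_asymp (n : ℕ) (hn : 0 < n) :
    |((harmonic n : ℚ) : ℝ) - Real.log n - Real.eulerMascheroniConstant| ≤ 1 / n := by
  have hn0 : (0:ℝ) < n := by exact_mod_cast hn
  have h1 := Real.eulerMascheroniConstant_lt_eulerMascheroniSeq' n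
  have h2 := Real.eulerMascheroniSeq_lt_eulerMascheroniConstant n
  rw [Real.eulerMascheroniSeq', if_neg hn.ne'] at h1
  rw [Real.eulerMascheroniSeq] at h2
  have h3 : Real.log ((n:ℝ) + 1) ≤ Real.log n + 1 / n := by
    have : Real.log (((n:ℝ) + 1) / n) ≤ ((n:ℝ) + 1) / n - 1 := Real.log_le_sub_one_of_pos (by positivity)
    rw [Real.log_div (by positivity) (by positivity)] at this
    have e : ((n:ℝ) + 1) / n - 1 = 1 / n := by field_simp; ring
    linarith
  rw [abs_le]; constructor <;> linarith [show (0:ℝ) < 1 / n by positivity]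

theorem D1_floor (x : ℝ) (hx : 0 < x) (n : ℕ) (hn : n = ⌊x⌋₊) :
    |x ^ 2 * ((harmonic n : ℚ) : ℝ) - 2 * x * n + n * (n + 1) / 2 -
      x ^ 2 * (Real.log x + Real.eulerMascheroniConstant - 3 / 2)| ≤ 8 * x := by
  have hle : (n:ℝ) ≤ x := by rw [hn]; exact Nat.floor_le hx.le
  have hlt : x < n + 1 := by rw [hn]; exact Nat.lt_floor_add_one x
  have hg0 := Real.one_half_lt_eulerMascheroniConstant
  have hg1 := Real.eulerMascheroniConstant_lt_two_thirds
  set γ := Real.eulerMascheroniConstant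
  rcases Nat.eq_zero_or_pos n with h0 | hpos
  · subst h0
    simp at hlt ⊢
    have hl : |Real.log x * x| < 1 := Real.abs_log_mul_self_lt x hx hlt.le
    rw [abs_lt] at hl
    have h8 : |x * (Real.log x + γ - 3 / 2)| ≤ 8 := by
      rw [abs_le]
      constructor <;> nlinarith
    rw [abs_mul, abs_of_pos hx] at h8
    nlinarith
  · have hn0 : (1:ℝ) ≤ n := by exact_mod_cast hpos
    have hH := harm_asymp n hpos
    have hlog1 : Real.log n ≤ Real.log x := Real.log_le_log (by linarith) hle
    have hlog2 : Real.log x ≤ Real.log n + 1 / n := by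
      have : Real.log (x / n) ≤ x / n - 1 := Real.log_le_sub_one_of_pos (by positivity)
      rw [Real.log_div (by positivity) (by positivity)] at this
      have e : x / n - 1 ≤ 1 / n := by rw [sub_le_iff_le_add, div_le_iff₀ (by linarith)]; field_simp; linarith
      linarith
    have hinv : 1 / (n:ℝ) ≤ 2 / x := by rw [div_le_div_iff₀ (by linarith) hx]; linarith
    set H : ℝ := ((harmonic n : ℚ) : ℝ)
    rw [abs_le] at hH
    have hd1 : H - Real.log x - γ ≤ 2 / x := by linarith
    have hd2 : -(4 / x) ≤ H - Real.log x - γ := by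
      have : 4 / x = 2 / x + 2 / x := by ring
      linarith
    have e1 : x ^ 2 * (2 / x) = 2 * x := by field_simp
    have e2 : x ^ 2 * (4 / x) = 4 * x := by field_simp
    have k1 : x ^ 2 * (H - Real.log x - γ) ≤ 2 * x := by rw [← e1]; exact mul_le_mul_of_nonneg_left hd1 (by positivity)
    have k2 : -(4 * x) ≤ x ^ 2 * (H - Real.log x - γ) := by
      rw [← e2, ← mul_neg]; exact mul_le_mul_of_nonneg_left hd2 (by positivity)
    rw [abs_le]
    constructor <;> nlinarith

theorem D1 (β Y : ℝ) (hβ : 0 < β) (hY : 0 < Y) (X : ℕ) (hX : Y / β ≤ X + 1) :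
    |∑ c ∈ Finset.Icc 1 X, max 0 (Y - β * c) ^ 2 / c -
      Y ^ 2 * (Real.log Y - Real.log β + Real.eulerMascheroniConstant - 3 / 2)| ≤ 8 * β * Y := by
  set x := Y / β with hx
  have hx0 : 0 < x := by positivity
  have hYx : Y = β * x := by rw [hx]; field_simp
  set n := ⌊x⌋₊ with hn
  have hle : (n:ℝ) ≤ x := Nat.floor_le hx0.le
  have hlt : x < n + 1 := Nat.lt_floor_add_one x
  have hzero : ∀ c : ℕ, x ≤ c → max 0 (Y - β * c) ^ 2 / c = 0 := by
    intro c hc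
    rw [max_eq_left]
    · simp
    · rw [hYx]; nlinarith
  have e1 : ∑ c ∈ Finset.Icc 1 X, max 0 (Y - β * c) ^ 2 / (c:ℝ) = ∑ c ∈ Finset.Icc 1 (max X n), max 0 (Y - β * c) ^ 2 / (c:ℝ) := by
    refine Finset.sum_subset (Finset.Icc_subset_Icc le_rfl (le_max_left _ _)) ?_
    intro c hc hc'
    rw [Finset.mem_Icc] at hc hc'
    apply hzero
    have : X + 1 ≤ c := by omega
    exact hX.trans (by exact_mod_cast this)
  have e2 : ∑ c ∈ Finset.Icc 1 n, max 0 (Y - β * c) ^ 2 / (c:ℝ) = ∑ c ∈ Finset.Icc 1 (max X n), max 0 (Y - β * c) ^ 2 / (c:ℝ) := by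
    refine Finset.sum_subset (Finset.Icc_subset_Icc le_rfl (le_max_right _ _)) ?_
    intro c hc hc'
    rw [Finset.mem_Icc] at hc hc'
    apply hzero
    have : n + 1 ≤ c := by omega
    exact hlt.le.trans (by exact_mod_cast this)
  rw [e1, ← e2]
  have e3 : ∑ c ∈ Finset.Icc 1 n, max 0 (Y - β * c) ^ 2 / (c:ℝ) =
      β ^ 2 * (x ^ 2 * ((harmonic n : ℚ) : ℝ) - 2 * x * n + n * (n + 1) / 2) := by
    have h1 : ∀ c ∈ Finset.Icc 1 n, max 0 (Y - β * c) ^ 2 / (c:ℝ) = β ^ 2 * x ^ 2 * (c:ℝ)⁻¹ - 2 * β ^ 2 * x + β ^ 2 * c := by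
      intro c hc
      rw [Finset.mem_Icc] at hc
      have hc0 : (0:ℝ) < c := by exact_mod_cast hc.1
      have hcx : (c:ℝ) ≤ x := le_trans (by exact_mod_cast hc.2) hle
      rw [max_eq_right (by rw [hYx]; nlinarith), hYx]
      field_simp
      ring
    rw [Finset.sum_congr rfl h1, Finset.sum_add_distrib, Finset.sum_sub_distrib, ← Finset.mul_sum, ← Finset.mul_sum, ← Finset.mul_sum,
      harmonic_eq_sum_Icc]
    have hg : ∀ m : ℕ, ∑ c ∈ Finset.Icc 1 m, (c:ℝ) = m * (m + 1) / 2 := by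
      intro m
      induction m with
      | zero => simp
      | succ m ih => rw [Finset.sum_Icc_succ_top (by omega), ih]; push_cast; ring
    rw [hg]
    simp only [Finset.sum_const, Nat.card_Icc, nsmul_eq_mul]
    push_cast
    ring
  rw [e3]
  have h := D1_floor x hx0 n hn
  have hlx : Real.log x = Real.log Y - Real.log β := by rw [hx, Real.log_div hY.ne' hβ.ne']
  rw [← hlx, hYx]
  calc _ = |β ^ 2 * (x ^ 2 * ((harmonic n : ℚ) : ℝ) - 2 * x * n + n * (n + 1) / 2 -
      x ^ 2 * (Real.log x + Real.eulerMascheroniConstant - 3 / 2))| := by congr 1; ring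
    _ = β ^ 2 * |x ^ 2 * ((harmonic n : ℚ) : ℝ) - 2 * x * n + n * (n + 1) / 2 -
      x ^ 2 * (Real.log x + Real.eulerMascheroniConstant - 3 / 2)| := by rw [abs_mul, abs_of_pos (by positivity)]
    _ ≤ β ^ 2 * (8 * x) := mul_le_mul_of_nonneg_left h (by positivity)
    _ = _ := by ring

open Classical in
def Lf (α Y : ℝ) (X : ℕ) : ℝ :=
  ∑ c ∈ Finset.Icc 1 X, ∑ d ∈ (Finset.Ioo (-(c:ℤ)) c).filter (fun d : ℤ => Odd ((c:ℤ) + d)),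
    max 0 (Y - d - α * c) / (2 * c)

theorem psi_ineq (u : ℝ) : |max 0 (u + 1) ^ 2 / 2 - max 0 (u - 1) ^ 2 / 2 - 2 * max 0 u| ≤ 1 := by
  rw [abs_le]
  rcases le_total 0 u with h | h <;> rcases le_total 0 (u+1) with h1 | h1 <;>
    rcases le_total 0 (u-1) with h2 | h2 <;> simp only [h, h1, h2, max_eq_right, max_eq_left] <;>
    constructor <;> nlinarith

theorem inner_tele (Y α : ℝ) (c : ℕ) (hc : 0 < c) [DecidablePred fun d : ℤ => Odd ((c:ℤ) + d)] :
    |∑ d ∈ (Finset.Ioo (-(c:ℤ)) c).filter (fun d : ℤ => Odd ((c:ℤ) + d)), max 0 (Y - d - α * c) / (2 * c)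
      - (max 0 (Y - (α - 1) * c) ^ 2 / c - max 0 (Y - (α + 1) * c) ^ 2 / c) / 8| ≤ 1 / 4 := by
  have hc0 : (0:ℝ) < c := by exact_mod_cast hc
  have himg : (Finset.Ioo (-(c:ℤ)) c).filter (fun d : ℤ => Odd ((c:ℤ) + d)) =
      (Finset.range c).image (fun i : ℕ => -(c:ℤ) + 1 + 2 * i) := by
    ext d
    rw [Finset.mem_filter, Finset.mem_Ioo, Finset.mem_image]
    constructor
    · rintro ⟨h1, k, hk⟩
      exact ⟨k.toNat, by rw [Finset.mem_range]; omega, by omega⟩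
    · rintro ⟨i, hi, rfl⟩
      rw [Finset.mem_range] at hi
      exact ⟨by omega, ⟨i, by ring⟩⟩
  rw [himg, Finset.sum_image (fun a _ b _ h => by simpa using h)]
  set g : ℕ → ℝ := fun i => max 0 (Y + c - 2 * i - α * c) ^ 2 / 2 with hg
  have htel : ∑ i ∈ Finset.range c, (g i - g (i+1)) = g 0 - g c := Finset.sum_range_sub' g c
  have hend : (max 0 (Y - (α - 1) * c) ^ 2 / c - max 0 (Y - (α + 1) * c) ^ 2 / c) / 8 = (g 0 - g c) / (4 * c) := by
    simp only [hg]
    rw [show Y + c - 2 * ((0:ℕ):ℝ) - α * c = Y - (α - 1) * c by push_cast; ring,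
      show Y + c - 2 * (c:ℝ) - α * c = Y - (α + 1) * c by ring]
    field_simp
    ring
  rw [hend, ← htel, Finset.sum_div, ← Finset.sum_sub_distrib]
  have hb : ∀ i ∈ Finset.range c, |max 0 (Y - ((-(c:ℤ) + 1 + 2 * i : ℤ) : ℝ) - α * c) / (2 * c) - (g i - g (i+1)) / (4 * c)| ≤ 1 / (4 * c) := by
    intro i _
    set u : ℝ := Y - ((-(c:ℤ) + 1 + 2 * i : ℤ) : ℝ) - α * c with hu
    have h := psi_ineq u
    have e1 : g i = max 0 (u + 1) ^ 2 / 2 := by simp only [hg, hu]; push_cast; congr 3; ring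
    have e2 : g (i+1) = max 0 (u - 1) ^ 2 / 2 := by simp only [hg, hu]; push_cast; congr 3; ring
    rw [e1, e2]
    have e3 : max 0 u / (2 * c) - (max 0 (u + 1) ^ 2 / 2 - max 0 (u - 1) ^ 2 / 2) / (4 * c) =
      -(max 0 (u + 1) ^ 2 / 2 - max 0 (u - 1) ^ 2 / 2 - 2 * max 0 u) / (4 * c) := by field_simp; ring
    rw [e3, abs_div, abs_neg, abs_of_pos (by positivity : (0:ℝ) < 4 * c)]
    exact div_le_div_of_nonneg_right h (by positivity)
  refine (Finset.abs_sum_le_sum_abs _ _).trans ((Finset.sum_le_sum hb).trans ?_)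
  rw [Finset.sum_const, Finset.card_range, nsmul_eq_mul]
  apply le_of_eq; field_simp

theorem D2 (α : ℝ) (hα : 1 < α) : ∃ C : ℝ, 0 < C ∧ ∀ (Y : ℝ) (X : ℕ), 0 < Y → Y / (α - 1) ≤ X + 1 →
    |Lf α Y X - Y ^ 2 / 8 * Real.log ((α + 1) / (α - 1))| ≤ C * Y := by
  have ha : 0 < α - 1 := by linarith
  refine ⟨1 / (4 * (α - 1)) + 2 * α, by positivity, fun Y X hY hX => ?_⟩
  have h1 := D1 (α - 1) Y ha hY X hX
  have h2 := D1 (α + 1) Y (by linarith) hY X (le_trans (by gcongr; linarith) hX)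
  set S1 := ∑ c ∈ Finset.Icc 1 X, max 0 (Y - (α - 1) * c) ^ 2 / (c:ℝ) with hS1
  set S2 := ∑ c ∈ Finset.Icc 1 X, max 0 (Y - (α + 1) * c) ^ 2 / (c:ℝ) with hS2
  have h3 : |Lf α Y X - (S1 - S2) / 8| ≤ Y / (α - 1) * (1 / 4) := by
    unfold Lf
    rw [hS1, hS2, ← Finset.sum_sub_distrib, Finset.sum_div, ← Finset.sum_sub_distrib]
    refine (Finset.abs_sum_le_sum_abs _ _).trans ?_
    set n := ⌊Y / (α - 1)⌋₊ with hn
    have hb : ∀ c ∈ Finset.Icc 1 X, |∑ d ∈ (Finset.Ioo (-(c:ℤ)) c).filter (fun d : ℤ => Odd ((c:ℤ) + d)), max 0 (Y - d - α * c) / (2 * c)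
      - (max 0 (Y - (α - 1) * c) ^ 2 / c - max 0 (Y - (α + 1) * c) ^ 2 / c) / 8| ≤ if c ≤ n then 1 / 4 else 0 := by
      intro c hc
      rw [Finset.mem_Icc] at hc
      split_ifs with h
      · exact inner_tele Y α c hc.1
      · apply le_of_eq
        have hc1 : Y / (α - 1) < c := by
          have := Nat.lt_floor_add_one (Y / (α - 1))
          refine this.trans_le ?_
          exact_mod_cast (by omega : n + 1 ≤ c)
        rw [div_lt_iff₀ ha] at hc1
        have hc0 : (0:ℝ) ≤ c := by positivity
        rw [max_eq_left (by linarith : Y - (α - 1) * c ≤ 0), max_eq_left (by linarith : Y - (α + 1) * c ≤ 0),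
          Finset.sum_eq_zero]
        · simp
        · intro d hd
          rw [Finset.mem_filter, Finset.mem_Ioo] at hd
          have : (-(c:ℝ)) < d := by exact_mod_cast hd.1.1
          rw [max_eq_left (by linarith)]; simp
    refine (Finset.sum_le_sum hb).trans ?_
    rw [← Finset.sum_filter, Finset.sum_const, nsmul_eq_mul]
    refine mul_le_mul_of_nonneg_right ?_ (by norm_num)
    have hcard : ((Finset.Icc 1 X).filter (fun c => c ≤ n)).card ≤ n := by
      refine (Finset.card_le_card (t := Finset.Icc 1 n) ?_).trans (by simp)
      intro c hc
      rw [Finset.mem_filter, Finset.mem_Icc] at hc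
      rw [Finset.mem_Icc]; omega
    exact (Nat.cast_le.mpr hcard).trans (Nat.floor_le (by positivity))
  rw [Real.log_div (by linarith) (by linarith)]
  rw [abs_le] at *
  have e : Y / (α - 1) * (1/4) = 1 / (4 * (α - 1)) * Y := by field_simp
  constructor <;> nlinarith
end
end KL

end ModD1

section ModD3

open Finset
namespace KL
noncomputable section

open Classical in
theorem coprime_ind (X c : ℕ) (hc : 1 ≤ c) (hcX : c ≤ X) (d : ℤ) :
    (if IsCoprime (c:ℤ) d then (1:ℝ) else 0) =
      ∑ g ∈ Icc 1 X, if (g:ℤ) ∣ c ∧ (g:ℤ) ∣ d then ((ArithmeticFunction.moebius g : ℤ) : ℝ) else 0 := by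
  have hG : Int.gcd (c:ℤ) d ≠ 0 := by
    intro h; rw [Int.gcd_eq_zero_iff] at h; omega
  have h1 : (∑ g ∈ (Int.gcd (c:ℤ) d).divisors, (ArithmeticFunction.moebius g : ℤ)) =
      if Int.gcd (c:ℤ) d = 1 then 1 else 0 := by
    have := ArithmeticFunction.coe_mul_zeta_apply (f := ArithmeticFunction.moebius) (x := Int.gcd (c:ℤ) d)
    rw [← this, ArithmeticFunction.moebius_mul_coe_zeta, ArithmeticFunction.one_apply]
  rw [← Finset.sum_filter]
  have h2 : (Icc 1 X).filter (fun g : ℕ => (g:ℤ) ∣ c ∧ (g:ℤ) ∣ d) = (Int.gcd (c:ℤ) d).divisors := by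
    ext g
    simp only [mem_filter, mem_Icc, Nat.mem_divisors]
    constructor
    · rintro ⟨_, h1, h2⟩
      exact ⟨by exact_mod_cast Int.dvd_coe_gcd h1 h2, hG⟩
    · rintro ⟨h, _⟩
      have h1 : (g:ℤ) ∣ c := (Int.natCast_dvd_natCast.mpr h).trans (Int.gcd_dvd_left ..)
      have h2 : (g:ℤ) ∣ d := (Int.natCast_dvd_natCast.mpr h).trans (Int.gcd_dvd_right ..)
      have h3 : g ∣ c := by exact_mod_cast h1
      exact ⟨⟨Nat.pos_of_dvd_of_pos h3 hc, (Nat.le_of_dvd hc h3).trans hcX⟩, h1, h2⟩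
  rw [h2, ← Int.cast_sum, h1]
  simp only [Int.isCoprime_iff_gcd_eq_one]
  split_ifs <;> simp

open Classical in
theorem Mc_g (α N : ℝ) (X g : ℕ) (hg : 1 ≤ g) :
    (∑ c ∈ Icc 1 X, ∑ d ∈ (Ioo (-(c:ℤ)) c).filter (fun d : ℤ => Odd ((c:ℤ) + d)),
      if (g:ℤ) ∣ c ∧ (g:ℤ) ∣ d then max 0 (N - d - α * c) / (2 * c) else 0) =
    if Odd g then Lf α (N / g) (X / g) else 0 := by
  have hg0 : (0:ℝ) < g := by exact_mod_cast hg
  have hgz : (0:ℤ) < g := by exact_mod_cast hg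
  split_ifs with ho
  · unfold Lf
    rw [Finset.sum_sigma', Finset.sum_sigma', ← Finset.sum_filter]
    symm
    refine Finset.sum_nbij' (fun p : (Σ _ : ℕ, ℤ) => (⟨g * p.1, g * p.2⟩ : (Σ _ : ℕ, ℤ)))
      (fun p : (Σ _ : ℕ, ℤ) => (⟨p.1 / g, p.2 / g⟩ : (Σ _ : ℕ, ℤ))) ?_ ?_ ?_ ?_ ?_
    · rintro ⟨c, d⟩ h
      simp only [mem_sigma, mem_Icc, mem_filter, mem_Ioo] at h ⊢
      obtain ⟨⟨h1, h2⟩, ⟨h3, h4⟩, h5⟩ := h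
      refine ⟨⟨⟨Nat.mul_pos hg h1, ?_⟩, ⟨?_, ?_⟩, ?_⟩, ?_, ?_⟩
      · rw [mul_comm]; exact (Nat.le_div_iff_mul_le hg).mp h2
      · push_cast; nlinarith
      · push_cast; nlinarith
      · push_cast; rw [← mul_add]
        exact (by exact_mod_cast ho : Odd (g:ℤ)).mul h5
      · push_cast; exact dvd_mul_right _ _
      · exact dvd_mul_right _ _
    · rintro ⟨c, d⟩ h
      simp only [mem_sigma, mem_Icc, mem_filter, mem_Ioo] at h ⊢
      obtain ⟨⟨⟨h1, h2⟩, ⟨h3, h4⟩, h5⟩, h6, h7⟩ := h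
      have h6' : g ∣ c := by exact_mod_cast h6
      obtain ⟨c', rfl⟩ := h6'
      obtain ⟨d', rfl⟩ := h7
      rw [Nat.mul_div_cancel_left _ hg, Int.mul_ediv_cancel_left _ hgz.ne']
      push_cast at *
      refine ⟨⟨Nat.pos_of_mul_pos_left h1, ?_⟩, ⟨?_, ?_⟩, ?_⟩
      · rw [Nat.le_div_iff_mul_le hg]; linarith
      · nlinarith
      · nlinarith
      · rw [← mul_add, Int.odd_mul] at h5; exact h5.2
    · rintro ⟨c, d⟩ h
      simp only [Nat.mul_div_cancel_left _ hg, Int.mul_ediv_cancel_left _ hgz.ne']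
    · rintro ⟨c, d⟩ h
      simp only [mem_sigma, mem_Icc, mem_filter, mem_Ioo] at h ⊢
      have h6' : g ∣ c := by exact_mod_cast h.2.1
      rw [Nat.mul_div_cancel' h6', Int.mul_ediv_cancel' h.2.2]
    · rintro ⟨c, d⟩ h
      simp only [mem_sigma, mem_Icc, mem_filter, mem_Ioo] at h ⊢
      have hc : (0:ℝ) < c := by exact_mod_cast h.1.1
      push_cast
      have : N - g * d - α * (g * c) = g * (N / g - d - α * c) := by field_simp
      rw [this]
      have h2 : max 0 ((g:ℝ) * (N / g - d - α * c)) = g * max 0 (N / g - d - α * c) := by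
        rw [mul_max_of_nonneg _ _ hg0.le, mul_zero]
      rw [h2]; field_simp
  · apply Finset.sum_eq_zero
    intro c _
    apply Finset.sum_eq_zero
    intro d hd
    rw [if_neg]
    rintro ⟨h1, h2⟩
    have h5 := (mem_filter.mp hd).2
    obtain ⟨k, hk⟩ := dvd_add h1 h2
    rw [hk, Int.odd_mul] at h5
    exact ho (by exact_mod_cast h5.1)

open Classical in
theorem D3 (α N : ℝ) (X : ℕ) : ∑ c ∈ Icc 1 X, Mc α N c =
    ∑ g ∈ Icc 1 X, ((ArithmeticFunction.moebius g : ℤ) : ℝ) * (if Odd g then Lf α (N / g) (X / g) else 0) := by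
  have h1 : ∀ c ∈ Icc 1 X, Mc α N c = ∑ g ∈ Icc 1 X,
      ∑ d ∈ (Ioo (-(c:ℤ)) c).filter (fun d : ℤ => Odd ((c:ℤ) + d)), ((ArithmeticFunction.moebius g : ℤ) : ℝ) *
        (if (g:ℤ) ∣ c ∧ (g:ℤ) ∣ d then max 0 (N - d - α * c) / (2 * c) else 0) := by
    intro c hc
    rw [mem_Icc] at hc
    unfold Mc
    have e : (Ioo (-(c:ℤ)) c).filter (fun d : ℤ => IsCoprime (c:ℤ) d ∧ Odd ((c:ℤ) + d)) =
      ((Ioo (-(c:ℤ)) c).filter (fun d : ℤ => Odd ((c:ℤ) + d))).filter (fun d : ℤ => IsCoprime (c:ℤ) d) := by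
      rw [filter_filter]; congr 1; ext d; rw [and_comm]
    rw [e, sum_filter, sum_comm]
    apply sum_congr rfl
    intro d _
    have := coprime_ind X c hc.1 hc.2 d
    calc (if IsCoprime (c:ℤ) d then max 0 (N - d - α * c) / (2 * c) else 0)
        = (if IsCoprime (c:ℤ) d then (1:ℝ) else 0) * (max 0 (N - d - α * c) / (2 * c)) := by split_ifs <;> simp
      _ = _ := by
        rw [this, sum_mul]
        apply sum_congr rfl
        intro g _
        split_ifs <;> simp
  rw [sum_congr rfl h1, sum_comm]
  apply sum_congr rfl
  intro g hg
  rw [← Mc_g α N X g (mem_Icc.mp hg).1, mul_sum]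
  apply sum_congr rfl
  intro c _
  rw [mul_sum]

end
end KL

end ModD3

section ModD4

open Finset
namespace KL
noncomputable section

def muf (n : ℕ) : ℝ := ((ArithmeticFunction.moebius n : ℤ) : ℝ) / (n:ℝ) ^ 2
open Classical in
def muo (n : ℕ) : ℝ := if Odd n then muf n else 0

theorem muf_le (n : ℕ) : |muf n| ≤ ((n:ℝ) ^ 2)⁻¹ := by
  unfold muf
  rw [abs_div, abs_of_nonneg (by positivity : (0:ℝ) ≤ (n:ℝ)^2), div_eq_mul_inv]
  have : |((ArithmeticFunction.moebius n : ℤ) : ℝ)| ≤ 1 := by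
    exact_mod_cast ArithmeticFunction.abs_moebius_le_one
  calc _ ≤ 1 * ((n:ℝ) ^ 2)⁻¹ := by gcongr
    _ = _ := one_mul _

theorem muo_le (n : ℕ) : |muo n| ≤ ((n:ℝ) ^ 2)⁻¹ := by
  unfold muo; split_ifs
  · exact muf_le n
  · simp

theorem muf_summable : Summable muf :=
  Summable.of_norm_bounded (g := fun n : ℕ => ((n:ℝ) ^ 2)⁻¹) (Real.summable_nat_pow_inv.mpr (by norm_num)) muf_le
theorem muo_summable : Summable muo :=
  Summable.of_norm_bounded (g := fun n : ℕ => ((n:ℝ) ^ 2)⁻¹) (Real.summable_nat_pow_inv.mpr (by norm_num)) muo_le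

theorem muf_tsum : ∑' n, muf n = 6 / Real.pi ^ 2 := by
  have h := ArithmeticFunction.LSeries_zeta_mul_Lseries_moebius (s := 2) (by norm_num)
  rw [ArithmeticFunction.LSeries_zeta_eq_riemannZeta (by norm_num), riemannZeta_two] at h
  have h2 : LSeries (fun n => ((ArithmeticFunction.moebius n : ℤ) : ℂ)) 2 = ((∑' n, muf n : ℝ) : ℂ) := by
    rw [Complex.ofReal_tsum, LSeries]
    apply tsum_congr
    intro n
    rw [LSeries.term_def]
    unfold muf
    split_ifs with h0
    · simp [h0]
    · push_cast
      norm_num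
  rw [h2] at h
  have h3 : Real.pi ^ 2 / 6 * (∑' n, muf n) = 1 := by exact_mod_cast h
  have := Real.pi_pos
  field_simp at h3 ⊢
  linarith

theorem muf_two (k : ℕ) : muf (2 * k) = -(1/4) * muo k := by
  unfold muo
  split_ifs with hk
  · unfold muf
    have : Nat.Coprime 2 k := (Nat.coprime_two_left).mpr hk
    rw [ArithmeticFunction.isMultiplicative_moebius.map_mul_of_coprime this,
      ArithmeticFunction.moebius_apply_prime Nat.prime_two]
    push_cast
    have : (k:ℝ) ≠ 0 := by rintro h; have : k = 0 := by exact_mod_cast h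
                           subst this; simp at hk
    field_simp; ring
  · rw [Nat.not_odd_iff_even] at hk
    obtain ⟨j, rfl⟩ := hk
    unfold muf
    rw [ArithmeticFunction.moebius_eq_zero_of_not_squarefree]
    · simp
    · intro h
      have := h 2 ⟨j, by ring⟩
      simp at this

theorem muo_tsum : ∑' n, muo n = 8 / Real.pi ^ 2 := by
  have inj0 : Function.Injective (fun k : ℕ => 2 * k) := fun a b h => by simpa using h
  have inj1 : Function.Injective (fun k : ℕ => 2 * k + 1) := fun a b h => by simpa using h
  have h1 := tsum_even_add_odd (muf_summable.comp_injective inj0) (muf_summable.comp_injective inj1)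
  have h2 := tsum_even_add_odd (muo_summable.comp_injective inj0) (muo_summable.comp_injective inj1)
  have e1 : ∀ k, muo (2 * k) = 0 := fun k => by unfold muo; rw [if_neg]; simp
  have e2 : ∀ k, muo (2 * k + 1) = muf (2 * k + 1) := fun k => by
    unfold muo; rw [if_pos]; exact ⟨k, rfl⟩
  simp only [e1, e2, tsum_zero, zero_add] at h2
  simp only [muf_two, tsum_mul_left] at h1
  rw [h2, muf_tsum] at h1
  linarith [show 8 / Real.pi ^ 2 = 4/3 * (6 / Real.pi ^ 2) by ring]

theorem D4 (X : ℕ) (hX : 1 ≤ X) : |(∑ g ∈ Icc 1 X, muo g) - 8 / Real.pi ^ 2| ≤ 1 / (X:ℝ) := by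
  have ht := muo_summable.hasSum.tendsto_sum_nat
  rw [muo_tsum] at ht
  have ht2 := ((ht.const_sub (∑ g ∈ Icc 1 X, muo g)).abs)
  refine le_of_tendsto ht2 ?_
  filter_upwards [Filter.eventually_ge_atTop (X+1)] with n hn
  have e : range n = insert 0 (Icc 1 X ∪ Ioc X (n-1)) := by
    ext i; simp only [mem_range, mem_insert, mem_union, mem_Icc, mem_Ioc]; omega
  rw [e, sum_insert (by simp), sum_union]
  · have : muo 0 = 0 := by simp [muo]
    rw [this]
    have h3 : |∑ i ∈ Ioc X (n-1), muo i| ≤ 1 / X := by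
      calc _ ≤ ∑ i ∈ Ioc X (n-1), |muo i| := abs_sum_le_sum_abs _ _
        _ ≤ ∑ i ∈ Ioc X (n-1), ((i:ℝ)^2)⁻¹ := sum_le_sum fun i _ => muo_le i
        _ ≤ (X:ℝ)⁻¹ - ((n-1 : ℕ):ℝ)⁻¹ := sum_Ioc_inv_sq_le_sub (by omega) (by omega)
        _ ≤ _ := by
          rw [one_div]
          have : (0:ℝ) ≤ ((n-1 : ℕ):ℝ)⁻¹ := by positivity
          linarith
    rw [show (∑ g ∈ Icc 1 X, muo g) - (0 + ((∑ g ∈ Icc 1 X, muo g) + ∑ i ∈ Ioc X (n-1), muo i)) = -∑ i ∈ Ioc X (n-1), muo i by ring, abs_neg]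
    exact h3
  · rw [disjoint_left]; intro a; simp only [mem_Icc, mem_Ioc]; omega

theorem D5 (α : ℝ) (hα : 1 < α) : ∃ C : ℝ, 0 < C ∧ ∀ (N : ℝ) (X : ℕ), 1 ≤ N → N / (α - 1) ≤ X → 1 ≤ X → X ≤ N / (α - 1) + 1 →
    |(∑ c ∈ Icc 1 X, Mc α N c) - N ^ 2 / Real.pi ^ 2 * Real.log ((α + 1) / (α - 1))| ≤ C * N * (1 + Real.log X) := by
  obtain ⟨C, hC, h⟩ := D2 α hα
  set l := Real.log ((α + 1) / (α - 1)) with hl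
  have ha : 0 < α - 1 := by linarith
  have hl0 : 0 ≤ l := Real.log_nonneg (by rw [le_div_iff₀ ha]; linarith)
  refine ⟨C + (α - 1) * l / 8, by positivity, fun N X hN hX hX1 hX2 => ?_⟩
  have hX0 : (1:ℝ) ≤ X := by exact_mod_cast hX1
  have hlogX : 0 ≤ Real.log X := Real.log_nonneg hX0
  rw [D3]
  have h1 : ∀ g ∈ Icc 1 X, |((ArithmeticFunction.moebius g : ℤ) : ℝ) * (if Odd g then Lf α (N / g) (X / g) else 0) - muo g * (N ^ 2 / 8 * l)| ≤ C * N * ((g:ℝ))⁻¹ := by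
    intro g hg
    rw [mem_Icc] at hg
    have hg0 : (0:ℝ) < g := by exact_mod_cast hg.1
    unfold muo
    split_ifs with ho
    · have h2 := h (N / g) (X / g) (by positivity) (by
        have : (X:ℝ) / g ≤ ((X / g : ℕ):ℝ) + 1 := by
          rw [div_le_iff₀ hg0]
          have := Nat.lt_div_mul_add (a := X) hg.1
          have : (X:ℝ) < ((X / g : ℕ):ℝ) * g + g := by exact_mod_cast this
          linarith
        refine le_trans ?_ this
        rw [div_div, mul_comm, ← div_div]
        gcongr)
      unfold muf
      have hm : |((ArithmeticFunction.moebius g : ℤ) : ℝ)| ≤ 1 := by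
        exact_mod_cast ArithmeticFunction.abs_moebius_le_one
      rw [show ((ArithmeticFunction.moebius g : ℤ) : ℝ) * Lf α (N / g) (X / g) - ((ArithmeticFunction.moebius g : ℤ) : ℝ) / (g:ℝ) ^ 2 * (N ^ 2 / 8 * l) = ((ArithmeticFunction.moebius g : ℤ) : ℝ) * (Lf α (N / g) (X / g) - (N / g) ^ 2 / 8 * l) by ring, abs_mul]
      calc _ ≤ 1 * (C * (N / g)) := by gcongr
        _ = _ := by ring
    · simp; positivity
  have h2 := D4 X hX1
  have h3 : ∑ g ∈ Icc 1 X, (g:ℝ)⁻¹ ≤ 1 + Real.log X := by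
    have := harmonic_le_one_add_log X
    rw [harmonic_eq_sum_Icc] at this
    push_cast at this
    exact this
  have h4 : |(∑ g ∈ Icc 1 X, ((ArithmeticFunction.moebius g : ℤ) : ℝ) * (if Odd g then Lf α (N / g) (X / g) else 0)) - (∑ g ∈ Icc 1 X, muo g) * (N ^ 2 / 8 * l)| ≤ C * N * (1 + Real.log X) := by
    rw [sum_mul, ← sum_sub_distrib]
    calc _ ≤ ∑ g ∈ Icc 1 X, C * N * ((g:ℝ))⁻¹ := (abs_sum_le_sum_abs _ _).trans (sum_le_sum h1)
      _ = C * N * ∑ g ∈ Icc 1 X, ((g:ℝ))⁻¹ := by rw [mul_sum]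
      _ ≤ _ := by gcongr
  have h5 : |(∑ g ∈ Icc 1 X, muo g) * (N ^ 2 / 8 * l) - N ^ 2 / Real.pi ^ 2 * l| ≤ (α - 1) * l / 8 * N * (1 + Real.log X) := by
    rw [show (∑ g ∈ Icc 1 X, muo g) * (N ^ 2 / 8 * l) - N ^ 2 / Real.pi ^ 2 * l = ((∑ g ∈ Icc 1 X, muo g) - 8 / Real.pi ^ 2) * (N ^ 2 / 8 * l) by ring, abs_mul, abs_of_nonneg (by positivity : 0 ≤ N ^ 2 / 8 * l)]
    have h6 : 1 / (X:ℝ) * N ≤ α - 1 := by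
      rw [div_le_iff₀ ha] at hX
      rw [one_div_mul_eq_div, div_le_iff₀ (by linarith)]; linarith
    calc _ ≤ 1 / (X:ℝ) * (N ^ 2 / 8 * l) := by gcongr
      _ = (1 / (X:ℝ) * N) * (N * l / 8) := by ring
      _ ≤ (α - 1) * (N * l / 8) := by gcongr
      _ = (α - 1) * l / 8 * N * 1 := by ring
      _ ≤ _ := by gcongr; linarith
  calc _ ≤ _ := abs_sub_le _ ((∑ g ∈ Icc 1 X, muo g) * (N ^ 2 / 8 * l)) _
    _ ≤ C * N * (1 + Real.log X) + (α - 1) * l / 8 * N * (1 + Real.log X) := add_le_add h4 h5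
    _ = _ := by ring

end
end KL

end ModD4

section ModE1

open Finset
namespace KL
noncomputable section

def PP (a b c d : ℤ) : Prop := (a * d - b * c = 1 ∨ a * d - b * c = -1) ∧ c < a ∧ -c < d ∧ d < c ∧
  ((Odd a ∧ Even b ∧ Even c ∧ Odd d) ∨ (Even a ∧ Odd b ∧ Odd c ∧ Even d))

def mob (a b c d : ℤ) (v : ℝ) : ℝ := (a * v + b) / (c * v + d)

def prodM (u : ℝ) (n : ℕ) : Matrix (Fin 2) (Fin 2) ℤ :=
  ((List.range n).map (fun i => Mmat (aE (TE^[i] u)) (eE (TE^[i] u)))).prod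

theorem prodM_zero (u : ℝ) : prodM u 0 = 1 := by simp [prodM]

theorem prodM_succ (u : ℝ) (n : ℕ) : prodM u (n + 1) = Mmat (aE u) (eE u) * prodM (TE u) n := by
  simp [prodM, List.range_succ_eq_map, List.map_map, Function.comp_def]

theorem prodM_add (u : ℝ) (m n : ℕ) : prodM u (m + n) = prodM u m * prodM (TE^[m] u) n := by
  induction m generalizing u with
  | zero => simp [prodM_zero]
  | succ m ih =>
    rw [show m + 1 + n = (m + n) + 1 by ring, prodM_succ, ih, prodM_succ, mul_assoc,
      Function.iterate_succ_apply]

theorem digit (a1 e : ℤ) (he : e = 1 ∨ e = -1) (ha : Even a1) (w : ℝ) (hw : 1 < w) :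
    aE (a1 + e / w) = a1 ∧ eE (a1 + e / w) = e ∧ TE (a1 + e / w) = w := by
  obtain ⟨k, hk⟩ := ha
  have hw0 : 0 < w := by linarith
  have h1 : 1 / w < 1 := by rw [div_lt_one hw0]; exact hw
  have h0 : 0 < 1 / w := by positivity
  have hA : aE (a1 + e / w) = a1 := by
    unfold aE
    have : ⌊((a1:ℝ) + e / w + 1) / 2⌋ = k := by
      rw [Int.floor_eq_iff, hk]
      push_cast
      rcases he with rfl | rfl
      · push_cast; constructor <;> linarith
      · push_cast; rw [neg_div]; constructor <;> linarith
    rw [this]; omega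
  have hEE : eE (a1 + e / w) = e := by
    unfold eE
    rw [hA]
    rcases he with rfl | rfl
    · rw [if_pos]; push_cast; linarith
    · rw [if_neg]; push_cast; rw [neg_div]; linarith
  refine ⟨hA, hEE, ?_⟩
  unfold TE
  rw [hA, hEE]
  rcases he with rfl | rfl
  · push_cast; field_simp; ring
  · push_cast; field_simp; ring_nf

theorem PP_sum {a b c d : ℤ} (h : PP a b c d) : 0 ≤ a - c + b - d := by
  obtain ⟨h1, h2, h3, h4, -⟩ := h
  have hc : 0 < c := by omega
  have : 1 ≤ (a - c) * (c + d) := by nlinarith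
  by_contra hneg
  push Not at hneg
  rcases h1 with h1 | h1 <;> nlinarith

theorem mob_gt {a b c d : ℤ} (h : PP a b c d) (v : ℝ) (hv : 1 < v) : 1 < mob a b c d v ∧ 0 < (c:ℝ) * v + d := by
  have h0 := PP_sum h
  obtain ⟨h1, h2, h3, h4, -⟩ := h
  have hc : 0 < c := by omega
  have hc' : (0:ℝ) < c := by exact_mod_cast hc
  have h3' : -(c:ℝ) < d := by exact_mod_cast h3
  have hpos : 0 < (c:ℝ) * v + d := by nlinarith
  refine ⟨?_, hpos⟩
  unfold mob
  rw [lt_div_iff₀ hpos]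
  have h2' : (c:ℝ) < a := by exact_mod_cast h2
  have h0' : (0:ℝ) ≤ a - c + b - d := by exact_mod_cast h0
  nlinarith

theorem algo_step {a b c d : ℤ} (h : PP a b c d) (hc : 2 ≤ c) : ∃ a1 e r s : ℤ, Even a1 ∧ (e = 1 ∨ e = -1) ∧
    PP c d r s ∧ a = a1 * c + e * r ∧ b = a1 * d + e * s := by
  obtain ⟨h1, h2, h3, h4, h5⟩ := h
  obtain ⟨q, hq⟩ : ∃ q, q = (a + c) / (2 * c) := ⟨_, rfl⟩
  have hq1 : q * (2 * c) ≤ a + c := by rw [hq]; exact Int.ediv_mul_le _ (by omega)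
  have hq2 : a + c < (q + 1) * (2 * c) := by rw [hq]; exact Int.lt_ediv_add_one_mul_self _ (by omega)
  set m := a - 2 * q * c with hm
  have hm1 : -c ≤ m := by rw [hm]; linarith
  have hm2 : m < c := by rw [hm]; linarith
  have hdet : m * d - (b - 2 * q * d) * c = 1 ∨ m * d - (b - 2 * q * d) * c = -1 := by
    rcases h1 with h1 | h1
    · left; rw [hm]; linarith
    · right; rw [hm]; linarith
  have hnd : ∀ k : ℤ, m ≠ k * c := by
    intro k hk
    rw [hk] at hdet
    have : c ∣ 1 := by
      rcases hdet with h | h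
      · exact ⟨k * d - (b - 2 * q * d), by linarith⟩
      · exact ⟨-(k * d - (b - 2 * q * d)), by linarith⟩
    have := Int.le_of_dvd one_pos this
    omega
  have hm0 : m ≠ 0 := by simpa using hnd 0
  have hmc : m ≠ -c := by simpa using hnd (-1)
  have main : ∀ e r s : ℤ, (e = 1 ∨ e = -1) → m = e * r → b - 2 * q * d = e * s → 0 < r → r < c → PP c d r s := by
    intro e r s he hmr hbs hr hrc
    have hpar : (Odd c ∧ Even d ∧ Even r ∧ Odd s) ∨ (Even c ∧ Odd d ∧ Odd r ∧ Even s) := by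
      have hma : a = e * r + 2 * (q * c) := by rw [← hmr, hm]; ring
      have hbb : b = e * s + 2 * (q * d) := by rw [← hbs]; ring
      rw [hma, hbb] at h5
      rcases he with rfl | rfl
      · simpa [parity_simps, and_comm, and_assoc, and_left_comm, or_comm] using h5
      · simpa [parity_simps, and_comm, and_assoc, and_left_comm, or_comm] using h5
    have hdet' : c * s - d * r = 1 ∨ c * s - d * r = -1 := by
      rw [hmr, hbs] at hdet
      rcases he with rfl | rfl
      · rcases hdet with h | h
        · right; linarith
        · left; linarith
      · rcases hdet with h | h
        · left; linarith
        · right; linarith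
    have hne1 : s ≠ r := by
      rintro rfl
      rcases hpar with h | h
      · exact (Int.not_even_iff_odd.mpr h.2.2.2) h.2.2.1
      · exact (Int.not_even_iff_odd.mpr h.2.2.1) h.2.2.2
    have hne2 : s ≠ -r := by
      rintro rfl
      rcases hpar with h | h
      · exact (Int.not_even_iff_odd.mpr h.2.2.2) h.2.2.1.neg
      · exact (Int.not_even_iff_odd.mpr h.2.2.1) (by simpa using h.2.2.2)
    have hs1 : s < r := by
      by_contra hcon
      have : r + 1 ≤ s := by omega
      rcases hdet' with h | h <;> nlinarith
    have hs2 : -r < s := by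
      by_contra hcon
      have : s ≤ -r - 1 := by omega
      rcases hdet' with h | h <;> nlinarith
    exact ⟨hdet', hrc, hs2, hs1, hpar⟩
  rcases lt_or_gt_of_ne hm0 with hlt | hgt
  · refine ⟨2 * q, -1, -m, -(b - 2 * q * d), by simp, Or.inr rfl, ?_, by rw [hm]; ring, by ring⟩
    exact main (-1) _ _ (Or.inr rfl) (by ring) (by ring) (by omega) (by omega)
  · refine ⟨2 * q, 1, m, (b - 2 * q * d), by simp, Or.inl rfl, ?_, by rw [hm]; ring, by ring⟩
    exact main 1 _ _ (Or.inl rfl) (by ring) (by ring) (by omega) (by omega)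

theorem algo (m : ℕ) : ∀ {a b c d : ℤ}, c.toNat ≤ m → PP a b c d → ∀ v : ℝ, 1 < v →
    ∃ n : ℕ, 0 < n ∧ TE^[n] (mob a b c d v) = v ∧ prodM (mob a b c d v) n = !![a, b; c, d] := by
  induction m with
  | zero =>
    intro a b c d hc h
    have := h.2.2.1
    have := h.2.2.2.1
    omega
  | succ m ih =>
    intro a b c d hcm h v hv
    have hv0 : 0 < v := by linarith
    by_cases hc : 2 ≤ c
    · obtain ⟨a1, e, r, s, h1, h2, h3, h4, h5⟩ := algo_step h hc
      have hr : r < c := h3.2.1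
      obtain ⟨n, hn, hn1, hn2⟩ := ih (by omega) h3 v hv
      have hw := (mob_gt h3 v hv).1
      have hp := (mob_gt h v hv).2
      have hp' := (mob_gt h3 v hv).2
      have hm : mob a b c d v = a1 + e / mob c d r s v := by
        unfold mob
        rw [div_div_eq_mul_div, h4, h5]
        push_cast
        field_simp
        ring
      obtain ⟨d1, d2, d3⟩ := digit a1 e h2 h1 _ hw
      rw [← hm] at d1 d2 d3
      refine ⟨n + 1, by omega, ?_, ?_⟩
      · rw [Function.iterate_succ_apply, d3, hn1]
      · rw [prodM_succ, d1, d2, d3, hn2, h4, h5]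
        unfold Mmat
        ext i j; fin_cases i <;> fin_cases j <;> simp [Matrix.mul_apply]
    · obtain ⟨h1, h2, h3, h4, h5⟩ := h
      have hc1 : c = 1 := by omega
      have hd : d = 0 := by omega
      subst hc1 hd
      have ha : Even a := by
        rcases h5 with h | h
        · simp at h
        · exact h.1
      have hb : b = 1 ∨ b = -1 := by omega
      have hm : mob a b 1 0 v = a + b / v := by
        unfold mob; push_cast; field_simp; ring
      obtain ⟨d1, d2, d3⟩ := digit a b hb ha _ hv
      rw [← hm] at d1 d2 d3
      refine ⟨1, one_pos, by simpa using d3, ?_⟩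
      have := prodM_succ (mob a b 1 0 v) 0
      rw [d1, d2, prodM_zero, mul_one] at this
      exact this

theorem aE_ge {u : ℝ} (hu : 1 < u) : 2 ≤ aE u := by
  unfold aE
  have : (1:ℤ) ≤ ⌊(u + 1) / 2⌋ := Int.le_floor.mpr (by push_cast; linarith)
  omega

theorem eE_or (u : ℝ) : eE u = 1 ∨ eE u = -1 := by
  unfold eE; split_ifs <;> simp

theorem TE_spec {u : ℝ} (hi : Irrational u) : 1 < TE u ∧ Irrational (TE u) ∧ u = aE u + eE u / TE u := by
  have h1 : (⌊(u + 1) / 2⌋ : ℝ) ≤ (u + 1) / 2 := Int.floor_le _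
  have h2 : (u + 1) / 2 < ⌊(u + 1) / 2⌋ + 1 := Int.lt_floor_add_one _
  have ha : (aE u : ℝ) = 2 * ⌊(u + 1) / 2⌋ := by unfold aE; push_cast; rfl
  have hi2 : Irrational (u - aE u) := hi.sub_intCast _
  have hne : u - aE u ≠ 0 := hi2.ne_zero
  have hne1 : u - aE u ≠ -1 := by exact_mod_cast hi2.ne_int (-1)
  have h3 : u - aE u < 1 := by rw [ha]; linarith
  have h4 : -1 < u - aE u := lt_of_le_of_ne (by rw [ha]; linarith) (Ne.symm hne1)
  unfold TE
  by_cases h : (aE u : ℝ) < u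
  · have e : eE u = 1 := by unfold eE; rw [if_pos h]
    rw [e]; push_cast
    refine ⟨?_, ?_, ?_⟩
    · rw [lt_div_iff₀ (by linarith)]; linarith
    · rw [one_div]; exact hi2.inv
    · field_simp; ring
  · have e : eE u = -1 := by unfold eE; rw [if_neg h]
    rw [e]; push_cast
    have hlt : u - aE u < 0 := lt_of_le_of_ne (by linarith) hne
    refine ⟨?_, ?_, ?_⟩
    · rw [lt_div_iff_of_neg hlt]; linarith
    · rw [neg_div, one_div]; exact hi2.inv.neg
    · field_simp; ring

theorem iter_spec {u : ℝ} (hu : 1 < u) (hi : Irrational u) (n : ℕ) : 1 < TE^[n] u ∧ Irrational (TE^[n] u) := by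
  induction n with
  | zero => exact ⟨hu, hi⟩
  | succ n ih =>
    rw [Function.iterate_succ_apply']
    exact ⟨(TE_spec ih.2).1, (TE_spec ih.2).2.1⟩

theorem PP_b {a b c d : ℤ} (h : PP a b c d) : -a < b ∧ b < a := by
  obtain ⟨h1, h2, h3, h4, h5⟩ := h
  have hc : 0 < c := by omega
  have h6 : a * d ≤ a * (c - 1) := by nlinarith
  have h7 : a * (-(c - 1)) ≤ a * d := by nlinarith
  constructor
  · by_contra hcon
    push Not at hcon
    rcases h1 with h | h <;> nlinarith
  · by_contra hcon
    push Not at hcon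
    rcases h1 with h | h <;> nlinarith

theorem prod_PP (n : ℕ) : ∀ u : ℝ, 1 < u → Irrational u → ∃ a b c d : ℤ, prodM u (n + 1) = !![a, b; c, d] ∧
    PP a b c d ∧ u = mob a b c d (TE^[n + 1] u) := by
  induction n with
  | zero =>
    intro u hu hi
    refine ⟨aE u, eE u, 1, 0, ?_, ?_, ?_⟩
    · rw [prodM_succ, prodM_zero, mul_one]; rfl
    · have h2 := aE_ge hu
      refine ⟨?_, by omega, by omega, by omega, Or.inr ⟨?_, ?_, by simp, by simp⟩⟩
      · rcases eE_or u with h | h <;> rw [h] <;> simp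
      · unfold aE; simp
      · rcases eE_or u with h | h <;> rw [h] <;> simp
    · obtain ⟨h1, h2, h3⟩ := TE_spec hi
      simp only [zero_add, Function.iterate_one]
      unfold mob
      push_cast
      have : TE u ≠ 0 := by linarith
      rw [mul_comm, add_zero, one_mul, eq_div_iff this]
      nth_rewrite 1 [h3]
      field_simp
  | succ n ih =>
    intro u hu hi
    obtain ⟨h1, h2, h3⟩ := TE_spec hi
    obtain ⟨a, b, c, d, e1, e2, e3⟩ := ih (TE u) h1 h2
    have hb := PP_b e2
    have h2' := aE_ge hu
    have hmob := (mob_gt e2 _ (iter_spec h1 h2 (n+1)).1).2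
    refine ⟨aE u * a + eE u * c, aE u * b + eE u * d, a, b, ?_, ?_, ?_⟩
    · rw [prodM_succ, e1]
      unfold Mmat
      ext i j; fin_cases i <;> fin_cases j <;> simp [Matrix.mul_apply]
    · obtain ⟨f1, f2, f3, f4, f5⟩ := e2
      have hE : Even (aE u) := by unfold aE; simp
      refine ⟨?_, ?_, hb.1, hb.2, ?_⟩
      · rcases eE_or u with h | h <;> rw [h]
        · rcases f1 with f | f
          · right; linarith
          · left; linarith
        · rcases f1 with f | f
          · left; linarith
          · right; linarith
      · rcases eE_or u with h | h <;> rw [h] <;> nlinarith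
      · have hO : Odd (eE u) := by rcases eE_or u with h | h <;> rw [h] <;> decide
        · rcases f5 with ⟨g1, g2, g3, g4⟩ | ⟨g1, g2, g3, g4⟩
          · right
            refine ⟨(hE.mul_right _).add (g3.mul_left _), (hE.mul_right _).add_odd (hO.mul g4), g1, g2⟩
          · left
            refine ⟨(hE.mul_right _).add_odd (hO.mul g3), (hE.mul_right _).add (g4.mul_left _), g1, g2⟩
    · rw [Function.iterate_succ_apply]
      set v := TE^[n+1] (TE u)
      have hTE : TE u ≠ 0 := by linarith
      have hnum : (a:ℝ) * v + b ≠ 0 := by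
        intro h
        rw [mob, h, zero_div] at e3
        exact hTE e3
      unfold mob at e3 ⊢
      rw [e3] at h3
      have h4 : u * (a * v + b) = aE u * (a * v + b) + eE u * (c * v + d) := by
        rw [div_div_eq_mul_div] at h3
        generalize (aE u : ℝ) = x at *
        generalize (eE u : ℝ) = y at *
        rw [h3, add_mul, div_mul_cancel₀ _ hnum]
      rw [eq_div_iff hnum, h4]
      push_cast
      ring

end
end KL

end ModE1

section ModE2

open Finset
namespace KL
noncomputable section

theorem per_spec {w : ℝ} {n : ℕ} (hn : 0 < n) (h : TE^[n] w = w) :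
    0 < perE w ∧ TE^[perE w] w = w ∧ perE w ∣ n := by
  have hmem : perE w ∈ {n : ℕ | 0 < n ∧ TE^[n] w = w} := Nat.sInf_mem ⟨n, hn, h⟩
  refine ⟨hmem.1, hmem.2, ?_⟩
  have h2 : TE^[n % perE w] w = w :=
    Function.IsPeriodicPt.mod (f := TE) (show Function.IsPeriodicPt TE n w from h) hmem.2
  rw [Nat.dvd_iff_mod_eq_zero]
  by_contra hne
  have h3 : perE w ≤ n % perE w := Nat.sInf_le ⟨Nat.pos_of_ne_zero hne, h2⟩
  have := Nat.mod_lt n hmem.1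
  omega

theorem prodM_mul {w : ℝ} {p : ℕ} (h : TE^[p] w = w) (k : ℕ) : prodM w (p * k) = prodM w p ^ k := by
  induction k with
  | zero => simp [prodM_zero]
  | succ k ih =>
    rw [mul_add, mul_one, add_comm, prodM_add, h, ih, pow_succ']

theorem Otilde_PP {w : ℝ} (hw : 1 < w) (hi : Irrational w) {n : ℕ} (hn : 0 < n) (h : TE^[n] w = w) :
    ∃ a b c d : ℤ, OmegaTildeE w = !![a, b; c, d] ∧ PP a b c d ∧ a * d - b * c = 1 ∧ w = mob a b c d w := by
  obtain ⟨h1, h2, -⟩ := per_spec hn h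
  obtain ⟨a, b, c, d, e1, e2, e3⟩ := prod_PP (perE w - 1) w hw hi
  rw [Nat.sub_add_cancel h1] at e1 e3
  rw [h2] at e3
  have hO : OmegaE w = !![a, b; c, d] := e1
  unfold OmegaTildeE
  split_ifs with hd
  · rw [hO, Matrix.det_fin_two_of] at hd
    exact ⟨a, b, c, d, hO, e2, hd, e3⟩
  · obtain ⟨a', b', c', d', f1, f2, f3⟩ := prod_PP (perE w * 2 - 1) w hw hi
    rw [Nat.sub_add_cancel (by omega)] at f1 f3
    have hp : TE^[perE w * 2] w = w := by
      have : Function.IsPeriodicPt TE (perE w) w := h2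
      exact this.mul_const 2
    rw [hp] at f3
    rw [prodM_mul h2] at f1
    have hO2 : OmegaE w ^ 2 = !![a', b'; c', d'] := f1
    refine ⟨a', b', c', d', hO2, f2, ?_, f3⟩
    rw [hO, Matrix.det_fin_two_of] at hd
    rw [← Matrix.det_fin_two_of, ← hO2, Matrix.det_pow, hO, Matrix.det_fin_two_of]
    rcases e2.1 with h | h
    · exact absurd h hd
    · rw [h]; norm_num

theorem fix_pow {a b c d : ℤ} (h : PP a b c d) (hdet : a * d - b * c = 1) {w : ℝ} (hw : 1 < w)
    (hi : Irrational w) (hf : mob a b c d w = w) :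
    ∃ k : ℕ, 0 < k ∧ !![a, b; c, d] = OmegaTildeE w ^ k := by
  obtain ⟨n, hn, h1, h2⟩ := algo c.toNat le_rfl h w hw
  rw [hf] at h1 h2
  obtain ⟨g1, g2, ⟨k, g3⟩⟩ := per_spec hn h1
  rw [g3, prodM_mul g2] at h2
  have hO : OmegaE w ^ k = !![a, b; c, d] := h2
  have hk : 0 < k := by
    rcases Nat.eq_zero_or_pos k with h0 | h0
    · subst h0; omega
    · exact h0
  have hdk : (OmegaE w).det ^ k = 1 := by
    rw [← Matrix.det_pow, hO, Matrix.det_fin_two_of, hdet]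
  unfold OmegaTildeE
  split_ifs with hd
  · exact ⟨k, hk, hO.symm⟩
  · have hd1 : (OmegaE w).det = -1 := by
      obtain ⟨a, b, c, d, e1, e2, e3⟩ := prod_PP (perE w - 1) w hw hi
      rw [Nat.sub_add_cancel g1] at e1
      have hO' : OmegaE w = !![a, b; c, d] := e1
      rw [hO', Matrix.det_fin_two_of] at hd ⊢
      exact e2.1.resolve_left hd
    rw [hd1] at hdk
    have hev : Even k := by
      by_contra hodd
      rw [Nat.not_even_iff_odd] at hodd
      rw [hodd.neg_one_pow] at hdk
      norm_num at hdk
    obtain ⟨j, rfl⟩ := hev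
    refine ⟨j, by omega, ?_⟩
    rw [← hO, ← pow_mul]; congr 1; ring

theorem reduced_fix {w w' : ℝ} (hw : 1 < w) (h : IsConjPair w w') (h1 : -1 < w') (h2 : w' < 1) :
    ∃ a b c d : ℤ, PP a b c d ∧ a * d - b * c = 1 ∧ mob a b c d w = w := by
  obtain ⟨hi, A, B, C, hA, -, e1, e2, hne⟩ := h
  have hA' : (0:ℝ) < A := by exact_mod_cast hA
  have hsum : (A:ℝ) * (w + w') + B = 0 := by
    have : (w' - w) * (A * (w + w') + B) = 0 := by linear_combination e2 - e1
    rcases mul_eq_zero.mp this with h | h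
    · exact absurd (by linarith) hne
    · exact h
  have hf1 : A + B + C < 0 := by
    have : ((A + B + C : ℤ):ℝ) < 0 := by
      have : ((A + B + C : ℤ):ℝ) = -(A * (w - 1) * (1 - w')) := by
        push_cast; linear_combination e1 + (1 - w) * hsum
      rw [this]
      have : 0 < A * (w - 1) * (1 - w') := by
        apply mul_pos (mul_pos hA' (by linarith)) (by linarith)
      linarith
    exact_mod_cast this
  have hf2 : 0 < A - B + C := by
    have : 0 < ((A - B + C : ℤ):ℝ) := by
      have : ((A - B + C : ℤ):ℝ) = A * (w + 1) * (1 + w') := by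
        push_cast; linear_combination e1 + (-1 - w) * hsum
      rw [this]
      apply mul_pos (mul_pos hA' (by linarith)) (by linarith)
    exact_mod_cast this
  have hB : B < 0 := by omega
  have hsq : (2 * A * w + B) ^ 2 = ((B ^ 2 - 4 * A * C : ℤ) : ℝ) := by
    push_cast; linear_combination 4 * A * e1
  have hns : ¬ IsSquare (B ^ 2 - 4 * A * C) := by
    rintro ⟨k, hk⟩
    rw [hk] at hsq
    push_cast at hsq
    have : (2 * A * w + B - k) * (2 * A * w + B + k) = 0 := by linear_combination hsq
    have hir : Irrational (2 * A * w + B) := by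
      have : Irrational (((2 * A : ℤ):ℝ) * w) := hi.intCast_mul (by omega)
      have := this.add_intCast B
      push_cast at this; exact this
    rcases mul_eq_zero.mp this with h | h
    · exact hir.ne_int k (by linarith)
    · exact hir.ne_int (-k) (by push_cast; linarith)
  set D := B ^ 2 - 4 * A * C with hD
  have hD0 : 0 < D := by
    have h0 : (0:ℝ) ≤ D := by rw [← hsq]; positivity
    have h0' : 0 ≤ D := by exact_mod_cast h0
    rcases h0'.lt_or_eq with h | h
    · exact h
    · exact absurd ⟨0, by rw [← h]; ring⟩ hns
  have hns4 : ¬ IsSquare (4 * D) := by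
    rintro ⟨k, hk⟩
    have hev : Even k := by
      have : Even (k * k) := ⟨2 * D, by linarith⟩
      rw [Int.even_mul] at this; tauto
    obtain ⟨j, rfl⟩ := hev
    exact hns ⟨j, by linarith⟩
  obtain ⟨x0, y0, hxy0, hy0⟩ := Pell.exists_of_not_isSquare (by omega : 0 < 4 * D) hns4
  obtain ⟨x, y, hx, hy, hxy⟩ : ∃ x y : ℤ, 0 < x ∧ 0 < y ∧ x ^ 2 - 4 * D * y ^ 2 = 1 := by
    refine ⟨|x0|, |y0|, ?_, abs_pos.mpr hy0, by rw [sq_abs, sq_abs]; exact hxy0⟩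
    rw [abs_pos]; rintro rfl
    nlinarith [sq_nonneg y0]
  have hxo : Odd x := by
    have : Odd (x ^ 2) := ⟨2 * D * y ^ 2, by linarith⟩
    rwa [Int.odd_pow' (by norm_num)] at this
  have hy2 : 1 ≤ y ^ 2 := by nlinarith
  have k1 : |(4 * A + 2 * B) * y| < x := by
    apply abs_lt_of_sq_lt_sq _ hx.le
    have : ((4 * A + 2 * B) * y) ^ 2 = 4 * D * y ^ 2 + 16 * (A * (A + B + C)) * y ^ 2 := by rw [hD]; ring
    rw [this]
    have : A * (A + B + C) < 0 := mul_neg_of_pos_of_neg hA hf1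
    nlinarith
  have k2 : |x| < (4 * A - 2 * B) * y := by
    apply abs_lt_of_sq_lt_sq _ (by apply mul_nonneg <;> linarith)
    have : ((4 * A - 2 * B) * y) ^ 2 = 4 * D * y ^ 2 + 16 * (A * (A - B + C)) * y ^ 2 := by rw [hD]; ring
    rw [this]
    have : 0 < A * (A - B + C) := mul_pos hA hf2
    nlinarith
  rw [abs_lt] at k1 k2
  have hE : ∀ z : ℤ, Even (2 * z) := fun z => ⟨z, by ring⟩
  have hPP : PP (x - 2 * B * y) (-4 * C * y) (4 * A * y) (x + 2 * B * y) := by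
    refine ⟨Or.inl (by rw [hD] at hxy; linarith), by linarith, by linarith, by linarith, Or.inl ⟨?_, ?_, ?_, ?_⟩⟩
    · rw [mul_assoc]; exact hxo.sub_even (hE _)
    · exact ⟨-2 * C * y, by ring⟩
    · exact ⟨2 * A * y, by ring⟩
    · rw [mul_assoc]; exact hxo.add_even (hE _)
  refine ⟨_, _, _, _, hPP, by rw [hD] at hxy; linarith, ?_⟩
  have := (mob_gt hPP w hw).2
  unfold mob
  rw [div_eq_iff this.ne']
  push_cast
  linear_combination (-4 * y) * e1

def rt (a c d : ℤ) : ℝ := ((a:ℝ) - d + Real.sqrt (((a:ℝ) + d) ^ 2 - 4)) / (2 * c)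

theorem PP_tr {a b c d : ℤ} (h : PP a b c d) : 2 ≤ a + d := by
  obtain ⟨-, h2, h3, -⟩ := h; omega

theorem fix_rt {a b c d : ℤ} (h : PP a b c d) (hdet : a * d - b * c = 1) {w : ℝ} (hw : 1 < w)
    (hi : Irrational w) (hf : mob a b c d w = w) : 3 ≤ a + d ∧ w = rt a c d := by
  have h2 := PP_tr h
  have hb := PP_b h
  have hpos := (mob_gt h w hw).2
  have hs := PP_sum h
  obtain ⟨-, k2, k3, k4, -⟩ := h
  have hc : 0 < c := by omega
  have hc' : (0:ℝ) < c := by exact_mod_cast hc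
  unfold mob at hf
  rw [div_eq_iff hpos.ne'] at hf
  have hdet' : (a:ℝ) * d - b * c = 1 := by exact_mod_cast hdet
  have hsq : (2 * c * w - (a - d)) ^ 2 = ((a:ℝ) + d) ^ 2 - 4 := by
    linear_combination (-4 * (c:ℝ)) * hf - 4 * hdet'
  have hir : Irrational (2 * c * w - (a - d)) := by
    have : Irrational (((2 * c : ℤ):ℝ) * w) := hi.intCast_mul (by omega)
    have := this.sub_intCast (a - d)
    push_cast at this; exact this
  constructor
  · by_contra hcon
    have ht : a + d = 2 := by omega
    have ht' : (a:ℝ) + d = 2 := by exact_mod_cast ht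
    rw [ht'] at hsq
    have : 2 * c * w - (a - d) = 0 := by
      have : (2 * c * w - ((a:ℝ) - d)) ^ 2 = 0 := by rw [hsq]; norm_num
      exact pow_eq_zero_iff (by norm_num) |>.mp this
    exact hir.ne_zero this
  · unfold rt
    rw [← hsq, Real.sqrt_sq_eq_abs]
    have hpos2 : 0 < 2 * c * w - ((a:ℝ) - d) := by
      by_contra hcon
      push Not at hcon
      have hs' : (0:ℝ) ≤ a - c + b - d := by exact_mod_cast hs
      have : (c:ℝ) + d - a - b = (w - 1) * (a - d - c * w - c) := by linear_combination -hf
      have h5 : 0 < (a:ℝ) - d - c * w - c := by nlinarith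
      have h6 := mul_pos (sub_pos.mpr hw) h5
      linarith
    rw [abs_of_pos hpos2]
    field_simp
    ring

set_option maxHeartbeats 1000000 in
theorem rt_spec {a b c d : ℤ} (h : PP a b c d) (hdet : a * d - b * c = 1) (ht : 3 ≤ a + d) :
    1 < rt a c d ∧ mob a b c d (rt a c d) = rt a c d ∧ (∃ w', IsConjPair (rt a c d) w' ∧ -1 < w' ∧ w' < 1) ∧
    c * rt a c d < a ∧ a < c * rt a c d + 1 := by
  have hb := PP_b h
  have hs := PP_sum h
  have hPP := h
  obtain ⟨-, k2, k3, k4, -⟩ := h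
  have hc : 0 < c := by omega
  have hc' : (0:ℝ) < c := by exact_mod_cast hc
  have hdet' : (a:ℝ) * d - b * c = 1 := by exact_mod_cast hdet
  have ht' : (3:ℝ) ≤ a + d := by exact_mod_cast ht
  set s := Real.sqrt (((a:ℝ) + d) ^ 2 - 4) with hsdef
  have hs2 : s ^ 2 = ((a:ℝ) + d) ^ 2 - 4 := Real.sq_sqrt (by nlinarith)
  have hs0 : 0 ≤ s := Real.sqrt_nonneg _
  have hirs : Irrational s := by
    have : Irrational (Real.sqrt (((a + d) ^ 2 - 4 : ℤ):ℝ)) := by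
      rw [irrational_sqrt_intCast_iff]
      refine ⟨?_, by nlinarith⟩
      rintro ⟨k, hk⟩
      have hk2 : |k| * |k| = (a + d) ^ 2 - 4 := by rw [abs_mul_abs_self, hk]
      have hk0 := abs_nonneg k
      have h1 : |k| < a + d := by nlinarith
      have h2 : a + d - 1 ≤ |k| ∨ |k| ≤ a + d - 2 := by omega
      rcases h2 with h2 | h2 <;> nlinarith
    push_cast at this; exact this
  have hs1 : s < a + d := by nlinarith
  have hs3 : (a:ℝ) + d - 2 < s := by nlinarith
  have hspos : 0 < s := by linarith
  have hw : rt a c d = ((a:ℝ) - d + s) / (2 * c) := rfl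
  set w := rt a c d with hwdef
  have hcw : 2 * c * w = a - d + s := by rw [hw]; field_simp
  obtain ⟨w', hw'⟩ : ∃ w' : ℝ, w' = ((a:ℝ) - d - s) / (2 * c) := ⟨_, rfl⟩
  have hcw' : 2 * c * w' = a - d - s := by rw [hw']; field_simp
  have hi : Irrational w := by
    intro ⟨q, hq⟩
    apply hirs
    refine ⟨2 * c * q - (a - d), ?_⟩
    push_cast; rw [hq]; linarith
  have e1 : (c:ℝ) * w ^ 2 + (d - a) * w - b = 0 := by
    have : 4 * (c:ℝ) * (c * w ^ 2 + (d - a) * w - b) = 0 := by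
      have : 4 * (c:ℝ) * (c * w ^ 2 + (d - a) * w - b) = (2 * c * w) ^ 2 + 2 * (d - a) * (2 * c * w) - 4 * (b * c) := by ring
      rw [this, hcw]; linear_combination hs2 + 4 * hdet'
    rcases mul_eq_zero.mp this with h | h
    · linarith
    · exact h
  have e2 : (c:ℝ) * w' ^ 2 + (d - a) * w' - b = 0 := by
    have : 4 * (c:ℝ) * (c * w' ^ 2 + (d - a) * w' - b) = 0 := by
      have : 4 * (c:ℝ) * (c * w' ^ 2 + (d - a) * w' - b) = (2 * c * w') ^ 2 + 2 * (d - a) * (2 * c * w') - 4 * (b * c) := by ring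
      rw [this, hcw']; linear_combination hs2 + 4 * hdet'
    rcases mul_eq_zero.mp this with h | h
    · linarith
    · exact h
  have hlt : w' < w := by
    have : 2 * c * w' < 2 * c * w := by linarith
    exact lt_of_mul_lt_mul_left this (by positivity)
  have hne1 : w ≠ 1 := by exact_mod_cast hi.ne_nat 1
  have hs' : (0:ℝ) ≤ a - c + b - d := by exact_mod_cast hs
  have hprod : ∀ X : ℝ, (c:ℝ) * X ^ 2 + (d - a) * X - b = c * (X - w) * (X - w') := by
    intro X
    have hsum : (c:ℝ) * (w + w') = a - d := by linarith
    linear_combination (X - w) * hsum + e1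
  have hsumne : a - c + b - d ≠ 0 := by
    intro h0
    have h0' : (a:ℝ) - c + b - d = 0 := by exact_mod_cast h0
    have h1 := hprod 1
    have h2 : c * (1 - w) * (1 - w') = 0 := by rw [← h1]; linarith
    have : w' = 1 := by
      rcases mul_eq_zero.mp h2 with h | h
      · rcases mul_eq_zero.mp h with h | h
        · linarith
        · exact absurd (by linarith) hne1
      · linarith
    rw [this] at hcw'
    apply hirs.ne_int (a - d - 2 * c)
    push_cast; linarith
  have hsum1 : (1:ℝ) ≤ a - c + b - d := by
    have : 1 ≤ a - c + b - d := by omega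
    exact_mod_cast this
  have h1 : c * (1 - w) * (1 - w') < 0 := by rw [← hprod]; linarith
  have hb1 : (b:ℝ) < a := by exact_mod_cast hb.2
  have hd1 : (d:ℝ) < c := by exact_mod_cast k4
  have h2 : 0 < c * (-1 - w) * (-1 - w') := by rw [← hprod]; linarith
  have h1' : (1 - w) * (1 - w') < 0 := by
    rw [mul_assoc] at h1; exact (pos_iff_neg_of_mul_neg h1).mp hc'
  have h2' : 0 < (-1 - w) * (-1 - w') := by
    rw [mul_assoc] at h2; exact pos_of_mul_pos_right h2 hc'.le
  have hw1 : 1 < w := by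
    by_contra hcon; push Not at hcon
    have := mul_nonneg (sub_nonneg.mpr hcon) (by linarith : 0 ≤ 1 - w')
    linarith
  have hw'1 : w' < 1 := by
    by_contra hcon; push Not at hcon
    have := mul_nonneg_of_nonpos_of_nonpos (by linarith : 1 - w ≤ 0) (by linarith : 1 - w' ≤ 0)
    linarith
  have hw'2 : -1 < w' := by
    by_contra hcon; push Not at hcon
    have := mul_nonpos_of_nonpos_of_nonneg (by linarith : -1 - w ≤ 0) (by linarith : 0 ≤ -1 - w')
    linarith
  refine ⟨hw1, ?_, ⟨w', ⟨hi, ?_⟩, hw'2, hw'1⟩, by linarith, by linarith⟩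
  · have := (mob_gt hPP w hw1).2
    unfold mob
    rw [div_eq_iff this.ne']
    linear_combination -e1
  · set g : ℤ := (Int.gcd (Int.gcd c (d - a) : ℤ) (-b) : ℤ) with hg
    have hg0 : 0 < g := by
      rw [hg]
      have : Int.gcd (Int.gcd c (d - a) : ℤ) (-b) ≠ 0 := by
        intro h; rw [Int.gcd_eq_zero_iff] at h
        have := h.1
        have h3 : Int.gcd c (d - a) = 0 := by exact_mod_cast this
        rw [Int.gcd_eq_zero_iff] at h3; omega
      positivity
    have d1 : g ∣ c := (Int.gcd_dvd_left ..).trans (Int.gcd_dvd_left ..)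
    have d2 : g ∣ d - a := (Int.gcd_dvd_left ..).trans (Int.gcd_dvd_right ..)
    have d3 : g ∣ -b := Int.gcd_dvd_right ..
    obtain ⟨A, hA⟩ := d1
    obtain ⟨B, hB⟩ := d2
    obtain ⟨C, hC⟩ := d3
    have hgr : (g:ℝ) ≠ 0 := by exact_mod_cast hg0.ne'
    have hAr : (c:ℝ) = g * A := by exact_mod_cast hA
    have hBr : (d:ℝ) - a = g * B := by exact_mod_cast hB
    have hCr : -(b:ℝ) = g * C := by exact_mod_cast hC
    refine ⟨A, B, C, by nlinarith, ?_, ?_, ?_, hlt.ne⟩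
    · have : g = g.natAbs * (Int.gcd (Int.gcd A B : ℤ) C : ℤ) := by
        conv_lhs => rw [hg, hA, hB, hC, Int.gcd_mul_left]
        push_cast
        conv_lhs => rw [abs_of_pos hg0, Int.gcd_mul_left]
        push_cast; rfl
      rw [Int.natCast_natAbs, abs_of_pos hg0] at this
      have h5 : (Int.gcd (Int.gcd A B : ℤ) C : ℤ) = 1 := by
        have : g * ((Int.gcd (Int.gcd A B : ℤ) C : ℤ) - 1) = 0 := by linarith
        rcases mul_eq_zero.mp this with h | h
        · omega
        · linarith
      exact_mod_cast h5
    · apply mul_left_cancel₀ hgr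
      rw [mul_zero]
      linear_combination e1 - w ^ 2 * hAr - w * hBr - hCr
    · apply mul_left_cancel₀ hgr
      rw [mul_zero]
      linear_combination e2 - w' ^ 2 * hAr - w' * hBr - hCr

end
end KL

end ModE2

section ModE3

open Finset
namespace KL
noncomputable section

theorem sq_CH {a b c d : ℤ} (hdet : a * d - b * c = 1) :
    (!![a, b; c, d] * !![a, b; c, d] : Matrix (Fin 2) (Fin 2) ℤ) = (a + d) • !![a, b; c, d] - 1 := by
  ext i j
  fin_cases i <;> fin_cases j <;> simp [Matrix.mul_apply, Fin.sum_univ_two] <;> linarith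

theorem tr_rec {a b c d : ℤ} (hdet : a * d - b * c = 1) (k : ℕ) :
    ((!![a, b; c, d] : Matrix (Fin 2) (Fin 2) ℤ) ^ (k + 2)).trace =
      (a + d) * (!![a, b; c, d] ^ (k + 1)).trace - (!![a, b; c, d] ^ k).trace := by
  rw [pow_add, sq, sq_CH hdet, mul_sub, mul_one, Matrix.trace_sub, Matrix.mul_smul, Matrix.trace_smul, pow_succ]
  rfl

theorem tr_grow {a b c d : ℤ} (hdet : a * d - b * c = 1) (ht : 3 ≤ a + d) (k : ℕ) :
    ((!![a, b; c, d] : Matrix (Fin 2) (Fin 2) ℤ) ^ k).trace ≤ (!![a, b; c, d] ^ (k + 1)).trace ∧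
    2 ^ k ≤ ((!![a, b; c, d] : Matrix (Fin 2) (Fin 2) ℤ) ^ k).trace ∧
    2 ^ (k + 1) ≤ ((!![a, b; c, d] : Matrix (Fin 2) (Fin 2) ℤ) ^ (k + 1)).trace := by
  induction k with
  | zero => simp [Matrix.trace_fin_two]; omega
  | succ k ih =>
    have h := tr_rec hdet k
    set x := ((!![a, b; c, d] : Matrix (Fin 2) (Fin 2) ℤ) ^ k).trace
    set y := ((!![a, b; c, d] : Matrix (Fin 2) (Fin 2) ℤ) ^ (k+1)).trace
    obtain ⟨h1, h2, h3⟩ := ih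
    have hy : 0 < y := lt_of_lt_of_le (by positivity) h3
    have h4 : 2 * y ≤ (a + d) * y - x := by nlinarith
    rw [show k + 1 + 1 = k + 2 by ring, h]
    refine ⟨by linarith, h3, ?_⟩
    calc (2:ℤ) ^ (k + 2) = 2 * 2 ^ (k + 1) := by ring
      _ ≤ _ := by linarith

theorem tr_sq {a b c d : ℤ} (hdet : a * d - b * c = 1) (ht : 3 ≤ a + d) (k : ℕ) (hk : 2 ≤ k) :
    (a + d) ^ 2 - 2 ≤ ((!![a, b; c, d] : Matrix (Fin 2) (Fin 2) ℤ) ^ k).trace := by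
  have hm : Monotone (fun k : ℕ => ((!![a, b; c, d] : Matrix (Fin 2) (Fin 2) ℤ) ^ k).trace) :=
    monotone_nat_of_le_succ fun k => (tr_grow hdet ht k).1
  have h := hm hk
  have h2 := tr_rec hdet 0
  simp [Matrix.trace_fin_two] at h2
  simp [Matrix.trace_fin_two, -Matrix.trace_fin_two_of] at h ⊢
  have h3 : ((!![a, b; c, d] : Matrix (Fin 2) (Fin 2) ℤ) ^ 2) 0 0 + ((!![a, b; c, d] : Matrix (Fin 2) (Fin 2) ℤ) ^ 2) 1 1 = (a + d) ^ 2 - 2 := by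
    rw [h2]; ring
  linarith

theorem rho_iff {w : ℝ} {a b c d : ℤ} (hO : OmegaTildeE w = !![a, b; c, d]) (ht : 3 ≤ a + d) {R : ℝ} (hR : 0 < R) :
    rhoE w ≤ R ↔ (a:ℝ) + d ≤ Real.exp (R / 2) + Real.exp (-(R / 2)) := by
  have ht' : (3:ℝ) ≤ a + d := by exact_mod_cast ht
  unfold rhoE specRad
  rw [hO, Matrix.trace_fin_two_of]
  push_cast
  set t := (a:ℝ) + d
  have hs0 := Real.sqrt_nonneg (t ^ 2 - 4)
  have hE : 1 < Real.exp (R / 2) := Real.one_lt_exp_iff.mpr (by linarith)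
  have hE1 : Real.exp (R / 2) * Real.exp (-(R / 2)) = 1 := by rw [← Real.exp_add]; simp
  set E := Real.exp (R / 2) with hEdef
  set F := Real.exp (-(R / 2))
  have hF : F < E := by nlinarith
  have h1 : 2 * Real.log ((t + Real.sqrt (t ^ 2 - 4)) / 2) ≤ R ↔ (t + Real.sqrt (t ^ 2 - 4)) / 2 ≤ E := by
    rw [hEdef, ← Real.log_le_iff_le_exp (by linarith)]
    constructor <;> intro h <;> linarith
  rw [h1]
  have h2 : (t + Real.sqrt (t ^ 2 - 4)) / 2 ≤ E ↔ Real.sqrt (t ^ 2 - 4) ≤ 2 * E - t := by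
    constructor <;> intro h <;> linarith
  rw [h2, Real.sqrt_le_iff]
  constructor
  · rintro ⟨h3, h4⟩
    have : E * t ≤ E * (E + F) := by nlinarith
    exact le_of_mul_le_mul_left this (by linarith)
  · intro h
    refine ⟨by linarith, ?_⟩
    have : E * t ≤ E * (E + F) := by gcongr
    nlinarith

def GS (α N : ℝ) : Set (ℤ × ℤ × ℤ) := {p | 0 < p.1 ∧ -p.1 < p.2.1 ∧ p.2.1 < p.1 ∧ α * p.1 ≤ p.2.2 ∧
  (p.2.2 : ℝ) + p.2.1 ≤ N ∧ Pc p.1 p.2.2 p.2.1}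

theorem Pc_PP {a c d : ℤ} (h1 : c < a) (h2 : -c < d) (h3 : d < c) :
    Pc c a d ↔ ∃ b, PP a b c d ∧ a * d - b * c = 1 := by
  constructor
  · rintro (⟨hc, b, hb⟩ | ⟨hc, ha, hd, b, hb⟩)
    · have e : a * d - (2 * b) * c = 1 := by linarith
      refine ⟨2 * b, ⟨Or.inl e, h1, h2, h3, Or.inl ?_⟩, e⟩
      have : Odd (a * d) := ⟨b * c, by linarith⟩
      rw [Int.odd_mul] at this
      exact ⟨this.1, by simp, hc, this.2⟩
    · have e : a * d - b * c = 1 := by linarith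
      refine ⟨b, ⟨Or.inl e, h1, h2, h3, Or.inr ⟨ha, ?_, hc, hd⟩⟩, e⟩
      have : Odd (b * c) := by
        rw [show b * c = a * d - 1 by linarith]
        exact (ha.mul_right d).sub_odd odd_one
      exact (Int.odd_mul.mp this).1
  · rintro ⟨b, ⟨-, -, -, -, h5⟩, e⟩
    rcases h5 with ⟨g1, ⟨j, g2⟩, g3, g4⟩ | ⟨g1, g2, g3, g4⟩
    · left; exact ⟨g3, j, by rw [g2] at e; linarith⟩
    · right; exact ⟨g3, g1, g4, b, by linarith⟩

theorem GS_PP {α N : ℝ} (hα : 1 < α) {p : ℤ × ℤ × ℤ} (hp : p ∈ GS α N) :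
    ∃ b, PP p.2.2 b p.1 p.2.1 ∧ p.2.2 * p.2.1 - b * p.1 = 1 := by
  obtain ⟨h1, h2, h3, h4, h5, h6⟩ := hp
  have h1' : (0:ℝ) < p.1 := by exact_mod_cast h1
  have : (p.1:ℝ) < p.2.2 := by nlinarith
  exact (Pc_PP (by exact_mod_cast this) h2 h3).mp h6

theorem GS_c {α N : ℝ} (hα : 1 < α) {X : ℕ} (hX : N / (α - 1) ≤ X) {p : ℤ × ℤ × ℤ} (hp : p ∈ GS α N) :
    1 ≤ p.1 ∧ p.1 ≤ X := by
  obtain ⟨h1, h2, h3, h4, h5, h6⟩ := hp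
  refine ⟨h1, ?_⟩
  have h2' : -(p.1:ℝ) < p.2.1 := by exact_mod_cast h2
  have : (p.1:ℝ) * (α - 1) ≤ N := by nlinarith
  have h7 : (p.1:ℝ) ≤ N / (α - 1) := by rw [le_div_iff₀ (by linarith)]; exact this
  have : (p.1:ℝ) ≤ (X:ℤ) := by push_cast; linarith
  exact_mod_cast this

open Classical in
theorem GS_card {α N : ℝ} (hα : 1 < α) {X : ℕ} (hX : N / (α - 1) ≤ X) :
    (GS α N).Finite ∧ (GS α N).ncard = ∑ c ∈ Icc 1 X, Dc α N c := by
  set T : Finset (Σ _ : ℕ, Σ _ : ℤ, ℤ) := (Icc 1 X).sigma fun c => (Ioo (-(c:ℤ)) c).sigma fun d =>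
    (Icc ⌈α * c⌉ (⌊N⌋ - d)).filter (fun a : ℤ => Pc c a d) with hT
  let f : (Σ _ : ℕ, Σ _ : ℤ, ℤ) → ℤ × ℤ × ℤ := fun x => ((x.1:ℤ), x.2.1, x.2.2)
  have hf : Function.Injective f := by
    rintro ⟨c, d, a⟩ ⟨c', d', a'⟩ h
    simp only [f, Prod.mk.injEq, Nat.cast_inj] at h
    obtain ⟨rfl, rfl, rfl⟩ := h
    rfl
  have hG : GS α N = ((T.image f : Finset (ℤ × ℤ × ℤ)) : Set (ℤ × ℤ × ℤ)) := by
    ext ⟨c, d, a⟩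
    simp only [coe_image, Set.mem_image, Finset.mem_coe]
    constructor
    · intro hp
      have hc := GS_c hα hX hp
      obtain ⟨h1, h2, h3, h4, h5, h6⟩ := hp
      simp only at h1 h2 h3 h4 h5 h6 hc
      refine ⟨⟨c.toNat, d, a⟩, ?_, ?_⟩
      · have hcc : ((c.toNat : ℕ) : ℤ) = c := Int.toNat_of_nonneg h1.le
        have hcr : ((c.toNat : ℕ) : ℝ) = c := by exact_mod_cast hcc
        simp only [hT, mem_sigma, mem_Icc, mem_Ioo, mem_filter, hcc, hcr]
        refine ⟨by omega, ⟨h2, h3⟩, ⟨Int.ceil_le.mpr h4, ?_⟩, h6⟩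
        have : a + d ≤ ⌊N⌋ := Int.le_floor.mpr (by push_cast; exact h5)
        omega
      · simp only [f, Int.toNat_of_nonneg h1.le]
    · rintro ⟨⟨c', d', a'⟩, hx, he⟩
      simp only [f, Prod.mk.injEq] at he
      obtain ⟨rfl, rfl, rfl⟩ := he
      simp only [hT, mem_sigma, mem_Icc, mem_Ioo, mem_filter] at hx
      obtain ⟨⟨h1, h2⟩, ⟨h3, h4⟩, ⟨h5, h6⟩, h7⟩ := hx
      refine ⟨by simp only; omega, h3, h4, ?_, ?_, h7⟩
      · exact_mod_cast Int.ceil_le.mp h5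
      · have : a' + d' ≤ ⌊N⌋ := by omega
        have := Int.le_floor.mp this
        push_cast at this; exact this
  refine ⟨by rw [hG]; exact Finset.finite_toSet _, ?_⟩
  rw [hG, Set.ncard_coe_finset, card_image_of_injective _ hf, hT, card_sigma]
  apply sum_congr rfl
  intro c _
  rw [card_sigma]
  rfl

theorem B1_card {α N : ℝ} (hα : 1 < α) {X : ℕ} (hX : N / (α - 1) ≤ X) :
    ({p ∈ GS α N | p.2.2 + p.2.1 = 2}).ncard ≤ X := by
  have := Set.ncard_le_ncard_of_injOn (s := {p ∈ GS α N | p.2.2 + p.2.1 = 2}) (t := ((Icc (1:ℤ) X : Finset ℤ) : Set ℤ))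
    (fun p => p.1) ?_ ?_ (Finset.finite_toSet _)
  · rw [Set.ncard_coe_finset] at this
    simpa using this
  · intro p hp
    simpa using GS_c hα hX hp.1
  · rintro ⟨c, d, a⟩ ⟨hp, ht⟩ ⟨c', d', a'⟩ ⟨hp', ht'⟩ (he : c = c')
    subst he
    obtain ⟨b, hb, -⟩ := GS_PP hα hp
    obtain ⟨b', hb', -⟩ := GS_PP hα hp'
    obtain ⟨-, h2, h3, h4, -⟩ := hb
    obtain ⟨-, h2', h3', h4', -⟩ := hb'
    simp only at *
    simp only [Prod.mk.injEq, true_and]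
    omega

theorem B2_card {α N : ℝ} (hα : 1 < α) {X : ℕ} (hX : N / (α - 1) ≤ X) :
    ({p ∈ GS α N | (p.2.2:ℝ) < α * p.1 + 1}).ncard ≤ 2 * X := by
  have := Set.ncard_le_ncard_of_injOn (s := {p ∈ GS α N | (p.2.2:ℝ) < α * p.1 + 1})
    (t := ((Icc (1:ℤ) X ×ˢ (Finset.univ : Finset Bool) : Finset (ℤ × Bool)) : Set (ℤ × Bool)))
    (fun p => (p.1, decide (0 ≤ p.2.1))) ?_ ?_ (Finset.finite_toSet _)
  · rw [Set.ncard_coe_finset, card_product] at this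
    simp at this
    linarith
  · intro p hp
    have h := GS_c hα hX hp.1
    simp only [coe_product, Set.mem_prod, Finset.mem_coe, mem_Icc, mem_univ, and_true]
    exact h
  · rintro ⟨c, d, a⟩ ⟨hp, ht⟩ ⟨c', d', a'⟩ ⟨hp', ht'⟩ he
    simp only [Prod.mk.injEq, decide_eq_decide] at he
    obtain ⟨rfl, hdd⟩ := he
    obtain ⟨b, ⟨-, h2, h3, h4, -⟩, hdet⟩ := GS_PP hα hp
    obtain ⟨b', ⟨-, h2', h3', h4', -⟩, hdet'⟩ := GS_PP hα hp'
    have k1 := hp.2.2.2.1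
    have k2 := hp'.2.2.2.1
    simp only at *
    have haa : a = a' := by
      have l1 : (a:ℝ) < a' + 1 := by linarith
      have l2 : (a':ℝ) < a + 1 := by linarith
      have l1' : a < a' + 1 := by exact_mod_cast l1
      have l2' : a' < a + 1 := by exact_mod_cast l2
      omega
    subst haa
    have hdvd : c ∣ d - d' := by
      have hco : IsCoprime c a := ⟨-b, d, by linarith⟩
      apply hco.dvd_of_dvd_mul_left
      exact ⟨b - b', by linarith⟩
    have : d - d' = 0 := by
      apply Int.eq_zero_of_abs_lt_dvd hdvd
      rw [abs_lt]
      by_cases h0 : 0 ≤ d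
      · have := hdd.mp h0
        constructor <;> omega
      · have : ¬ 0 ≤ d' := fun h => h0 (hdd.mpr h)
        constructor <;> omega
    have : d = d' := by omega
    rw [this]

end
end KL

end ModE3

section ModE4

open Finset
namespace KL
noncomputable section

def SS (α R : ℝ) : Set ℝ := {ω : ℝ | 1 < ω ∧ α ≤ ω ∧ rhoE ω ≤ R ∧
          ∃ ω' : ℝ, IsConjPair ω ω' ∧ -1 < ω' ∧ ω' < 1}

def Phi (w : ℝ) : ℤ × ℤ × ℤ := (OmegaTildeE w 1 0, OmegaTildeE w 1 1, OmegaTildeE w 0 0)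

def matOf (q : ℤ × ℤ × ℤ) : Matrix (Fin 2) (Fin 2) ℤ := !![q.2.2, (q.2.2 * q.2.1 - 1) / q.1; q.1, q.2.1]

def powOf (x : (ℤ × ℤ × ℤ) × ℕ) : ℤ × ℤ × ℤ :=
  ((matOf x.1 ^ x.2) 1 0, (matOf x.1 ^ x.2) 1 1, (matOf x.1 ^ x.2) 0 0)

theorem red_spec {w w' : ℝ} (hw : 1 < w) (h : IsConjPair w w') (h1 : -1 < w') (h2 : w' < 1) :
    ∃ a b c d : ℤ, OmegaTildeE w = !![a, b; c, d] ∧ PP a b c d ∧ a * d - b * c = 1 ∧ 3 ≤ a + d ∧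
      w = rt a c d := by
  obtain ⟨a, b, c, d, g1, g2, g3⟩ := reduced_fix hw h h1 h2
  obtain ⟨n, hn, k1, -⟩ := algo c.toNat le_rfl g1 w hw
  rw [g3] at k1
  obtain ⟨a', b', c', d', e1, e2, e3, e4⟩ := Otilde_PP hw h.1 hn k1
  obtain ⟨f1, f2⟩ := fix_rt e2 e3 hw h.1 e4.symm
  exact ⟨a', b', c', d', e1, e2, e3, f1, f2⟩

theorem Phi_inj (α R : ℝ) : Set.InjOn Phi (SS α R) := by
  rintro w ⟨h1, -, -, w', h2, h3, h4⟩ v ⟨k1, -, -, v', k2, k3, k4⟩ he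
  obtain ⟨a, b, c, d, e1, -, -, -, e2⟩ := red_spec h1 h2 h3 h4
  obtain ⟨a', b', c', d', f1, -, -, -, f2⟩ := red_spec k1 k2 k3 k4
  simp only [Phi, e1, f1, Prod.mk.injEq] at he
  simp at he
  obtain ⟨rfl, rfl, rfl⟩ := he
  rw [e2, f2]

theorem Phi_maps {α R : ℝ} (hα : 1 < α) (hR : 0 < R) :
    Phi '' SS α R ⊆ GS α (Real.exp (R / 2) + Real.exp (-(R / 2))) := by
  rintro _ ⟨w, ⟨h1, h0, hr, w', h2, h3, h4⟩, rfl⟩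
  obtain ⟨a, b, c, d, e1, e2, e3, e4, e5⟩ := red_spec h1 h2 h3 h4
  have hPhi : Phi w = (c, d, a) := by simp [Phi, e1]
  rw [hPhi]
  obtain ⟨-, -, -, r1, r2⟩ := rt_spec e2 e3 e4
  rw [← e5] at r1
  have hcd := e2
  obtain ⟨-, k2, k3, k4, -⟩ := hcd
  have hc : 0 < c := by omega
  have hc' : (0:ℝ) < c := by exact_mod_cast hc
  refine ⟨hc, k3, k4, ?_, (rho_iff e1 e4 hR).mp hr, (Pc_PP k2 k3 k4).mpr ⟨b, e2, e3⟩⟩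
  have : α * c ≤ w * c := by gcongr
  simp only
  linarith

theorem diff_sub {α R : ℝ} (hα : 1 < α) (hR : 0 < R) (N : ℝ) (hN : N = Real.exp (R / 2) + Real.exp (-(R / 2)))
    (L K : ℕ) (hL : L = ⌊Real.sqrt (N + 2) * (α / (α - 1))⌋₊) (hK : K = ⌊Real.log N / Real.log 2⌋₊) :
    GS α N \ Phi '' SS α R ⊆ {p ∈ GS α N | p.2.2 + p.2.1 = 2} ∪ {p ∈ GS α N | (p.2.2:ℝ) < α * p.1 + 1} ∪
      (((Icc (1:ℤ) L ×ˢ Icc (-(L:ℤ)) L ×ˢ Icc (1:ℤ) L) ×ˢ Icc 1 K).image powOf : Finset (ℤ × ℤ × ℤ)) := by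
  rintro ⟨c, d, a⟩ ⟨hp, hn⟩
  by_cases h2 : a + d = 2
  · left; left; exact ⟨hp, h2⟩
  obtain ⟨b, hPP, hdet⟩ := GS_PP hα hp
  simp only at hPP hdet
  have ht : 3 ≤ a + d := by have := PP_tr hPP; omega
  obtain ⟨r1, r2, ⟨w', r3, r4, r5⟩, r6, r7⟩ := rt_spec hPP hdet ht
  have hc : (0:ℝ) < c := by exact_mod_cast hp.1
  by_cases hαr : rt a c d < α
  · left; right
    refine ⟨hp, ?_⟩
    simp only
    nlinarith
  push Not at hαr
  right
  set w := rt a c d with hw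
  obtain ⟨a', b', c', d', e1, e2, e3, e4, e5⟩ := red_spec r1 r3 r4 r5
  obtain ⟨k, hk, hpow⟩ := fix_pow hPP hdet r1 r3.1 r2
  have hNle : (a:ℝ) + d ≤ N := hp.2.2.2.2.1
  have hk2 : 2 ≤ k := by
    by_contra hcon
    have hk1 : k = 1 := by omega
    rw [hk1, pow_one] at hpow
    apply hn
    refine ⟨w, ⟨r1, hαr, (rho_iff hpow.symm ht hR).mpr (hN ▸ hNle), w', r3, r4, r5⟩, ?_⟩
    simp [Phi, ← hpow]
  rw [e1] at hpow
  have hc' : 0 < c' := by have := e2.2.2.1; have := e2.2.2.2.1; omega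
  have hmat : matOf (c', d', a') = !![a', b'; c', d'] := by
    unfold matOf
    simp only
    rw [show a' * d' - 1 = b' * c' by linarith, Int.mul_ediv_cancel _ hc'.ne']
  have htr : ((!![a', b'; c', d'] : Matrix (Fin 2) (Fin 2) ℤ) ^ k).trace = a + d := by
    rw [← hpow, Matrix.trace_fin_two_of]
  have t1 := tr_sq e3 e4 k hk2
  have t2 := (tr_grow e3 e4 k).2.1
  rw [htr] at t1 t2
  have hN0 : 0 < N := by rw [hN]; positivity
  have t1' : ((a':ℝ) + d') ^ 2 - 2 ≤ a + d := by exact_mod_cast t1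
  have t2' : (2:ℝ) ^ k ≤ a + d := by exact_mod_cast t2
  have t3 : (a':ℝ) + d' ≤ Real.sqrt (N + 2) := Real.le_sqrt_of_sq_le (by linarith)
  have hkK : k ≤ K := by
    rw [hK]
    apply Nat.le_floor
    rw [le_div_iff₀ (Real.log_pos (by norm_num)), ← Real.log_pow]
    exact Real.log_le_log (by positivity) (by linarith)
  obtain ⟨-, -, -, s1, -⟩ := rt_spec e2 e3 e4
  rw [← e5] at s1
  obtain ⟨-, k2, k3, k4, -⟩ := e2
  have hc'r : (0:ℝ) < c' := by exact_mod_cast hc'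
  have hαc : α * c' < a' := by nlinarith
  have k3' : -(c':ℝ) < d' := by exact_mod_cast k3
  have hαm : 0 < α - 1 := by linarith
  have hcM : (c':ℝ) * (α - 1) ≤ Real.sqrt (N + 2) := by nlinarith
  have haM : (a':ℝ) ≤ Real.sqrt (N + 2) * (α / (α - 1)) := by
    rw [mul_div_assoc', le_div_iff₀ hαm]
    nlinarith
  have haL : a' ≤ L := by
    have : a'.toNat ≤ L := by
      rw [hL]
      apply Nat.le_floor
      have : ((a'.toNat:ℕ):ℝ) = a' := by
        exact_mod_cast Int.toNat_of_nonneg (by omega : 0 ≤ a')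
      rw [this]; exact haM
    omega
  rw [Finset.mem_coe, Finset.mem_image]
  refine ⟨((c', d', a'), k), ?_, ?_⟩
  · simp only [mem_product, mem_Icc]
    omega
  · simp only [powOf, hmat, ← hpow]
    simp

theorem count {α R : ℝ} (hα : 1 < α) (hR : 0 < R) (N : ℝ) (hN : N = Real.exp (R / 2) + Real.exp (-(R / 2)))
    (L K X : ℕ) (hL : L = ⌊Real.sqrt (N + 2) * (α / (α - 1))⌋₊) (hK : K = ⌊Real.log N / Real.log 2⌋₊)
    (hX : N / (α - 1) ≤ X) :
    |((SS α R).ncard : ℝ) - ∑ c ∈ Icc 1 X, (Dc α N c : ℝ)| ≤ 3 * X + L * ((2 * L + 1) * L) * K := by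
  obtain ⟨hfin, hcard⟩ := GS_card (N := N) hα hX
  have hsub : Phi '' SS α R ⊆ GS α N := by rw [hN]; exact Phi_maps hα hR
  have h1 : (Phi '' SS α R).ncard = (SS α R).ncard := Set.ncard_image_of_injOn (Phi_inj α R)
  have h2 := Set.ncard_diff_add_ncard_of_subset hsub hfin
  have h3 := Set.ncard_le_ncard (diff_sub hα hR N hN L K hL hK)
    (((hfin.sep _).union (hfin.sep _)).union (Finset.finite_toSet _))
  have h4 := (h3.trans (Set.ncard_union_le _ _)).trans (Nat.add_le_add_right (Set.ncard_union_le _ _) _)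
  have h5 := B1_card (N := N) hα hX
  have h6 := B2_card (N := N) hα hX
  have h7 : ((((Icc (1:ℤ) L ×ˢ Icc (-(L:ℤ)) L ×ˢ Icc (1:ℤ) L) ×ˢ Icc 1 K).image powOf : Finset (ℤ × ℤ × ℤ)) : Set (ℤ × ℤ × ℤ)).ncard
      ≤ L * ((2 * L + 1) * L) * K := by
    rw [Set.ncard_coe_finset]
    refine Finset.card_image_le.trans (le_of_eq ?_)
    simp only [card_product, Int.card_Icc, Nat.card_Icc]
    congr 1
    congr 1
    · omega
    · congr 1
      · omega
      · omega
  have h8 : (GS α N \ Phi '' SS α R).ncard ≤ 3 * X + L * ((2 * L + 1) * L) * K := by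
    refine h4.trans ?_
    linarith
  have e : (∑ c ∈ Icc 1 X, (Dc α N c : ℝ)) = ((GS α N \ Phi '' SS α R).ncard : ℝ) + (SS α R).ncard := by
    rw [← Nat.cast_sum, ← hcard, ← h2, h1]; push_cast; rfl
  rw [e, abs_sub_comm, add_sub_cancel_right, abs_of_nonneg (Nat.cast_nonneg _)]
  exact_mod_cast h8

end
end KL

end ModE4

section ModE5

open Finset
namespace KL
noncomputable section

set_option maxHeartbeats 2000000 in
theorem final (α : ℝ) (hα : 1 < α) (ε : ℝ) (hε : 0 < ε) : ∃ K > (0 : ℝ), ∀ R > (0 : ℝ),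
    |((SS α R).ncard : ℝ) - Real.exp R / Real.pi ^ 2 * Real.log ((α + 1) / (α - 1))|
      ≤ K * Real.exp ((3 / 4 + ε) * R) := by
  obtain ⟨C1, hC1, H1⟩ := sum_Dc (2 * ε) (by linarith)
  obtain ⟨C2, hC2, H2⟩ := D5 α hα
  have ha : 0 < α - 1 := by linarith
  set l := Real.log ((α + 1) / (α - 1)) with hl
  have hl0 : 0 ≤ l := Real.log_nonneg (by rw [le_div_iff₀ ha]; linarith)
  obtain ⟨κ, hκ⟩ : ∃ κ : ℝ, κ = 1 / (α - 1) + 1 := ⟨_, rfl⟩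
  have hκ1 : 0 < κ := by rw [hκ]; positivity
  obtain ⟨β, hβ⟩ : ∃ β : ℝ, β = α / (α - 1) := ⟨_, rfl⟩
  have hβ0 : 0 < β := by rw [hβ]; positivity
  have hlog2 : 0 < Real.log 2 := Real.log_pos (by norm_num)
  set δ := 2 * ε with hδ
  have hδ0 : 0 < δ := by positivity
  obtain ⟨Q, hQ⟩ : ∃ Q : ℝ, Q = C1 * κ ^ (3/2 + δ) + C2 * (3 * κ ^ (1/2:ℝ)) + 3 * κ +
    3 * β ^ 3 * 3 ^ (3/2:ℝ) / (δ * Real.log 2) + 3 * l := ⟨_, rfl⟩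
  have hQ0 : 0 < Q := by rw [hQ]; positivity
  refine ⟨Q * 2 ^ (3/2 + δ), by positivity, fun R hR => ?_⟩
  have hE1 : 1 < Real.exp (R / 2) := Real.one_lt_exp_iff.mpr (by linarith)
  have hF1 : Real.exp (-(R / 2)) < 1 := Real.exp_lt_one_iff.mpr (by linarith)
  have hF0 : 0 < Real.exp (-(R / 2)) := Real.exp_pos _
  have hEF : Real.exp (R / 2) * Real.exp (-(R / 2)) = 1 := by rw [← Real.exp_add]; simp
  have hER : Real.exp (R / 2) ^ 2 = Real.exp R := by rw [← Real.exp_nat_mul]; congr 1; push_cast; ring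
  obtain ⟨N, hN⟩ : ∃ N : ℝ, N = Real.exp (R / 2) + Real.exp (-(R / 2)) := ⟨_, rfl⟩
  have hN1 : 1 ≤ N := by rw [hN]; linarith
  have hN0 : 0 < N := by linarith
  have hN2 : N ≤ 2 * Real.exp (R / 2) := by rw [hN]; linarith
  obtain ⟨X, hX⟩ : ∃ X : ℕ, X = ⌈N / (α - 1)⌉₊ := ⟨_, rfl⟩
  have hXa : N / (α - 1) ≤ X := by rw [hX]; exact Nat.le_ceil _
  have hXb : (X:ℝ) ≤ N / (α - 1) + 1 := by rw [hX]; exact (Nat.ceil_lt_add_one (by positivity)).le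
  have hX1 : 1 ≤ X := by rw [hX]; exact Nat.one_le_ceil_iff.mpr (by positivity)
  have hX1' : (1:ℝ) ≤ X := by exact_mod_cast hX1
  have hXκ : (X:ℝ) ≤ κ * N := by
    have : κ * N = N / (α - 1) + N := by rw [hκ]; ring
    linarith
  obtain ⟨L, hL⟩ : ∃ L : ℕ, L = ⌊Real.sqrt (N + 2) * (α / (α - 1))⌋₊ := ⟨_, rfl⟩
  obtain ⟨K, hK⟩ : ∃ K : ℕ, K = ⌊Real.log N / Real.log 2⌋₊ := ⟨_, rfl⟩
  have hc := count hα hR N hN L K X hL hK hXa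
  have h1 := H1 α N X
  have h2 := H2 N X hN1 hXa hX1 hXb
  obtain ⟨P, hP⟩ : ∃ P : ℝ, P = N ^ (3/2 + δ) := ⟨_, rfl⟩
  have hP1 : 1 ≤ P := by rw [hP]; exact Real.one_le_rpow hN1 (by positivity)
  have hP32 : N ^ (3/2:ℝ) ≤ P := by rw [hP]; exact Real.rpow_le_rpow_of_exponent_le hN1 (by linarith)
  have hPN : N ≤ P := by
    refine le_trans ?_ hP32
    calc N = N ^ (1:ℝ) := (Real.rpow_one N).symm
      _ ≤ _ := Real.rpow_le_rpow_of_exponent_le hN1 (by norm_num)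
  -- first error
  have b1 : C1 * (X:ℝ) ^ (3/2 + δ) ≤ C1 * κ ^ (3/2 + δ) * P := by
    rw [mul_assoc, hP, ← Real.mul_rpow hκ1.le hN0.le]
    gcongr
  -- second error
  have b2 : C2 * N * (1 + Real.log X) ≤ C2 * (3 * κ ^ (1/2:ℝ)) * P := by
    have u1 : Real.log X ≤ (X:ℝ) ^ (1/2:ℝ) / (1/2) := Real.log_le_rpow_div (by linarith) (by norm_num)
    have u2 : (1:ℝ) ≤ (X:ℝ) ^ (1/2:ℝ) := Real.one_le_rpow hX1' (by norm_num)
    have u3 : (X:ℝ) ^ (1/2:ℝ) ≤ κ ^ (1/2:ℝ) * N ^ (1/2:ℝ) := by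
      rw [← Real.mul_rpow hκ1.le hN0.le]
      gcongr
    have u4 : N * N ^ (1/2:ℝ) = N ^ (3/2:ℝ) := by
      nth_rewrite 1 [← Real.rpow_one N]
      rw [← Real.rpow_add hN0]; norm_num
    calc C2 * N * (1 + Real.log X) ≤ C2 * N * (3 * (κ ^ (1/2:ℝ) * N ^ (1/2:ℝ))) := by
          gcongr; linarith
      _ = C2 * (3 * κ ^ (1/2:ℝ)) * (N * N ^ (1/2:ℝ)) := by ring
      _ ≤ _ := by rw [u4]; gcongr
  have b3 : 3 * (X:ℝ) ≤ 3 * κ * P := by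
    calc 3 * (X:ℝ) ≤ 3 * (κ * N) := by gcongr
      _ = 3 * κ * N := by ring
      _ ≤ _ := by gcongr
  have b4 : (L:ℝ) * ((2 * L + 1) * L) * K ≤ 3 * β ^ 3 * 3 ^ (3/2:ℝ) / (δ * Real.log 2) * P := by
    have u1 : (L:ℝ) * ((2 * L + 1) * L) ≤ 3 * (L:ℝ) ^ 3 := by
      rcases Nat.eq_zero_or_pos L with h | h
      · simp [h]
      · have : (1:ℝ) ≤ L := by exact_mod_cast h
        nlinarith [sq_nonneg (L:ℝ)]
    have u2 : (L:ℝ) ≤ Real.sqrt (N + 2) * β := by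
      rw [hL, ← hβ]; exact Nat.floor_le (by positivity)
    have u3 : (K:ℝ) ≤ N ^ δ / (δ * Real.log 2) := by
      rw [hK]
      refine (Nat.floor_le (by have := Real.log_nonneg hN1; positivity)).trans ?_
      rw [← div_div]
      gcongr
      exact Real.log_le_rpow_div hN0.le hδ0
    have u4 : Real.sqrt (N + 2) ^ 3 ≤ 3 ^ (3/2:ℝ) * N ^ (3/2:ℝ) := by
      rw [← Real.mul_rpow (by norm_num) hN0.le, Real.sqrt_eq_rpow, ← Real.rpow_natCast, ← Real.rpow_mul (by linarith)]
      rw [show (1/2:ℝ) * ((3:ℕ):ℝ) = 3/2 by norm_num]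
      gcongr
      linarith
    have u5 : N ^ (3/2:ℝ) * N ^ δ = P := by rw [hP, Real.rpow_add hN0]
    calc (L:ℝ) * ((2 * L + 1) * L) * K ≤ 3 * (L:ℝ) ^ 3 * K := by gcongr
      _ ≤ 3 * (Real.sqrt (N + 2) * β) ^ 3 * (N ^ δ / (δ * Real.log 2)) := by gcongr
      _ = 3 * (Real.sqrt (N + 2) ^ 3 * β ^ 3) * (N ^ δ / (δ * Real.log 2)) := by ring
      _ ≤ 3 * ((3 ^ (3/2:ℝ) * N ^ (3/2:ℝ)) * β ^ 3) * (N ^ δ / (δ * Real.log 2)) := by gcongr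
      _ = 3 * β ^ 3 * 3 ^ (3/2:ℝ) / (δ * Real.log 2) * (N ^ (3/2:ℝ) * N ^ δ) := by ring
      _ = _ := by rw [u5]
  have b5 : |N ^ 2 / Real.pi ^ 2 * l - Real.exp R / Real.pi ^ 2 * l| ≤ 3 * l * P := by
    have e : N ^ 2 = Real.exp R + 2 + Real.exp (-(R / 2)) ^ 2 := by
      rw [hN, ← hER]; linear_combination 2 * hEF
    rw [show N ^ 2 / Real.pi ^ 2 * l - Real.exp R / Real.pi ^ 2 * l = (N ^ 2 - Real.exp R) / Real.pi ^ 2 * l by ring, e,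
      show Real.exp R + 2 + Real.exp (-(R / 2)) ^ 2 - Real.exp R = 2 + Real.exp (-(R / 2)) ^ 2 by ring,
      abs_of_nonneg (by positivity)]
    have v1 : (2 + Real.exp (-(R / 2)) ^ 2) / Real.pi ^ 2 ≤ 3 := by
      have := Real.pi_gt_three
      rw [div_le_iff₀ (by positivity)]
      nlinarith
    calc _ ≤ 3 * l := by gcongr
      _ = 3 * l * 1 := by ring
      _ ≤ _ := by gcongr
  have hPfin : P ≤ 2 ^ (3/2 + δ) * Real.exp ((3 / 4 + ε) * R) := by
    have : Real.exp ((3 / 4 + ε) * R) = Real.exp (R / 2) ^ (3/2 + δ) := by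
      rw [← Real.exp_mul]; congr 1; rw [hδ]; ring
    rw [this, hP, ← Real.mul_rpow (by norm_num) (Real.exp_pos _).le]
    gcongr
  have key : |((SS α R).ncard : ℝ) - Real.exp R / Real.pi ^ 2 * l| ≤ Q * P := by
    have e : ((SS α R).ncard : ℝ) - Real.exp R / Real.pi ^ 2 * l =
      (((SS α R).ncard : ℝ) - ∑ c ∈ Icc 1 X, (Dc α N c : ℝ)) +
      ((∑ c ∈ Icc 1 X, (Dc α N c : ℝ)) - ∑ c ∈ Icc 1 X, Mc α N c) +
      ((∑ c ∈ Icc 1 X, Mc α N c) - N ^ 2 / Real.pi ^ 2 * l) +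
      (N ^ 2 / Real.pi ^ 2 * l - Real.exp R / Real.pi ^ 2 * l) := by ring
    rw [e]
    refine (abs_add_le _ _).trans ?_
    have h3 := (abs_add_le (((SS α R).ncard : ℝ) - ∑ c ∈ Icc 1 X, (Dc α N c : ℝ) +
      ((∑ c ∈ Icc 1 X, (Dc α N c : ℝ)) - ∑ c ∈ Icc 1 X, Mc α N c)) ((∑ c ∈ Icc 1 X, Mc α N c) - N ^ 2 / Real.pi ^ 2 * l))
    have h4 := (abs_add_le (((SS α R).ncard : ℝ) - ∑ c ∈ Icc 1 X, (Dc α N c : ℝ))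
      ((∑ c ∈ Icc 1 X, (Dc α N c : ℝ)) - ∑ c ∈ Icc 1 X, Mc α N c))
    have : Q * P = C1 * κ ^ (3/2 + δ) * P + C2 * (3 * κ ^ (1/2:ℝ)) * P + 3 * κ * P +
      3 * β ^ 3 * 3 ^ (3/2:ℝ) / (δ * Real.log 2) * P + 3 * l * P := by rw [hQ]; ring
    rw [this]
    linarith
  calc _ ≤ Q * P := key
    _ ≤ Q * (2 ^ (3/2 + δ) * Real.exp ((3 / 4 + ε) * R)) := by gcongr
    _ = _ := by ring

end
end KL

end ModE5

theorem stmt1 (α : ℝ) (hα : 1 < α) :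
    ∀ ε > (0 : ℝ), ∃ K > (0 : ℝ), ∀ R > (0 : ℝ),
      |({ω : ℝ | 1 < ω ∧ α ≤ ω ∧ rhoE ω ≤ R ∧
          ∃ ω' : ℝ, IsConjPair ω ω' ∧ -1 < ω' ∧ ω' < 1}.ncard : ℝ) -
        Real.exp R / Real.pi ^ 2 * Real.log ((α + 1) / (α - 1))|
      ≤ K * Real.exp ((3 / 4 + ε) * R) := by
  intro ε hε
  exact KL.final α hα ε hε
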